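/- arXiv:1211.0812 — 2 statements merged into one kernel-verified Lean document; each statement's English description precedes it below -/
import Mathlib

section
/- Let E be a Banach lattice and let A and B be positive bounded linear operators on E such that the commutator C = AB − BA is a positive operator. If one of the operators A and B is power-compact, then the commutator C is quasi-nilpotent, i.e., lim_{n→∞} ‖Cⁿ‖^{1/n} = 0. -/
open Filter Topology

set_option linter.unusedSectionVars false

namespace PosComm

section Basics

variable {E : Type*} [NormedAddCommGroup E] [Lattice E] [HasSolidNorm E] [IsOrderedAddMonoid E]
  [NormedSpace ℝ E]

lemma half_smul_nonneg {x : E} (hx : 0 ≤ x) : 0 ≤ (2⁻¹ : ℝ) • x := by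
  apply nsmul_two_semiclosed
  rw [two_nsmul, ← add_smul]
  norm_num
  exact hx

lemma real_smul_nonneg {c : ℝ} (hc : 0 ≤ c) {x : E} (hx : 0 ≤ x) : 0 ≤ c • x := by
  have h1 : ∀ n : ℕ, 0 ≤ ((2⁻¹ : ℝ) ^ n) • x := by
    intro n
    induction n with
    | zero => simpa
    | succ n ih => rw [pow_succ', mul_smul]; exact half_smul_nonneg ih
  have h2 : ∀ n : ℕ, 0 ≤ (((⌊c * 2 ^ n⌋₊ : ℕ) : ℝ) / 2 ^ n) • x := by
    intro n
    have : (((⌊c * 2 ^ n⌋₊ : ℕ) : ℝ) / 2 ^ n) • x = (⌊c * 2 ^ n⌋₊ : ℕ) • (((2⁻¹ : ℝ) ^ n) • x) := by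
      rw [← Nat.cast_smul_eq_nsmul ℝ, smul_smul]; congr 1; rw [inv_pow]; rfl
    rw [this]
    exact nsmul_nonneg (h1 n) _
  have h3 : Tendsto (fun n : ℕ => ((⌊c * 2 ^ n⌋₊ : ℕ) : ℝ) / 2 ^ n) atTop (𝓝 c) :=
    (tendsto_nat_floor_mul_div_atTop hc).comp
      (tendsto_pow_atTop_atTop_of_one_lt (by norm_num : (1 : ℝ) < 2))
  exact isClosed_nonneg.mem_of_tendsto (h3.smul_const x) (Eventually.of_forall h2)

instance : IsOrderedModule ℝ E where
  smul_le_smul_of_nonneg_left c hc x y hxy := by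
    have := real_smul_nonneg hc (sub_nonneg.2 hxy)
    rw [smul_sub] at this
    exact sub_nonneg.1 this
  smul_le_smul_of_nonneg_right x hx c d hcd := by
    have := real_smul_nonneg (sub_nonneg.2 hcd) hx
    rw [sub_smul] at this
    exact sub_nonneg.1 this

lemma abs_real_smul_le (c : ℝ) (x : E) : |c • x| ≤ |c| • |x| := by
  rcases abs_cases c with ⟨h, hc⟩ | ⟨h, hc⟩ <;> rw [h, abs_le']
  · exact ⟨smul_le_smul_of_nonneg_left (le_abs_self x) hc, by
      rw [← smul_neg]; exact smul_le_smul_of_nonneg_left (neg_le_abs x) hc⟩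
  · refine ⟨?_, ?_⟩
    · have := smul_le_smul_of_nonneg_left (neg_le_abs x) (neg_nonneg.2 hc.le)
      rwa [smul_neg, neg_smul, neg_neg] at this
    · rw [← neg_smul]; exact smul_le_smul_of_nonneg_left (le_abs_self x) (neg_nonneg.2 hc.le)

lemma abs_real_smul (c : ℝ) (x : E) : |c • x| = |c| • |x| := by
  apply le_antisymm (abs_real_smul_le c x)
  rcases eq_or_ne c 0 with rfl | hc
  · simp
  have := abs_real_smul_le c⁻¹ (c • x)
  rw [inv_smul_smul₀ hc] at this
  have h2 := smul_le_smul_of_nonneg_left this (abs_nonneg c)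
  rwa [smul_smul, abs_inv, mul_inv_cancel₀ (abs_ne_zero.2 hc), one_smul] at h2

lemma norm_le_of_nonneg_of_le {x y : E} (hx : 0 ≤ x) (hxy : x ≤ y) : ‖x‖ ≤ ‖y‖ :=
  norm_le_norm_of_abs_le_abs (by rwa [abs_of_nonneg hx, abs_of_nonneg (hx.trans hxy)])

/-- A continuous linear operator is positive if it maps the positive cone into itself. -/
def Pos (T : E →L[ℝ] E) : Prop := ∀ x : E, 0 ≤ x → 0 ≤ T x

namespace Pos

variable {S T U V : E →L[ℝ] E}

lemma zero : Pos (0 : E →L[ℝ] E) := fun _ _ => le_rfl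

lemma one : Pos (1 : E →L[ℝ] E) := fun _ hx => hx

lemma add (hS : Pos S) (hT : Pos T) : Pos (S + T) := fun x hx => add_nonneg (hS x hx) (hT x hx)

lemma smul {c : ℝ} (hc : 0 ≤ c) (hT : Pos T) : Pos (c • T) :=
  fun x hx => real_smul_nonneg hc (hT x hx)

lemma mul (hS : Pos S) (hT : Pos T) : Pos (S * T) := fun x hx => hS _ (hT x hx)

lemma pow (hT : Pos T) (n : ℕ) : Pos (T ^ n) := by
  induction n with
  | zero => exact one
  | succ n ih => rw [pow_succ]; exact ih.mul hT

lemma sum {ι : Type*} {s : Finset ι} {f : ι → E →L[ℝ] E} (h : ∀ i ∈ s, Pos (f i)) :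
    Pos (∑ i ∈ s, f i) := by
  classical
  induction s using Finset.induction_on with
  | empty => simpa using zero
  | insert a s ha ih =>
    rw [Finset.sum_insert ha]
    exact (h _ (Finset.mem_insert_self _ _)).add (ih fun i hi => h i (Finset.mem_insert_of_mem hi))

lemma isClosed : IsClosed {T : E →L[ℝ] E | Pos T} := by
  have : {T : E →L[ℝ] E | Pos T} = ⋂ x : {x : E // 0 ≤ x}, {T | 0 ≤ T x.1} := by
    ext T; simp [Pos]
  rw [this]
  refine isClosed_iInter fun x => ?_
  exact isClosed_nonneg.preimage (ContinuousLinearMap.apply ℝ E x.1).continuous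

lemma tsum {f : ℕ → E →L[ℝ] E} (hf : Summable f) (h : ∀ i, Pos (f i)) : Pos (∑' i, f i) :=
  isClosed.mem_of_tendsto hf.hasSum (Eventually.of_forall fun _ => sum fun i _ => h i)

lemma le_apply (h : Pos (T - S)) {x : E} (hx : 0 ≤ x) : S x ≤ T x := by
  have := h x hx
  rwa [sub_apply, sub_nonneg] at this

lemma mono (hT : Pos T) {x y : E} (h : x ≤ y) : T x ≤ T y := by
  have := hT _ (sub_nonneg.2 h)
  rwa [map_sub, sub_nonneg] at this

lemma abs_apply_le (hT : Pos T) (x : E) : |T x| ≤ T |x| := by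
  rw [abs_le']
  exact ⟨hT.mono (le_abs_self x), by rw [← map_neg]; exact hT.mono (neg_le_abs x)⟩

lemma norm_le (hT : Pos T) (h : Pos (U - T)) : ‖T‖ ≤ ‖U‖ := by
  refine T.opNorm_le_bound (norm_nonneg _) fun x => ?_
  calc ‖T x‖ ≤ ‖T |x|‖ := norm_le_norm_of_abs_le_abs (by
        rw [abs_of_nonneg (hT _ (abs_nonneg x))]; exact hT.abs_apply_le x)
    _ ≤ ‖U |x|‖ := norm_le_of_nonneg_of_le (hT _ (abs_nonneg x)) (h.le_apply (abs_nonneg x))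
    _ ≤ ‖U‖ * ‖|x|‖ := U.le_opNorm _
    _ = ‖U‖ * ‖x‖ := by rw [norm_abs_eq_norm]

/-- Domination of positive operators is stable under products. -/
lemma mul_sub_mul (hST : Pos (T - S)) (hUV : Pos (V - U)) (hT : Pos T) (hU : Pos U) :
    Pos (T * V - S * U) := by
  have : T * V - S * U = T * (V - U) + (T - S) * U := by noncomm_ring
  rw [this]
  exact (hT.mul hUV).add (hST.mul hU)

lemma pow_sub_pow (hS : Pos S) (hST : Pos (T - S)) (n : ℕ) : Pos (T ^ n - S ^ n) := by
  have hT : Pos T := by simpa using hST.add hS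
  induction n with
  | zero => simpa using zero
  | succ n ih =>
    rw [pow_succ, pow_succ]
    exact mul_sub_mul ih hST (hT.pow n) hS

lemma sub_trans (h1 : Pos (T - S)) (h2 : Pos (U - T)) : Pos (U - S) := by
  simpa using h2.add h1

end Pos

end Basics

section Resolvent

variable {E : Type*} [NormedAddCommGroup E] [Lattice E] [HasSolidNorm E] [IsOrderedAddMonoid E]
  [NormedSpace ℝ E]

/-- `Q` is a positive resolvent of `T` at `μ`. -/
structure IsPosRes (T : E →L[ℝ] E) (μ : ℝ) (Q : E →L[ℝ] E) : Prop where
  mu_pos : 0 < μ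
  pos : Pos Q
  mul_eq : T * Q = μ • Q - 1
  eq_mul : Q * T = μ • Q - 1

/-- Positive numbers at which `T` has a positive resolvent. -/
def posResSet (T : E →L[ℝ] E) : Set ℝ := {μ | ∃ Q, IsPosRes T μ Q}

/-- The infimum of the numbers with positive resolvent (the spectral radius of `T`). -/
noncomputable def rad (T : E →L[ℝ] E) : ℝ := sInf (posResSet T)

variable {T Q : E →L[ℝ] E} {μ : ℝ}

namespace IsPosRes

lemma expand (h : IsPosRes T μ Q) (m : ℕ) :
    Q = ∑ i ∈ Finset.range m, μ⁻¹ ^ (i + 1) • T ^ i + μ⁻¹ ^ m • (T ^ m * Q) := by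
  induction m with
  | zero => simp
  | succ m ih =>
    rw [Finset.sum_range_succ, pow_succ T m, mul_assoc, h.mul_eq, mul_sub, mul_smul_comm, mul_one,
      smul_sub, smul_smul, pow_succ μ⁻¹ m, mul_assoc, inv_mul_cancel₀ h.mu_pos.ne', mul_one]
    conv_lhs => rw [ih]
    abel

lemma sum_le (hT : Pos T) (h : IsPosRes T μ Q) (m : ℕ) :
    Pos (Q - ∑ i ∈ Finset.range m, μ⁻¹ ^ (i + 1) • T ^ i) := by
  have := h.expand m
  rw [← sub_eq_iff_eq_add'] at this
  rw [this]
  exact ((hT.pow m).mul h.pos).smul (pow_nonneg (inv_nonneg.2 h.mu_pos.le) _)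

lemma pow_le (hT : Pos T) (h : IsPosRes T μ Q) (m : ℕ) : Pos (μ ^ (m + 1) • Q - T ^ m) := by
  have h1 := h.sum_le hT (m + 1)
  rw [Finset.sum_range_succ] at h1
  have h2 : Pos (Q - μ⁻¹ ^ (m + 1) • T ^ m) := by
    have h3 : Pos (∑ i ∈ Finset.range m, μ⁻¹ ^ (i + 1) • T ^ i) :=
      Pos.sum fun i _ => (hT.pow i).smul (pow_nonneg (inv_nonneg.2 h.mu_pos.le) _)
    have h5 := h1.add h3
    rwa [sub_add_eq_sub_sub, sub_add_eq_add_sub, sub_add_cancel] at h5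
  have h4 := h2.smul (pow_nonneg h.mu_pos.le (m + 1))
  rwa [smul_sub, smul_smul, ← mul_pow, mul_inv_cancel₀ h.mu_pos.ne', one_pow, one_smul] at h4

lemma norm_pow_le (hT : Pos T) (h : IsPosRes T μ Q) (m : ℕ) : ‖T ^ m‖ ≤ μ * ‖Q‖ * μ ^ m := by
  refine ((hT.pow m).norm_le (h.pow_le hT m)).trans ?_
  rw [norm_smul, Real.norm_of_nonneg (pow_nonneg h.mu_pos.le _), pow_succ]
  apply le_of_eq; ring

end IsPosRes

variable [CompleteSpace E]

lemma exists_pos_inverse (hT : Pos T) (hs : Summable fun i => T ^ i) :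
    ∃ Q, Pos Q ∧ Q * (1 - T) = 1 ∧ (1 - T) * Q = 1 :=
  ⟨∑' i, T ^ i, Pos.tsum hs hT.pow, hs.tsum_pow_mul_one_sub, hs.one_sub_mul_tsum_pow⟩

lemma mem_posResSet_of_pow_le (hT : Pos T) {M ν : ℝ} (hμ : 0 < μ) (hμν : μ < ν)
    (h : ∀ i, ‖T ^ i‖ ≤ M * μ ^ i) : ν ∈ posResSet T := by
  have hν : 0 < ν := hμ.trans hμν
  have hs : Summable fun i => (ν⁻¹ • T) ^ i := by
    refine Summable.of_norm_bounded (g := fun i => M * (μ / ν) ^ i) ?_ ?_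
    · exact (summable_geometric_of_lt_one (by positivity) ((div_lt_one hν).2 hμν)).mul_left M
    · intro i
      rw [smul_pow, norm_smul, Real.norm_of_nonneg (by positivity), inv_pow, div_pow,
        inv_mul_eq_div, mul_div_assoc']
      gcongr
      exact h i
  obtain ⟨Q, hQ, h1, h2⟩ := exists_pos_inverse (hT.smul (inv_nonneg.2 hν.le)) hs
  refine ⟨ν⁻¹ • Q, hν, hQ.smul (inv_nonneg.2 hν.le), ?_, ?_⟩
  · rw [sub_mul, one_mul, smul_mul_assoc] at h2
    rw [mul_smul_comm, smul_inv_smul₀ hν.ne', ← h2]; abel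
  · rw [mul_sub, mul_one, mul_smul_comm] at h1
    rw [smul_mul_assoc, smul_inv_smul₀ hν.ne', ← h1]; abel

lemma posResSet_nonempty (hT : Pos T) : (posResSet T).Nonempty := by
  refine ⟨‖T‖ + 2, mem_posResSet_of_pow_le (M := 1) (μ := ‖T‖ + 1) hT (by positivity)
    (by linarith) fun i => ?_⟩
  rw [one_mul]
  rcases Nat.eq_zero_or_pos i with rfl | hi
  · rw [pow_zero, pow_zero]; exact ContinuousLinearMap.norm_id_le
  · exact (norm_pow_le' T hi).trans (by gcongr; linarith)

lemma posResSet_bddBelow (T : E →L[ℝ] E) : BddBelow (posResSet T) :=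
  ⟨0, fun _ ⟨_, h⟩ => h.mu_pos.le⟩

lemma rad_nonneg (T : E →L[ℝ] E) : 0 ≤ rad T :=
  Real.sInf_nonneg fun _ ⟨_, h⟩ => h.mu_pos.le

lemma mem_posResSet_of_rad_lt (hT : Pos T) (h : rad T < μ) : μ ∈ posResSet T := by
  obtain ⟨ν, ⟨Q, hQ⟩, hν⟩ := exists_lt_of_csInf_lt (posResSet_nonempty hT) h
  exact mem_posResSet_of_pow_le hT hQ.mu_pos hν (hQ.norm_pow_le hT)

lemma IsPosRes.one_le_sub_mul_norm (h : IsPosRes T μ Q) (hr : 0 < rad T) :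
    1 ≤ (μ - rad T) * ‖Q‖ := by
  by_contra! hlt
  obtain ⟨ε, h1, h2, h3⟩ : ∃ ε, μ - rad T < ε ∧ ε < μ ∧ ε * ‖Q‖ < 1 := by
    have hc : ContinuousAt (fun ε : ℝ => ε * ‖Q‖) (μ - rad T) := by fun_prop
    have h1 := hc.eventually_lt continuousAt_const hlt
    have h2 : ∀ᶠ ε in 𝓝 (μ - rad T), ε < μ := eventually_lt_nhds (by linarith)
    obtain ⟨ε, hε, h4⟩ := ((h1.and h2).filter_mono nhdsWithin_le_nhds |>.and
      (self_mem_nhdsWithin : Set.Ioi (μ - rad T) ∈ 𝓝[>] (μ - rad T))).exists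
    exact ⟨ε, h4, hε.2, hε.1⟩
  have hle : rad T ≤ μ := csInf_le (posResSet_bddBelow T) ⟨Q, h⟩
  have hε : 0 ≤ ε := by linarith
  have hs : Summable fun i => (ε • Q) ^ i := summable_geometric_of_norm_lt_one (by
    rwa [norm_smul, Real.norm_of_nonneg hε])
  obtain ⟨W, hW, hW1, hW2⟩ := exists_pos_inverse (h.pos.smul hε) hs
  have hmem : μ - ε ∈ posResSet T := by
    have hQW : Q * W = W * Q := by
      have h5 : Q * (1 - ε • Q) = (1 - ε • Q) * Q := by
        rw [mul_sub, sub_mul, mul_smul_comm, smul_mul_assoc, mul_one, one_mul]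
      calc Q * W = W * (1 - ε • Q) * Q * W := by rw [hW1, one_mul]
        _ = W * (Q * (1 - ε • Q)) * W := by rw [h5]; noncomm_ring
        _ = W * Q * ((1 - ε • Q) * W) := by noncomm_ring
        _ = W * Q := by rw [hW2, mul_one]
    refine ⟨Q * W, by linarith, h.pos.mul hW, ?_, ?_⟩
    · rw [← mul_assoc, h.mul_eq, sub_mul, one_mul, smul_mul_assoc, sub_smul]
      rw [sub_mul, one_mul, smul_mul_assoc, sub_eq_iff_eq_add] at hW2
      nth_rw 2 [hW2]; abel
    · rw [hQW, mul_assoc, h.eq_mul, mul_sub, mul_one, mul_smul_comm, sub_smul]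
      rw [mul_sub, mul_one, mul_smul_comm, sub_eq_iff_eq_add] at hW1
      nth_rw 2 [hW1]; abel
  have := csInf_le (posResSet_bddBelow T) hmem
  change rad T ≤ _ at this
  linarith

end Resolvent
section Riesz

variable {F : Type*} [NormedAddCommGroup F] [NormedSpace ℝ F]

/-- The operator induced on a quotient by an invariant subspace. -/
def quotMap (N : Submodule ℝ F) (T : F →L[ℝ] F) (h : ∀ x ∈ N, T x ∈ N) : (F ⧸ N) →L[ℝ] (F ⧸ N) :=
  N.liftQL (N.mkQL ∘L T) (fun x hx => by
    simpa using h x hx)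

lemma quotMap_mk (N : Submodule ℝ F) (T : F →L[ℝ] F) (h : ∀ x ∈ N, T x ∈ N) (x : F) :
    quotMap N T h (Submodule.Quotient.mk x) = Submodule.Quotient.mk (T x) := rfl

lemma isCompactOperator_quotMap {N : Submodule ℝ F} {T : F →L[ℝ] F} (h : ∀ x ∈ N, T x ∈ N)
    (hT : IsCompactOperator T) : IsCompactOperator (quotMap N T h) := by
  rw [isCompactOperator_iff_exists_mem_nhds_image_subset_compact] at hT ⊢
  obtain ⟨V, hV, K, hK, hVK⟩ := hT
  refine ⟨N.mkQL '' V, ?_, N.mkQL '' K, hK.image N.mkQL.continuous, ?_⟩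
  · have := (Submodule.isOpenQuotientMap_mkQL N).isOpenMap.image_mem_nhds hV
    simpa using this
  · rintro _ ⟨_, ⟨x, hx, rfl⟩, rfl⟩
    exact ⟨T x, hVK ⟨x, hx, rfl⟩, rfl⟩

lemma exists_ker_pow_succ_le {X : F →L[ℝ] F} (hX : IsCompactOperator X) {ρ : ℝ} (hρ : ρ ≠ 0) :
    ∃ k : ℕ, ∀ x, ((ρ • (1 : F →L[ℝ] F) - X) ^ (k + 1)) x = 0 →
      ((ρ • (1 : F →L[ℝ] F) - X) ^ k) x = 0 := by
  by_contra! hcon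
  set T : F →L[ℝ] F := ρ • (1 : F →L[ℝ] F) - X with hT
  have key : ∀ k : ℕ, ∃ x : F, (T ^ (k + 1)) x = 0 ∧ ‖x‖ ≤ 3 ∧
      ∀ y, (T ^ k) y = 0 → 1 ≤ ‖x - y‖ := by
    intro k
    obtain ⟨x, hx1, hx2⟩ := hcon k
    let W : Submodule ℝ F := (T ^ (k + 1)).ker
    let V : Submodule ℝ W := (T ^ k).ker.comap W.subtype
    have hVc : IsClosed (V : Set W) :=
      (T ^ k).isClosed_ker.preimage continuous_subtype_val
    obtain ⟨x₀, h1, h2⟩ := riesz_lemma_of_norm_lt (c := (2 : ℝ)) (R := 3) (by norm_num)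
      (by norm_num) (F := V) hVc ⟨⟨x, hx1⟩, hx2⟩
    refine ⟨x₀, x₀.2, h1, fun y hy => ?_⟩
    have hyW : y ∈ W := by
      change (T ^ (k + 1)) y = 0
      rw [pow_succ', mul_apply_eq_comp, hy, map_zero]
    exact h2 ⟨y, hyW⟩ hy
  choose x hx1 hx2 hx3 using key
  have hsep : ∀ j m, j < m → |ρ| ≤ ‖X (x m) - X (x j)‖ := by
    intro j m hjm
    have hXT : X = ρ • (1 : F →L[ℝ] F) - T := by rw [hT]; abel
    have hcomm : ∀ y, (T ^ m) (X y) = X ((T ^ m) y) := by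
      intro y
      have hc : Commute (T ^ m) X := by
        rw [hXT]
        exact ((Commute.one_right _).smul_right ρ).sub_right (Commute.pow_self T m)
      exact congrArg (fun S : F →L[ℝ] F => S y) hc.eq
    have h1 : (T ^ m) (T (x m) + X (x j)) = 0 := by
      have h2 : (T ^ m) (x j) = 0 := by
        obtain ⟨d, rfl⟩ := Nat.exists_eq_add_of_le' hjm
        rw [pow_add, mul_apply_eq_comp, hx1, map_zero]
      have h3 : (T ^ m) (T (x m)) = 0 := by
        rw [← mul_apply_eq_comp, ← pow_succ, hx1]
      rw [map_add, h3, hcomm, h2, map_zero, add_zero]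
    have h4 : X (x m) - X (x j) = ρ • (x m - ρ⁻¹ • (T (x m) + X (x j))) := by
      rw [smul_sub, smul_inv_smul₀ hρ, hT]
      simp only [sub_apply, smul_apply, one_apply_eq_self]
      abel
    rw [h4, norm_smul, Real.norm_eq_abs]
    refine le_mul_of_one_le_right (abs_nonneg _) (hx3 m _ ?_)
    rw [map_smul, h1, smul_zero]
  obtain ⟨K, hK, hKX⟩ := hX.image_closedBall_subset_compact 3
  have hmem : ∀ m, X (x m) ∈ K := fun m => hKX ⟨x m, by simpa using hx2 m, rfl⟩
  obtain ⟨a, -, s, hs, hlim⟩ := hK.tendsto_subseq hmem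
  have hcau := hlim.cauchySeq
  rw [Metric.cauchySeq_iff'] at hcau
  obtain ⟨n, hn⟩ := hcau |ρ| (abs_pos.2 hρ)
  have := hn (n + 1) (Nat.le_succ n)
  rw [dist_eq_norm] at this
  exact absurd (hsep (s n) (s (n + 1)) (hs (Nat.lt_succ_self n))) (not_le.2 this)

/-- Riesz decomposition at a nonzero point `ρ`: `h` is the projection complementary to the
generalized eigenspace and `L` inverts `ρ - X` on its range. -/
structure RieszData (X : F →L[ℝ] F) (ρ : ℝ) (k : ℕ) (h L : F →L[ℝ] F) : Prop where
  pow_mul : (ρ • (1 : F →L[ℝ] F) - X) ^ k * (1 - h) = 0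
  mul_eq : (ρ • (1 : F →L[ℝ] F) - X) * L = h
  eq_mul : L * (ρ • (1 : F →L[ℝ] F) - X) = h
  h_mul : h * L = L

lemma exists_rieszData [CompleteSpace F] {X : F →L[ℝ] F} (hX : IsCompactOperator X) {ρ : ℝ}
    (hρ : ρ ≠ 0) : ∃ k h L, RieszData X ρ k h L := by
  obtain ⟨k, hk⟩ := exists_ker_pow_succ_le hX hρ
  set T : F →L[ℝ] F := ρ • (1 : F →L[ℝ] F) - X with hT
  have hXT : Commute (T ^ k) X := by
    have : X = ρ • (1 : F →L[ℝ] F) - T := by rw [hT]; abel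
    rw [this]
    exact ((Commute.one_right _).smul_right ρ).sub_right (Commute.pow_self T k)
  let G : Submodule ℝ F := (T ^ k).ker
  have hG : IsClosed (G : Set F) := (T ^ k).isClosed_ker
  have hXG : ∀ x ∈ G, X x ∈ G := by
    intro x hx
    change (T ^ k) (X x) = 0
    rw [← mul_apply_eq_comp, hXT.eq, mul_apply_eq_comp,
      show (T ^ k) x = 0 from hx, map_zero]
  let Xq := quotMap G X hXG
  have hXq : IsCompactOperator Xq := isCompactOperator_quotMap hXG hX
  have hinj : ¬ Module.End.HasEigenvalue (Xq : Module.End ℝ (F ⧸ G)) ρ := by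
    intro hev
    obtain ⟨q, hq⟩ := hev.exists_hasEigenvector
    obtain ⟨x, rfl⟩ := Submodule.Quotient.mk_surjective G q
    have h1 : (Submodule.Quotient.mk (X x) : F ⧸ G) = ρ • Submodule.Quotient.mk x := hq.apply_eq_smul
    rw [← Submodule.Quotient.mk_smul, eq_comm, Submodule.Quotient.eq] at h1
    have h2 : (T ^ k) (ρ • x - X x) = 0 := h1
    have h3 : (T ^ (k + 1)) x = 0 := by
      rw [pow_succ, mul_apply_eq_comp]
      simpa [hT] using h2
    exact hq.2 ((Submodule.Quotient.mk_eq_zero G).2 (hk x h3))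
  have hres := (hXq.hasEigenvalue_or_mem_resolventSet hρ).resolve_left hinj
  obtain ⟨u, hu⟩ := hres
  let Tq : (F ⧸ G) →L[ℝ] (F ⧸ G) := ρ • 1 - Xq
  have huT : (u : (F ⧸ G) →L[ℝ] (F ⧸ G)) = Tq := by
    rw [hu, Algebra.algebraMap_eq_smul_one]
  let U : (F ⧸ G) →L[ℝ] (F ⧸ G) := ↑u⁻¹
  have hTU : Tq * U = 1 := by rw [← huT]; exact u.mul_inv
  have hUT : U * Tq = 1 := by rw [← huT]; exact u.inv_mul
  let π : F →L[ℝ] (F ⧸ G) := G.mkQL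
  let τ : (F ⧸ G) →L[ℝ] F := G.liftQL (T ^ k) le_rfl
  have hπT : π ∘L T = Tq ∘L π := by
    ext x
    change (Submodule.Quotient.mk (T x) : F ⧸ G) =
      ρ • Submodule.Quotient.mk x - Submodule.Quotient.mk (X x)
    rw [← Submodule.Quotient.mk_smul, ← Submodule.Quotient.mk_sub]
    simp [hT]
  have hτπ : τ ∘L π = T ^ k := by ext x; rfl
  have hTτ : T ∘L τ = τ ∘L Tq := by
    ext q
    obtain ⟨x, rfl⟩ := Submodule.Quotient.mk_surjective G q
    have h1 : Tq (Submodule.Quotient.mk x) = π (T x) :=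
      (congrArg (fun S : F →L[ℝ] (F ⧸ G) => S x) hπT).symm
    change T ((T ^ k) x) = τ (Tq (Submodule.Quotient.mk x))
    rw [h1]
    change (T * T ^ k) x = (T ^ k * T) x
    rw [← pow_succ, ← pow_succ']
  have hπTk : ∀ j, π ∘L (T ^ j) = (Tq ^ j) ∘L π := by
    intro j
    induction j with
    | zero => ext x; rfl
    | succ j ih =>
      calc π ∘L (T ^ (j + 1)) = (π ∘L T ^ j) ∘L T := by rw [pow_succ]; rfl
        _ = (Tq ^ j) ∘L (π ∘L T) := by rw [ih]; rfl
        _ = _ := by rw [hπT, pow_succ]; rfl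
  have hTkτ : ∀ j, (T ^ j) ∘L τ = τ ∘L (Tq ^ j) := by
    intro j
    induction j with
    | zero => ext x; rfl
    | succ j ih =>
      calc (T ^ (j + 1)) ∘L τ = (T ^ j) ∘L (T ∘L τ) := by rw [pow_succ]; rfl
        _ = ((T ^ j) ∘L τ) ∘L Tq := by rw [hTτ]; rfl
        _ = _ := by rw [ih, pow_succ]; rfl
  have hπτ : π ∘L τ = Tq ^ k := by
    ext q
    obtain ⟨x, rfl⟩ := Submodule.Quotient.mk_surjective G q
    exact congrArg (fun S : F →L[ℝ] (F ⧸ G) => S x) (hπTk k)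
  have hc : Commute Tq U := by rw [Commute, SemiconjBy, hTU, hUT]
  have hTUk : Tq ^ k * U ^ k = 1 := by rw [← hc.mul_pow, hTU, one_pow]
  have hUTk : U ^ k * Tq ^ k = 1 := by rw [← hc.symm.mul_pow, hUT, one_pow]
  refine ⟨k, τ ∘L (U ^ k) ∘L π, τ ∘L (U ^ (k + 1)) ∘L π, ?_, ?_, ?_, ?_⟩
  · rw [mul_sub, mul_one, sub_eq_zero]
    calc T ^ k = τ ∘L ((Tq ^ k * U ^ k) ∘L π) := by rw [hTUk, ← hτπ]; rfl
      _ = ((T ^ k) ∘L τ) ∘L ((U ^ k) ∘L π) := by rw [hTkτ]; rfl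
  · calc T * (τ ∘L (U ^ (k + 1)) ∘L π) = (T ∘L τ) ∘L (U ^ (k + 1)) ∘L π := rfl
      _ = τ ∘L (Tq * U * U ^ k) ∘L π := by rw [hTτ, pow_succ' U]; rfl
      _ = _ := by rw [hTU, one_mul]
  · calc (τ ∘L (U ^ (k + 1)) ∘L π) * T = τ ∘L (U ^ (k + 1)) ∘L (π ∘L T) := rfl
      _ = τ ∘L (U ^ k * (U * Tq)) ∘L π := by rw [hπT, pow_succ U]; rfl
      _ = _ := by rw [hUT, mul_one]
  · calc (τ ∘L (U ^ k) ∘L π) * (τ ∘L (U ^ (k + 1)) ∘L π)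
        = τ ∘L (U ^ k) ∘L (π ∘L τ) ∘L (U ^ (k + 1)) ∘L π := rfl
      _ = τ ∘L (U ^ k * Tq ^ k * U ^ (k + 1)) ∘L π := by rw [hπτ]; rfl
      _ = _ := by rw [hUTk, one_mul]

end Riesz
section Riesz

variable {F : Type*} [NormedAddCommGroup F] [NormedSpace ℝ F] {X h L : F →L[ℝ] F} {ρ : ℝ} {k : ℕ}

namespace RieszData

lemma eq_zero_of_apply_eq_smul (H : RieszData X ρ k h L) {μ : ℝ} (hμ : μ ≠ ρ) {x : F}
    (hx : X x = μ • x) : x = (ρ - μ) • L x := by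
  set T : F →L[ℝ] F := ρ • (1 : F →L[ℝ] F) - X with hT
  have hTx : T x = (ρ - μ) • x := by
    rw [hT, sub_smul, ← hx]; rfl
  have hLT : Commute L T := by rw [Commute, SemiconjBy, H.mul_eq, H.eq_mul]
  have hhT : Commute h T := by
    rw [← H.eq_mul]; exact hLT.mul_left (Commute.refl T)
  have h1 : ∀ j, (T ^ j) ((1 - h) x) = (ρ - μ) ^ j • (1 - h) x := by
    intro j
    induction j with
    | zero => simp
    | succ j ih =>
      have h2 : T ((1 - h) x) = (ρ - μ) • (1 - h) x := by
        have hc : Commute T (1 - h) := (Commute.one_right T).sub_right hhT.symm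
        rw [← mul_apply_eq_comp, hc.eq, mul_apply_eq_comp, hTx, map_smul]
      rw [pow_succ, mul_apply_eq_comp, h2, map_smul, ih, smul_smul, pow_succ, mul_comm]
  have h3 : (ρ - μ) ^ k • (1 - h) x = 0 := by
    rw [← h1, ← mul_apply_eq_comp, H.pow_mul]; rfl
  have h4 : (1 - h) x = 0 :=
    (smul_eq_zero.1 h3).resolve_left (pow_ne_zero _ (sub_ne_zero.2 hμ.symm))
  have h5 : x = h x := sub_eq_zero.1 h4
  conv_lhs => rw [h5, ← H.eq_mul, mul_apply_eq_comp, hTx, map_smul]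

end RieszData

lemma finite_eigenvalues [CompleteSpace F] (hX : IsCompactOperator X) {δ : ℝ} (hδ : 0 < δ) :
    {μ : ℝ | δ ≤ μ ∧ Module.End.HasEigenvalue (X : Module.End ℝ F) μ}.Finite := by
  by_contra hinf
  have hsub : {μ : ℝ | δ ≤ μ ∧ Module.End.HasEigenvalue (X : Module.End ℝ F) μ} ⊆
      Set.Icc δ ‖X‖ := by
    rintro μ ⟨h1, h2⟩
    refine ⟨h1, ?_⟩
    obtain ⟨x, hx⟩ := h2.exists_hasEigenvector
    have h3 : X x = μ • x := hx.apply_eq_smul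
    have h4 := X.le_opNorm x
    rw [h3, norm_smul, Real.norm_of_nonneg (hδ.le.trans h1)] at h4
    exact le_of_mul_le_mul_right h4 (norm_pos_iff.2 hx.2)
  obtain ⟨ρ, hρ, hacc⟩ := Set.Infinite.exists_accPt_of_subset_isCompact hinf isCompact_Icc hsub
  obtain ⟨k, h, L, H⟩ := exists_rieszData hX (ρ := ρ) (by linarith [hρ.1])
  rw [accPt_iff_nhds] at hacc
  obtain ⟨μ, ⟨hμ1, -, hμ2⟩, hμρ⟩ := hacc (Metric.ball ρ (1 / (‖L‖ + 1)))
    (Metric.ball_mem_nhds _ (by positivity))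
  obtain ⟨x, hx⟩ := hμ2.exists_hasEigenvector
  have h1 := H.eq_zero_of_apply_eq_smul hμρ (x := x) hx.apply_eq_smul
  have hx0 : 0 < ‖x‖ := norm_pos_iff.2 hx.2
  have h2 : ‖x‖ ≤ |ρ - μ| * (‖L‖ * ‖x‖) := by
    conv_lhs => rw [h1, norm_smul, Real.norm_eq_abs]
    gcongr
    exact L.le_opNorm x
  rw [Metric.mem_ball, Real.dist_eq, abs_sub_comm, lt_div_iff₀ (by positivity)] at hμ1
  nlinarith [abs_nonneg (ρ - μ), norm_nonneg L]

end Riesz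

section KreinRutman

variable {F : Type*} [NormedAddCommGroup F] [Lattice F] [HasSolidNorm F] [IsOrderedAddMonoid F]
  [NormedSpace ℝ F] {X : F →L[ℝ] F} {ρ : ℝ}

lemma exists_eigenvector_of_blowup (hX : IsCompactOperator X) (hρ : 0 < ρ) {μ : ℕ → ℝ}
    (hμ : Tendsto μ atTop (𝓝 ρ)) {w : ℕ → F} (hw : ∀ n, 0 ≤ w n)
    (hw' : Tendsto (fun n => ‖w n‖) atTop atTop) {M : ℝ} (hM : ∀ n, ‖μ n • w n - X (w n)‖ ≤ M) :
    ∃ v, 0 ≤ v ∧ ‖v‖ = 1 ∧ X v = ρ • v ∧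
      ∀ φ : F →L[ℝ] ℝ, (∃ M', ∀ n, |φ (w n)| ≤ M') → φ v = 0 := by
  let u : ℕ → F := fun n => ‖w n‖⁻¹ • w n
  have hinv : Tendsto (fun n => ‖w n‖⁻¹) atTop (𝓝 0) := tendsto_inv_atTop_zero.comp hw'
  have hu0 : ∀ n, 0 ≤ u n := fun n => real_smul_nonneg (inv_nonneg.2 (norm_nonneg _)) (hw n)
  have hu1 : ∀ᶠ n in atTop, ‖u n‖ = 1 := by
    filter_upwards [hw'.eventually_gt_atTop 0] with n hn
    rw [norm_smul, norm_inv, norm_norm, inv_mul_cancel₀ hn.ne']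
  have hule : ∀ n, ‖u n‖ ≤ 1 := fun n => by
    rw [norm_smul, norm_inv, norm_norm]
    exact inv_mul_le_one
  have hlim0 : Tendsto (fun n => μ n • u n - X (u n)) atTop (𝓝 0) := by
    have h1 : ∀ n, μ n • u n - X (u n) = ‖w n‖⁻¹ • (μ n • w n - X (w n)) := by
      intro n
      simp only [u, map_smul, smul_sub]
      rw [smul_comm]
    refine squeeze_zero_norm (a := fun n => ‖w n‖⁻¹ * M) (fun n => ?_) (by simpa using hinv.mul_const M)
    rw [h1, norm_smul, norm_inv, norm_norm]
    gcongr
    exact hM n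
  obtain ⟨K, hK, hKX⟩ := hX.image_closedBall_subset_compact 1
  obtain ⟨a, -, s, hs, hlim⟩ := hK.tendsto_subseq
    (fun n => hKX ⟨u n, by simpa using hule n, rfl⟩ : ∀ n, X (u n) ∈ K)
  have hsat := hs.tendsto_atTop
  have hv : Tendsto (fun n => u (s n)) atTop (𝓝 (ρ⁻¹ • a)) := by
    have h1 := ((hμ.comp hsat).inv₀ hρ.ne').smul (hlim.add (hlim0.comp hsat))
    rw [add_zero] at h1
    refine h1.congr' ?_
    filter_upwards [(hμ.comp hsat).eventually (lt_mem_nhds hρ)] with n hn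
    simp only [Function.comp] at hn ⊢
    rw [add_sub_cancel, inv_smul_smul₀ hn.ne']
  refine ⟨ρ⁻¹ • a, isClosed_nonneg.mem_of_tendsto hv (Eventually.of_forall fun n => hu0 _), ?_, ?_,
    ?_⟩
  · exact tendsto_nhds_unique hv.norm
      (tendsto_const_nhds.congr' ((hsat.eventually hu1).mono fun n hn => hn.symm))
  · rw [smul_inv_smul₀ hρ.ne']
    exact tendsto_nhds_unique ((X.continuous.tendsto _).comp hv) hlim
  · rintro φ ⟨M', hM'⟩
    refine tendsto_nhds_unique ((φ.continuous.tendsto _).comp hv) ?_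
    refine squeeze_zero_norm (a := fun n => ‖w (s n)‖⁻¹ * M') (fun n => ?_)
      (by simpa using (hinv.comp hsat).mul_const M')
    simp only [Function.comp, u, map_smul, smul_eq_mul, norm_mul, norm_inv, norm_norm]
    gcongr
    exact hM' _

lemma IsPosRes.smul_sub {T Q : F →L[ℝ] F} {μ : ℝ} (h : IsPosRes T μ Q) (x : F) :
    μ • Q x - T (Q x) = x := by
  have := congrArg (fun S : F →L[ℝ] F => S x) h.mul_eq
  simp only [mul_apply_eq_comp, sub_apply, smul_apply, one_apply_eq_self] at this
  rw [this]; abel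

lemma IsPosRes.apply_smul_sub {T Q : F →L[ℝ] F} {μ : ℝ} (h : IsPosRes T μ Q) (x : F) :
    Q (μ • x - T x) = x := by
  have := congrArg (fun S : F →L[ℝ] F => S x) h.eq_mul
  simp only [mul_apply_eq_comp, sub_apply, smul_apply, one_apply_eq_self] at this
  rw [map_sub, map_smul, this]; abel

variable [CompleteSpace F]

lemma exists_large_resolvent {T : F →L[ℝ] F} (hT : Pos T) (hr : 0 < rad T) (n : ℕ) :
    ∃ Q x, IsPosRes T (rad T + 1 / (n + 1)) Q ∧ 0 ≤ x ∧ ‖x‖ ≤ 1 ∧ (n : ℝ) < ‖Q x‖ := by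
  have hn : (0 : ℝ) < 1 / (n + 1) := by positivity
  obtain ⟨Q, hQ⟩ := mem_posResSet_of_rad_lt hT (lt_add_of_pos_right (rad T) hn)
  have h1 := hQ.one_le_sub_mul_norm hr
  rw [add_sub_cancel_left, one_div, inv_mul_eq_div, one_le_div (by positivity)] at h1
  obtain ⟨x, hx1, hx2⟩ := Q.exists_lt_apply_of_lt_opNorm (by linarith : (n : ℝ) < ‖Q‖)
  refine ⟨Q, |x|, hQ, abs_nonneg x, by rw [norm_abs_eq_norm]; exact hx1.le, hx2.trans_le ?_⟩
  refine norm_le_norm_of_abs_le_abs ?_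
  rw [abs_of_nonneg (hQ.pos _ (abs_nonneg x))]
  exact hQ.pos.abs_apply_le x

lemma tendsto_add_one_div (a : ℝ) : Tendsto (fun n : ℕ => a + 1 / ((n : ℝ) + 1)) atTop (𝓝 a) := by
  simpa using (tendsto_const_nhds (x := a)).add (tendsto_one_div_add_atTop_nhds_zero_nat (𝕜 := ℝ))

/-- Krein–Rutman. -/
lemma exists_pos_eigenvector (hXp : Pos X) (hX : IsCompactOperator X) (hr : 0 < rad X) :
    ∃ v, 0 ≤ v ∧ ‖v‖ = 1 ∧ X v = rad X • v := by
  choose Q x hQ hx0 hx1 hQx using exists_large_resolvent hXp hr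
  obtain ⟨v, h1, h2, h3, -⟩ := exists_eigenvector_of_blowup hX hr (tendsto_add_one_div (rad X))
    (w := fun n => Q n (x n)) (fun n => (hQ n).pos _ (hx0 n))
    (tendsto_atTop_mono (fun n => (hQx n).le) tendsto_natCast_atTop_atTop) (M := 1)
    (fun n => by rw [(hQ n).smul_sub]; exact hx1 n)
  exact ⟨v, h1, h2, h3⟩

end KreinRutman

section Growth

variable {F : Type*} [NormedAddCommGroup F] [Lattice F] [HasSolidNorm F] [IsOrderedAddMonoid F]
  [NormedSpace ℝ F] {X h L : F →L[ℝ] F} {ρ : ℝ} {k : ℕ}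

/-- The weighted orbit sums of `x` under `X`, measured by `φ`, are bounded. -/
def SumBdd (X : F →L[ℝ] F) (φ : F →L[ℝ] ℝ) (ρ : ℝ) (x : F) : Prop :=
  ∃ M : ℝ, ∀ m : ℕ, ∑ i ∈ Finset.range m, ρ⁻¹ ^ i * φ ((X ^ i) x) ≤ M

lemma RieszData.norm_resolvent_apply_le (H : RieszData X ρ k h L) {R : F →L[ℝ] F} {ε : ℝ}
    (hε : 0 ≤ ε) (hεL : ε * ‖L‖ ≤ 1 / 2) (hR : IsPosRes X (ρ + ε) R) (x : F) :
    ‖R (h x)‖ ≤ 2 * ‖L‖ * ‖x‖ := by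
  have hK : R * h = L - ε • (R * h * L) := by
    ext x
    have h1 : h x = ρ • L x - X (L x) := by
      rw [← H.mul_eq]; rfl
    have h2 : h (L x) = L x := by
      rw [← mul_apply_eq_comp, H.h_mul]
    have h3 := hR.apply_smul_sub (L x)
    simp only [mul_apply_eq_comp, sub_apply, smul_apply]
    rw [h2, h1, eq_sub_iff_add_eq, ← R.map_smul ε, ← R.map_add]
    convert h3 using 2
    rw [add_smul]; abel
  have h1 : ‖R * h‖ ≤ ‖L‖ + ‖R * h‖ * (1 / 2) := by
    calc ‖R * h‖ = ‖L - ε • (R * h * L)‖ := by rw [← hK]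
      _ ≤ ‖L‖ + ‖ε • (R * h * L)‖ := norm_sub_le _ _
      _ ≤ ‖L‖ + ε * (‖R * h‖ * ‖L‖) := by
          rw [norm_smul, Real.norm_of_nonneg hε]
          gcongr
          exact norm_mul_le _ _
      _ = ‖L‖ + ‖R * h‖ * (ε * ‖L‖) := by ring
      _ ≤ _ := by gcongr
  calc ‖R (h x)‖ = ‖(R * h) x‖ := rfl
    _ ≤ ‖R * h‖ * ‖x‖ := ContinuousLinearMap.le_opNorm _ _
    _ ≤ _ := by gcongr; linarith

variable [CompleteSpace F]

lemma sumBdd_of_apply_eq (hXp : Pos X) (hr : 0 < rad X) (H : RieszData X (rad X) k h L)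
    {φ : F →L[ℝ] ℝ} (hφ : ∀ x, 0 ≤ x → 0 ≤ φ x) {x : F} (hx0 : 0 ≤ x) (hx : h x = x) :
    SumBdd X φ (rad X) x := by
  refine ⟨rad X * (‖φ‖ * (2 * ‖L‖ * ‖x‖)), fun m => ?_⟩
  have hcont : Tendsto (fun ε : ℝ => ∑ i ∈ Finset.range m, (rad X + ε)⁻¹ ^ (i + 1) * φ ((X ^ i) x))
      (𝓝[>] 0) (𝓝 (∑ i ∈ Finset.range m, (rad X)⁻¹ ^ (i + 1) * φ ((X ^ i) x))) := by
    refine tendsto_finsetSum _ fun i _ => Tendsto.mul_const _ (Tendsto.pow ?_ _)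
    refine Tendsto.inv₀ ?_ hr.ne'
    have : Tendsto (fun ε : ℝ => rad X + ε) (𝓝 0) (𝓝 (rad X + 0)) := by
      exact (continuous_const.add continuous_id).tendsto 0
    rw [add_zero] at this
    exact this.mono_left nhdsWithin_le_nhds
  have hsmall : ∀ᶠ ε : ℝ in 𝓝[>] 0, ε * ‖L‖ ≤ 1 / 2 := by
    have : Tendsto (fun ε : ℝ => ε * ‖L‖) (𝓝 0) (𝓝 (0 * ‖L‖)) :=
      (continuous_id.mul continuous_const).tendsto 0
    rw [zero_mul] at this
    exact (this.mono_left nhdsWithin_le_nhds).eventually_le_const (by norm_num)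
  have h1 : ∑ i ∈ Finset.range m, (rad X)⁻¹ ^ (i + 1) * φ ((X ^ i) x) ≤
      ‖φ‖ * (2 * ‖L‖ * ‖x‖) := by
    refine le_of_tendsto hcont ?_
    filter_upwards [hsmall, self_mem_nhdsWithin] with ε hε1 hε0
    obtain ⟨R, hR⟩ := mem_posResSet_of_rad_lt hXp (lt_add_of_pos_right (rad X) hε0)
    have h2 := hφ _ (hR.sum_le hXp m x hx0)
    rw [sub_apply, map_sub, sub_nonneg] at h2
    simp only [sum_apply, map_sum, smul_apply, map_smul, smul_eq_mul] at h2
    refine h2.trans ((le_abs_self _).trans ((φ.le_opNorm _).trans ?_))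
    gcongr
    rw [← hx]
    refine (H.norm_resolvent_apply_le (le_of_lt hε0) hε1 hR x).trans ?_
    rw [hx]
  have h3 := mul_le_mul_of_nonneg_left h1 hr.le
  refine le_trans (le_of_eq ?_) h3
  rw [Finset.mul_sum]
  refine Finset.sum_congr rfl fun i _ => ?_
  rw [pow_succ, mul_right_comm, ← mul_assoc, mul_comm (rad X), mul_assoc, mul_inv_cancel₀ hr.ne',
    mul_one]

lemma apply_resolvent_le_of_sumBdd (hXp : Pos X) (hr : 0 < rad X) {φ : F →L[ℝ] ℝ}
    (hφ : ∀ x, 0 ≤ x → 0 ≤ φ x) {x : F} (hx0 : 0 ≤ x) {M : ℝ}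
    (hM : ∀ m : ℕ, ∑ i ∈ Finset.range m, (rad X)⁻¹ ^ i * φ ((X ^ i) x) ≤ M) {μ : ℝ}
    (hμ : rad X < μ) {R : F →L[ℝ] F} (hR : IsPosRes X μ R) : φ (R x) ≤ (rad X)⁻¹ * M := by
  obtain ⟨ν, hν1, hν2⟩ := exists_between hμ
  obtain ⟨Q, hQ⟩ := mem_posResSet_of_rad_lt hXp hν1
  have hlim : Tendsto (fun m : ℕ => (rad X)⁻¹ * M + ‖φ‖ * (ν * ‖Q‖ * (μ⁻¹ * ν) ^ m * ‖R x‖)) atTop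
      (𝓝 ((rad X)⁻¹ * M)) := by
    have h0 : 0 < ν := hr.trans hν1
    have h1 : Tendsto (fun m : ℕ => (μ⁻¹ * ν) ^ m) atTop (𝓝 0) := by
      refine tendsto_pow_atTop_nhds_zero_of_lt_one ?_ ?_
      · have := hR.mu_pos; positivity
      · rw [inv_mul_lt_one₀ hR.mu_pos]; exact hν2
    have h2 := ((h1.const_mul (ν * ‖Q‖)).mul_const ‖R x‖).const_mul ‖φ‖
    simpa using h2.const_add ((rad X)⁻¹ * M)
  refine ge_of_tendsto hlim (Eventually.of_forall fun m => ?_)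
  have h1 := congrArg (fun S : F →L[ℝ] F => φ (S x)) (hR.expand m)
  simp only [add_apply, sum_apply, map_add, map_sum, smul_apply, map_smul,
    smul_eq_mul, mul_apply_eq_comp] at h1
  rw [h1]
  refine add_le_add ?_ ?_
  · refine le_trans ?_ (mul_le_mul_of_nonneg_left (hM m) (inv_nonneg.2 hr.le))
    rw [Finset.mul_sum]
    refine Finset.sum_le_sum fun i _ => ?_
    rw [← mul_assoc, ← pow_succ']
    have h2 : 0 ≤ φ ((X ^ i) x) := hφ _ (hXp.pow i x hx0)
    have h3 := hR.mu_pos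
    gcongr
  · have h2 : φ ((X ^ m) (R x)) ≤ ‖φ‖ * (ν * ‖Q‖ * ν ^ m * ‖R x‖) := by
      refine (le_abs_self _).trans ((φ.le_opNorm _).trans ?_)
      gcongr
      exact ((X ^ m).le_opNorm _).trans (by gcongr; exact hQ.norm_pow_le hXp m)
    have h3 : 0 ≤ μ⁻¹ ^ m := pow_nonneg (inv_nonneg.2 hR.mu_pos.le) _
    refine (mul_le_mul_of_nonneg_left h2 h3).trans (le_of_eq ?_)
    rw [mul_pow]; ring

lemma apply_eq_of_sumBdd (hXp : Pos X) (hX : IsCompactOperator X) (hr : 0 < rad X)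
    (H : RieszData X (rad X) k h L) {φ : F →L[ℝ] ℝ} (hφ : ∀ x, 0 ≤ x → 0 ≤ φ x)
    (hφ0 : ∀ v, 0 ≤ v → X v = rad X • v → φ v = 0 → v = 0) {x : F} (hx0 : 0 ≤ x)
    (hx : SumBdd X φ (rad X) x) : h x = x := by
  obtain ⟨M, hM⟩ := hx
  have hlt : ∀ n : ℕ, rad X < rad X + 1 / ((n : ℝ) + 1) := fun n =>
    lt_add_of_pos_right _ (by positivity)
  choose R hR using fun n => mem_posResSet_of_rad_lt hXp (hlt n)
  have hnt : ¬ Tendsto (fun n => ‖R n x‖) atTop atTop := by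
    intro ht
    obtain ⟨v, hv0, hv1, hv2, hv3⟩ := exists_eigenvector_of_blowup hX hr
      (tendsto_add_one_div (rad X)) (fun n => (hR n).pos x hx0) ht (M := ‖x‖)
      (fun n => by rw [(hR n).smul_sub])
    have hv4 := hφ0 v hv0 hv2 (hv3 φ ⟨(rad X)⁻¹ * M, fun n => by
      rw [abs_of_nonneg (hφ _ ((hR n).pos x hx0))]
      exact apply_resolvent_le_of_sumBdd hXp hr hφ hx0 hM (hlt n) (hR n)⟩)
    rw [hv4, norm_zero] at hv1
    exact zero_ne_one hv1
  rw [tendsto_atTop] at hnt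
  push Not at hnt
  obtain ⟨B, hB⟩ := hnt
  have hsmall : ∀ᶠ n : ℕ in atTop, (1 / ((n : ℝ) + 1)) * ‖L‖ ≤ 1 / 2 := by
    have : Tendsto (fun n : ℕ => (1 / ((n : ℝ) + 1)) * ‖L‖) atTop (𝓝 (0 * ‖L‖)) :=
      tendsto_one_div_add_atTop_nhds_zero_nat.mul_const _
    rw [zero_mul] at this
    exact this.eventually_le_const (by norm_num)
  set T : F →L[ℝ] F := rad X • (1 : F →L[ℝ] F) - X with hT
  set z : F := x - h x with hz
  have hBz : ∃ᶠ n in atTop, ‖R n z‖ ≤ B + 2 * ‖L‖ * ‖x‖ := by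
    refine (hB.and_eventually hsmall).mono fun n hn => ?_
    rw [hz, map_sub]
    refine (norm_sub_le _ _).trans (add_le_add hn.1.le ?_)
    exact H.norm_resolvent_apply_le (by positivity) hn.2 (hR n) x
  have hTz : ∃ j, (T ^ j) z = 0 := ⟨k, by
    have := congrArg (fun S : F →L[ℝ] F => S x) H.pow_mul
    rw [mul_apply_eq_comp] at this
    exact this⟩
  have hz0 : z = 0 := by
    classical
    by_contra hne
    obtain ⟨j, hj1, hj2⟩ : ∃ j, (T ^ j) z ≠ 0 ∧ T ((T ^ j) z) = 0 := by
      have h1 := Nat.find_spec hTz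
      obtain ⟨j, hj⟩ : ∃ j, Nat.find hTz = j + 1 := by
        refine Nat.exists_eq_succ_of_ne_zero fun h0 => ?_
        rw [h0] at h1
        exact hne h1
      refine ⟨j, Nat.find_min hTz (by omega), ?_⟩
      rw [hj, pow_succ'] at h1
      exact h1
    have h1 : ∃ᶠ n : ℕ in atTop, ‖(T ^ j) z‖ ≤
        (1 / ((n : ℝ) + 1)) * (‖T ^ j‖ * (B + 2 * ‖L‖ * ‖x‖)) := by
      refine hBz.mono fun n hn => ?_
      have hc : Commute (R n) (T ^ j) := by
        have hc1 : Commute (R n) X := by rw [Commute, SemiconjBy, (hR n).mul_eq, (hR n).eq_mul]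
        exact (((Commute.one_right _).smul_right _).sub_right hc1).pow_right j
      have h2 := (hR n).apply_smul_sub ((T ^ j) z)
      have h3 : (rad X + 1 / ((n : ℝ) + 1)) • (T ^ j) z - X ((T ^ j) z) =
          (1 / ((n : ℝ) + 1)) • (T ^ j) z + T ((T ^ j) z) := by
        rw [hT]; simp only [sub_apply, smul_apply, one_apply_eq_self, add_smul]; abel
      rw [h3, hj2, add_zero, map_smul, ← mul_apply_eq_comp, hc.eq, mul_apply_eq_comp] at h2
      rw [← h2, norm_smul, Real.norm_of_nonneg (by positivity)]
      gcongr
      exact ((T ^ j).le_opNorm _).trans (by gcongr)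
    have h2 : Tendsto (fun n : ℕ => (1 / ((n : ℝ) + 1)) * (‖T ^ j‖ * (B + 2 * ‖L‖ * ‖x‖))) atTop
        (𝓝 (0 * (‖T ^ j‖ * (B + 2 * ‖L‖ * ‖x‖)))) :=
      tendsto_one_div_add_atTop_nhds_zero_nat.mul_const _
    rw [zero_mul] at h2
    have h3 := ge_of_tendsto_of_frequently h2 h1
    exact hj1 (norm_le_zero_iff.1 h3)
  exact (sub_eq_zero.1 hz0).symm

end Growth
section Core

/-- The data to which the commutator problem is reduced: a compact positive `X` dominating
the positive eigenfunctional `φ` of `C`, and almost commuting with `C`. -/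
structure PreCore {F : Type*} [NormedAddCommGroup F] [Lattice F] [NormedSpace ℝ F]
    (X C : F →L[ℝ] F) (φ : F →L[ℝ] ℝ) (r δ c c' : ℝ) : Prop where
  posX : Pos X
  compact : IsCompactOperator X
  posC : Pos C
  nonneg : ∀ x, 0 ≤ x → 0 ≤ φ x
  r_pos : 0 < r
  δ_pos : 0 < δ
  apply_C : ∀ x, φ (C x) = r * φ x
  le_apply_X : ∀ x, 0 ≤ x → δ * φ x ≤ φ (X x)
  pow_C_le : ∀ i x, 0 ≤ x → φ ((X ^ i) (C x)) ≤ c' * φ ((X ^ i) x)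
  sum_le : ∀ m x, 0 ≤ x →
    ∑ i ∈ Finset.range m, φ ((X ^ (i + 1)) (C ((X ^ (m - 1 - i)) x))) ≤ c * φ ((X ^ m) x)
  exists_pos : ∃ y, 0 ≤ y ∧ 0 < φ y

/-- A `PreCore` for which the functionals `φ ∘ X ^ i` jointly separate the positive cone from `0`. -/
structure Core {F : Type*} [NormedAddCommGroup F] [Lattice F] [NormedSpace ℝ F]
    (X C : F →L[ℝ] F) (φ : F →L[ℝ] ℝ) (r δ c c' : ℝ) : Prop extends PreCore X C φ r δ c c' where
  sep : ∀ x, 0 ≤ x → (∀ i, φ ((X ^ i) x) = 0) → x = 0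

variable {F : Type*} [NormedAddCommGroup F] [Lattice F] [HasSolidNorm F] [IsOrderedAddMonoid F]
  [NormedSpace ℝ F]

lemma abs_sup_le_abs_add_abs (x y : F) : |x ⊔ y| ≤ |x| + |y| := by
  rw [abs_le']
  refine ⟨sup_le ?_ ?_, ?_⟩
  · exact (le_abs_self x).trans (le_add_of_nonneg_right (abs_nonneg y))
  · exact (le_abs_self y).trans (le_add_of_nonneg_left (abs_nonneg x))
  · exact (neg_le_neg le_sup_left).trans
      ((neg_le_abs x).trans (le_add_of_nonneg_right (abs_nonneg y)))

lemma abs_inf_le_abs_add_abs (x y : F) : |x ⊓ y| ≤ |x| + |y| := by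
  rw [← abs_neg, neg_inf, ← abs_neg x, ← abs_neg y]
  exact abs_sup_le_abs_add_abs _ _

lemma abs_mem_of_solid {J : Submodule ℝ F} (hJ : ∀ ⦃x y⦄, |x| ≤ |y| → y ∈ J → x ∈ J) {x : F}
    (hx : x ∈ J) : |x| ∈ J := hJ (by rw [abs_abs]) hx

/-- The lattice structure on a solid subspace. -/
abbrev solidLattice (J : Submodule ℝ F) (hJ : ∀ ⦃x y⦄, |x| ≤ |y| → y ∈ J → x ∈ J) : Lattice J :=
  Subtype.lattice (P := fun x => x ∈ J)
    (fun x y hx hy => hJ (y := |x| + |y|)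
      ((abs_sup_le_abs_add_abs x y).trans (le_abs_self _))
      (J.add_mem (abs_mem_of_solid hJ hx) (abs_mem_of_solid hJ hy)))
    (fun x y hx hy => hJ (y := |x| + |y|)
      ((abs_inf_le_abs_add_abs x y).trans (le_abs_self _))
      (J.add_mem (abs_mem_of_solid hJ hx) (abs_mem_of_solid hJ hy)))

namespace Core

variable {X C : F →L[ℝ] F} {φ : F →L[ℝ] ℝ} {r δ c c' : ℝ}

lemma mono_apply (K : Core X C φ r δ c c') {x y : F} (h : x ≤ y) : φ x ≤ φ y := by
  have := K.nonneg _ (sub_nonneg.2 h)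
  rwa [map_sub, sub_nonneg] at this

lemma pow_mul_le (K : Core X C φ r δ c c') (i : ℕ) {x : F} (hx : 0 ≤ x) :
    δ ^ i * φ x ≤ φ ((X ^ i) x) := by
  induction i with
  | zero => simp
  | succ i ih =>
    rw [pow_succ', pow_succ', mul_apply_eq_comp, mul_assoc]
    exact (mul_le_mul_of_nonneg_left ih K.δ_pos.le).trans
      (K.le_apply_X _ (K.posX.pow i x hx))

variable [CompleteSpace F]

lemma le_rad (K : Core X C φ r δ c c') : δ ≤ rad X := by
  obtain ⟨y, hy0, hy⟩ := K.exists_pos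
  refine le_csInf (posResSet_nonempty K.posX) ?_
  rintro μ ⟨Q, hQ⟩
  by_contra! hlt
  have h1 : ∀ i : ℕ, φ y ≤ ‖φ‖ * (μ * ‖Q‖ * ‖y‖) * (μ / δ) ^ i := by
    intro i
    have h2 : δ ^ i * φ y ≤ ‖φ‖ * (μ * ‖Q‖ * μ ^ i * ‖y‖) := by
      refine (K.pow_mul_le i hy0).trans ((le_abs_self _).trans ((φ.le_opNorm _).trans ?_))
      gcongr
      exact ((X ^ i).le_opNorm _).trans (by gcongr; exact hQ.norm_pow_le K.posX i)
    have h3 := K.δ_pos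
    rw [div_pow, mul_div_assoc', le_div_iff₀ (by positivity)]
    calc φ y * δ ^ i = δ ^ i * φ y := mul_comm _ _
      _ ≤ _ := h2
      _ = _ := by ring
  have h4 : Tendsto (fun i : ℕ => (μ / δ) ^ i) atTop (𝓝 0) :=
    tendsto_pow_atTop_nhds_zero_of_lt_one (div_nonneg hQ.mu_pos.le K.δ_pos.le)
      ((div_lt_one K.δ_pos).2 hlt)
  have h5 := ge_of_tendsto' (h4.const_mul (‖φ‖ * (μ * ‖Q‖ * ‖y‖))) h1
  rw [mul_zero] at h5
  linarith

lemma sumBdd_mono (K : Core X C φ r δ c c') {x y : F} (h : x ≤ y) (hy : SumBdd X φ (rad X) y) :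
    SumBdd X φ (rad X) x := by
  obtain ⟨M, hM⟩ := hy
  refine ⟨M, fun m => le_trans (Finset.sum_le_sum fun i _ => ?_) (hM m)⟩
  exact mul_le_mul_of_nonneg_left (K.mono_apply ((K.posX.pow i).mono h))
    (pow_nonneg (inv_nonneg.2 (rad_nonneg X)) i)

lemma sumBdd_add {x y : F} (hx : SumBdd X φ (rad X) x) (hy : SumBdd X φ (rad X) y) :
    SumBdd X φ (rad X) (x + y) := by
  obtain ⟨M, hM⟩ := hx
  obtain ⟨M', hM'⟩ := hy
  refine ⟨M + M', fun m => ?_⟩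
  simp only [map_add, mul_add, Finset.sum_add_distrib]
  exact add_le_add (hM m) (hM' m)

lemma sumBdd_smul {x : F} (hx : SumBdd X φ (rad X) x) {a : ℝ} (ha : 0 ≤ a) :
    SumBdd X φ (rad X) (a • x) := by
  obtain ⟨M, hM⟩ := hx
  refine ⟨a * M, fun m => ?_⟩
  refine le_trans (le_of_eq ?_) (mul_le_mul_of_nonneg_left (hM m) ha)
  rw [Finset.mul_sum]
  refine Finset.sum_congr rfl fun i _ => ?_
  rw [map_smul, map_smul, smul_eq_mul]; ring

lemma sumBdd_X (K : Core X C φ r δ c c') {x : F} (hx0 : 0 ≤ x) (hx : SumBdd X φ (rad X) x) :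
    SumBdd X φ (rad X) (X x) := by
  have hr : 0 < rad X := K.δ_pos.trans_le K.le_rad
  obtain ⟨M, hM⟩ := hx
  refine ⟨rad X * M, fun m => ?_⟩
  refine le_trans ?_ (mul_le_mul_of_nonneg_left (hM (m + 1)) hr.le)
  rw [Finset.sum_range_succ', mul_add, Finset.mul_sum]
  have h1 : 0 ≤ rad X * ((rad X)⁻¹ ^ 0 * φ ((X ^ 0) x)) := by
    simpa using mul_nonneg hr.le (K.nonneg x hx0)
  refine le_add_of_le_of_nonneg (le_of_eq (Finset.sum_congr rfl fun i _ => ?_)) h1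
  rw [pow_succ, pow_succ, mul_apply_eq_comp]
  field_simp

lemma sumBdd_C (K : Core X C φ r δ c c') {x : F} (hx0 : 0 ≤ x) (hx : SumBdd X φ (rad X) x) :
    SumBdd X φ (rad X) (C x) := by
  have hr : 0 < rad X := K.δ_pos.trans_le K.le_rad
  obtain ⟨M, hM⟩ := hx
  have hc : 0 ≤ |c'| := abs_nonneg c'
  refine ⟨|c'| * M, fun m => ?_⟩
  refine le_trans ?_ (mul_le_mul_of_nonneg_left (hM m) hc)
  rw [Finset.mul_sum]
  refine Finset.sum_le_sum fun i _ => ?_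
  have h1 := K.pow_C_le i x hx0
  have h2 : c' * φ ((X ^ i) x) ≤ |c'| * φ ((X ^ i) x) :=
    mul_le_mul_of_nonneg_right (le_abs_self _) (K.nonneg _ (K.posX.pow i x hx0))
  calc (rad X)⁻¹ ^ i * φ ((X ^ i) (C x)) ≤ (rad X)⁻¹ ^ i * (|c'| * φ ((X ^ i) x)) := by
        gcongr; exact h1.trans h2
    _ = _ := by ring

/-- The solid subspace of vectors whose weighted orbit sums are bounded. -/
def bddIdeal (K : Core X C φ r δ c c') : Submodule ℝ F where
  carrier := {x | SumBdd X φ (rad X) |x|}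
  zero_mem' := ⟨0, fun m => by simp⟩
  add_mem' := fun {x y} hx hy => K.sumBdd_mono (abs_add_le x y) (sumBdd_add hx hy)
  smul_mem' := fun a x hx => by
    change SumBdd X φ (rad X) |a • x|
    rw [abs_real_smul]
    exact sumBdd_smul hx (abs_nonneg a)

lemma mem_bddIdeal (K : Core X C φ r δ c c') {x : F} :
    x ∈ K.bddIdeal ↔ SumBdd X φ (rad X) |x| := Iff.rfl

lemma isClosed_bddIdeal (K : Core X C φ r δ c c') : IsClosed (K.bddIdeal : Set F) := by
  have hr : 0 < rad X := K.δ_pos.trans_le K.le_rad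
  obtain ⟨k, h, L, H⟩ := exists_rieszData K.compact hr.ne'
  have h0 : ∀ v, 0 ≤ v → X v = rad X • v → φ v = 0 → v = 0 := by
    intro v hv hXv hφ
    refine K.sep v hv fun i => ?_
    have : (X ^ i) v = rad X ^ i • v := by
      induction i with
      | zero => simp
      | succ i ih => rw [pow_succ, mul_apply_eq_comp, hXv, map_smul, ih, smul_smul, pow_succ']
    rw [this, map_smul, hφ, smul_zero]
  have : (K.bddIdeal : Set F) = {x | h |x| = |x|} := by
    ext x
    exact ⟨apply_eq_of_sumBdd K.posX K.compact hr H K.nonneg h0 (abs_nonneg x),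
      sumBdd_of_apply_eq K.posX hr H K.nonneg (abs_nonneg x)⟩
  rw [this]
  have hc : Continuous fun x : F => |x| := continuous_id.sup continuous_neg
  exact isClosed_eq (h.continuous.comp hc) hc

lemma eq_zero_of_mem_bddIdeal (K : Core X C φ r δ c c') {x : F} (hx : x ∈ K.bddIdeal)
    (hXx : X x = rad X • x) : x = 0 := by
  have hr : 0 < rad X := K.δ_pos.trans_le K.le_rad
  have h1 : rad X • |x| ≤ X |x| := by
    have := K.posX.abs_apply_le x
    rwa [hXx, abs_real_smul, abs_of_pos hr] at this
  have h2 : ∀ i j : ℕ, rad X ^ i * φ ((X ^ j) |x|) ≤ φ ((X ^ (i + j)) |x|) := by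
    intro i j
    induction i with
    | zero => simp
    | succ i ih =>
      have h3 := K.mono_apply ((K.posX.pow (i + j)).mono h1)
      rw [map_smul, map_smul, smul_eq_mul, ← mul_apply_eq_comp, ← pow_succ] at h3
      rw [pow_succ', mul_assoc, show i + 1 + j = i + j + 1 by ring]
      exact (mul_le_mul_of_nonneg_left ih hr.le).trans h3
  obtain ⟨M, hM⟩ := hx
  have h4 : |x| = 0 := by
    refine K.sep _ (abs_nonneg x) fun j => ?_
    refine le_antisymm ?_ (K.nonneg _ (K.posX.pow j _ (abs_nonneg x)))
    by_contra! hpos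
    have h5 : ∀ m : ℕ, m * ((rad X)⁻¹ ^ j * φ ((X ^ j) |x|)) ≤ M := by
      intro m
      refine le_trans ?_ (hM (j + m))
      rw [Finset.sum_range_add]
      refine le_add_of_nonneg_of_le (Finset.sum_nonneg fun i _ => ?_) ?_
      · exact mul_nonneg (pow_nonneg (inv_nonneg.2 hr.le) i)
          (K.nonneg _ (K.posX.pow i _ (abs_nonneg x)))
      · rw [← nsmul_eq_mul]
        conv_lhs => rw [← Finset.card_range m]
        refine Finset.card_nsmul_le_sum _ _ _ fun i _ => ?_
        have h6 := h2 i j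
        rw [add_comm j i, pow_add, mul_comm ((rad X)⁻¹ ^ i), mul_assoc]
        gcongr
        rw [inv_pow, ← div_eq_inv_mul, le_div_iff₀ (by positivity), mul_comm]
        exact h6
    obtain ⟨m, hm⟩ := exists_nat_gt (M / ((rad X)⁻¹ ^ j * φ ((X ^ j) |x|)))
    rw [div_lt_iff₀ (by positivity)] at hm
    exact absurd (h5 m) (not_le.2 hm)
  have := norm_abs_eq_norm x
  rw [h4, norm_zero] at this
  exact norm_eq_zero.1 this.symm

lemma exists_pos_mem_bddIdeal (K : Core X C φ r δ c c') : ∃ y ∈ K.bddIdeal, 0 ≤ y ∧ 0 < φ y := by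
  have hr : 0 < rad X := K.δ_pos.trans_le K.le_rad
  obtain ⟨v, hv0, hv1, hXv⟩ := exists_pos_eigenvector K.posX K.compact hr
  have hpow : ∀ i, (X ^ i) v = rad X ^ i • v := by
    intro i
    induction i with
    | zero => simp
    | succ i ih => rw [pow_succ, mul_apply_eq_comp, hXv, map_smul, ih, smul_smul, pow_succ']
  have hφv : 0 < φ v := by
    refine lt_of_le_of_ne (K.nonneg v hv0) fun h => ?_
    have : v = 0 := K.sep v hv0 fun i => by rw [hpow, map_smul, ← h, smul_zero]
    rw [this, norm_zero] at hv1
    exact zero_ne_one hv1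
  have hCv : 0 ≤ C v := K.posC v hv0
  have hXCv : 0 ≤ X (C v) := K.posX _ hCv
  refine ⟨X (C v), ?_, hXCv, ?_⟩
  · rw [mem_bddIdeal, abs_of_nonneg hXCv]
    refine ⟨rad X * (c * φ v), fun m => ?_⟩
    have h1 := K.sum_le m v hv0
    rw [hpow, map_smul, smul_eq_mul] at h1
    have h2 : 0 ≤ rad X * (rad X)⁻¹ ^ m := by positivity
    have h3 := mul_le_mul_of_nonneg_left h1 h2
    refine (le_of_eq ?_).trans (h3.trans (le_of_eq ?_))
    · rw [Finset.mul_sum]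
      refine Finset.sum_congr rfl fun i hi => ?_
      have him : i < m := Finset.mem_range.1 hi
      rw [hpow, map_smul, map_smul, map_smul, smul_eq_mul, pow_succ, mul_apply_eq_comp, ← mul_assoc]
      congr 1
      obtain ⟨d, rfl⟩ : ∃ d, m = i + d + 1 := ⟨m - i - 1, by omega⟩
      rw [show i + d + 1 - 1 - i = d by omega]
      simp only [inv_pow, pow_succ, pow_add]
      field_simp
    · rw [inv_pow]; field_simp
  · have h1 := K.le_apply_X _ hCv
    rw [K.apply_C] at h1
    exact (mul_pos K.δ_pos (mul_pos K.r_pos hφv)).trans_le h1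

end Core

universe u

theorem Core.elim (n : ℕ) : ∀ {F : Type u} [NormedAddCommGroup F] [Lattice F] [HasSolidNorm F]
    [IsOrderedAddMonoid F] [NormedSpace ℝ F] [CompleteSpace F] {X C : F →L[ℝ] F} {φ : F →L[ℝ] ℝ}
    {r δ c c' : ℝ}, Core X C φ r δ c c' →
    {μ : ℝ | δ ≤ μ ∧ Module.End.HasEigenvalue (X : Module.End ℝ F) μ}.ncard ≠ n := by
  induction n using Nat.strong_induction_on with
  | _ n ih =>
    intro F _ _ _ _ _ _ X C φ r δ c c' K hn
    have hr : 0 < rad X := K.δ_pos.trans_le K.le_rad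
    obtain ⟨v, hv0, hv1, hXv⟩ := exists_pos_eigenvector K.posX K.compact hr
    have hsolid : ∀ ⦃x y : F⦄, |x| ≤ |y| → y ∈ K.bddIdeal → x ∈ K.bddIdeal :=
      fun x y hxy hy => K.sumBdd_mono hxy hy
    have hXJ : ∀ x ∈ K.bddIdeal, X x ∈ K.bddIdeal := fun x hx =>
      K.sumBdd_mono (K.posX.abs_apply_le x) (K.sumBdd_X (abs_nonneg x) hx)
    have hCJ : ∀ x ∈ K.bddIdeal, C x ∈ K.bddIdeal := fun x hx =>
      K.sumBdd_mono (K.posC.abs_apply_le x) (K.sumBdd_C (abs_nonneg x) hx)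
    have hcl := K.isClosed_bddIdeal
    have heig := fun x => K.eq_zero_of_mem_bddIdeal (x := x)
    obtain ⟨y, hyJ, hy0, hyφ⟩ := K.exists_pos_mem_bddIdeal
    generalize K.bddIdeal = J at *
    let : Lattice J := solidLattice J hsolid
    have : CompleteSpace J := hcl.completeSpace_coe
    have : HasSolidNorm J := ⟨fun x y h => norm_le_norm_of_abs_le_abs (a := (x : F)) (b := y) h⟩
    have : IsOrderedAddMonoid J := {
      add_le_add_left := fun a b h c => add_le_add_left (α := F) h c }
    let XJ : J →L[ℝ] J := (X ∘L J.subtypeL).codRestrict J fun x => hXJ x x.2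
    let CJ : J →L[ℝ] J := (C ∘L J.subtypeL).codRestrict J fun x => hCJ x x.2
    have hpow : ∀ i (x : J), (((XJ ^ i) x : J) : F) = (X ^ i) x := by
      intro i
      induction i with
      | zero => intro x; rfl
      | succ i ih => intro x; rw [pow_succ, pow_succ, mul_apply_eq_comp, ih]; rfl
    have KJ : Core XJ CJ (φ ∘L J.subtypeL) r δ c c' :=
      { posX := fun x hx => K.posX x hx
        compact := K.compact.restrict (f := (X : F →ₗ[ℝ] F)) hXJ hcl
        posC := fun x hx => K.posC x hx
        nonneg := fun x hx => K.nonneg x hx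
        r_pos := K.r_pos
        δ_pos := K.δ_pos
        apply_C := fun x => K.apply_C x
        le_apply_X := fun x hx => K.le_apply_X x hx
        pow_C_le := fun i x hx => by
          change φ (((XJ ^ i) (CJ x) : J) : F) ≤ c' * φ (((XJ ^ i) x : J) : F)
          rw [hpow, hpow]
          exact K.pow_C_le i x hx
        sum_le := fun m x hx => by
          have h1 := K.sum_le m x hx
          rw [← hpow] at h1
          refine le_trans (le_of_eq (Finset.sum_congr rfl fun i _ => ?_)) h1
          change φ (((XJ ^ (i + 1)) _ : J) : F) = _
          rw [hpow]
          change φ ((X ^ (i + 1)) (C (((XJ ^ (m - 1 - i)) x : J) : F))) = _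
          rw [hpow]
        sep := fun x hx h => by
          refine Subtype.ext (K.sep x hx fun i => ?_)
          rw [← hpow]
          exact h i
        exists_pos := ⟨⟨y, hyJ⟩, hy0, hyφ⟩ }
    refine ih _ ?_ KJ rfl
    rw [← hn]
    refine Set.ncard_lt_ncard ?_ (finite_eigenvalues K.compact K.δ_pos)
    rw [Set.ssubset_iff_of_subset]
    · refine ⟨rad X, ⟨K.le_rad, ?_⟩, ?_⟩
      · refine Module.End.hasEigenvalue_of_hasEigenvector (x := v)
          ⟨Module.End.mem_eigenspace_iff.2 hXv, fun h => ?_⟩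
        rw [h, norm_zero] at hv1
        exact zero_ne_one hv1
      · rintro ⟨-, h⟩
        obtain ⟨x, hx⟩ := h.exists_hasEigenvector
        refine hx.2 (Subtype.ext (heig x x.2 ?_))
        exact congrArg Subtype.val hx.apply_eq_smul
    · rintro μ ⟨h1, h2⟩
      refine ⟨h1, ?_⟩
      obtain ⟨x, hx⟩ := h2.exists_hasEigenvector
      refine Module.End.hasEigenvalue_of_hasEigenvector (x := (x : F))
        ⟨Module.End.mem_eigenspace_iff.2 ?_, fun h => hx.2 (Subtype.ext h)⟩
      exact congrArg Subtype.val hx.apply_eq_smul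

end Core
section Quotient

variable {E : Type*} [NormedAddCommGroup E] [Lattice E] [HasSolidNorm E] [IsOrderedAddMonoid E]
  [NormedSpace ℝ E] (N : Submodule ℝ E)

lemma sup_sub_sup_mem {N : Submodule ℝ E} (hN : ∀ ⦃x y⦄, |x| ≤ |y| → y ∈ N → x ∈ N) {x x' y y' : E}
    (hx : x - x' ∈ N) (hy : y - y' ∈ N) : x ⊔ y - x' ⊔ y' ∈ N := by
  have : x ⊔ y - x' ⊔ y' = (x ⊔ y - x' ⊔ y) + (y ⊔ x' - y' ⊔ x') := by
    rw [sup_comm y x', sup_comm y' x']; abel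
  rw [this]
  exact N.add_mem (hN (abs_sup_sub_sup_le_abs _ _ _) hx) (hN (abs_sup_sub_sup_le_abs _ _ _) hy)

lemma inf_sub_inf_mem {N : Submodule ℝ E} (hN : ∀ ⦃x y⦄, |x| ≤ |y| → y ∈ N → x ∈ N) {x x' y y' : E}
    (hx : x - x' ∈ N) (hy : y - y' ∈ N) : x ⊓ y - x' ⊓ y' ∈ N := by
  have : x ⊓ y - x' ⊓ y' = (x ⊓ y - x' ⊓ y) + (y ⊓ x' - y' ⊓ x') := by
    rw [inf_comm y x', inf_comm y' x']; abel
  rw [this]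
  exact N.add_mem (hN (abs_inf_sub_inf_le_abs _ _ _) hx) (hN (abs_inf_sub_inf_le_abs _ _ _) hy)

/-- The quotient of a vector lattice by a solid subspace is a lattice. -/
abbrev quotLattice (hN : ∀ ⦃x y⦄, |x| ≤ |y| → y ∈ N → x ∈ N) : Lattice (E ⧸ N) :=
  letI : Max (E ⧸ N) := ⟨Quotient.map₂ (· ⊔ ·) fun x x' hx y y' hy => by
    exact (Submodule.quotientRel_def N).2 (sup_sub_sup_mem hN
      ((Submodule.quotientRel_def N).1 hx) ((Submodule.quotientRel_def N).1 hy))⟩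
  letI : Min (E ⧸ N) := ⟨Quotient.map₂ (· ⊓ ·) fun x x' hx y y' hy => by
    exact (Submodule.quotientRel_def N).2 (inf_sub_inf_mem hN
      ((Submodule.quotientRel_def N).1 hx) ((Submodule.quotientRel_def N).1 hy))⟩
  Lattice.mk'
    (by rintro ⟨x⟩ ⟨y⟩; exact congrArg (Submodule.Quotient.mk (p := N)) (sup_comm x y))
    (by rintro ⟨x⟩ ⟨y⟩ ⟨z⟩; exact congrArg (Submodule.Quotient.mk (p := N)) (sup_assoc x y z))
    (by rintro ⟨x⟩ ⟨y⟩; exact congrArg (Submodule.Quotient.mk (p := N)) (inf_comm x y))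
    (by rintro ⟨x⟩ ⟨y⟩ ⟨z⟩; exact congrArg (Submodule.Quotient.mk (p := N)) (inf_assoc x y z))
    (by rintro ⟨x⟩ ⟨y⟩; exact congrArg (Submodule.Quotient.mk (p := N)) (sup_inf_self (a := x) (b := y)))
    (by rintro ⟨x⟩ ⟨y⟩; exact congrArg (Submodule.Quotient.mk (p := N)) (inf_sup_self (a := x) (b := y)))

variable (hN : ∀ ⦃x y⦄, |x| ≤ |y| → y ∈ N → x ∈ N)

lemma quot_le_iff (x y : E) : (quotLattice N hN).le (Submodule.Quotient.mk x)
    (Submodule.Quotient.mk y) ↔ x ⊔ y - y ∈ N :=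
  Submodule.Quotient.eq N

lemma quot_isOrderedAddMonoid :
    @IsOrderedAddMonoid (E ⧸ N) _ (quotLattice N hN).toPartialOrder.toPreorder := by
  let := quotLattice N hN
  refine { add_le_add_left := ?_ }
  rintro ⟨x⟩ ⟨y⟩ hxy ⟨z⟩
  rw [Submodule.Quotient.quot_mk_eq_mk, Submodule.Quotient.quot_mk_eq_mk, quot_le_iff] at hxy
  refine (quot_le_iff N hN (x + z) (y + z)).2 ?_
  rwa [← sup_add, add_sub_add_right_eq_sub]

lemma exists_nonneg_rep (q : E ⧸ N)
    (hq : (quotLattice N hN).le 0 q) : ∃ x, 0 ≤ x ∧ Submodule.Quotient.mk x = q := by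
  obtain ⟨x, rfl⟩ := Submodule.Quotient.mk_surjective N q
  exact ⟨0 ⊔ x, le_sup_left, (Submodule.Quotient.eq N).2 ((quot_le_iff N hN 0 x).1 hq)⟩

lemma quot_nonneg {x : E} (hx : 0 ≤ x) :
    (quotLattice N hN).le 0 (Submodule.Quotient.mk x) := by
  refine (quot_le_iff N hN 0 x).2 ?_
  rw [sup_of_le_right hx, sub_self]
  exact N.zero_mem

lemma quot_hasSolidNorm [IsClosed (N : Set E)] :
    @HasSolidNorm (E ⧸ N) _ (quotLattice N hN) := by
  let := quotLattice N hN
  refine ⟨fun q q' hq => le_of_forall_pos_lt_add fun ε hε => ?_⟩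
  obtain ⟨x, rfl⟩ := Submodule.Quotient.mk_surjective N q
  obtain ⟨y, rfl, hy⟩ := Submodule.Quotient.norm_mk_lt q' hε
  have hmem : |x| ⊔ |y| - |y| ∈ N := (quot_le_iff N hN |x| |y|).1 hq
  set p : E := |x| ⊔ |y| - |y| with hp
  have hp0 : 0 ≤ p := sub_nonneg.2 le_sup_right
  have hxy : |x| ≤ |y| + p := by rw [hp, add_sub_cancel]; exact le_sup_left
  let x' : E := (x ⊓ |y|) ⊔ (-|y|)
  have hx' : |x'| ≤ |y| := by
    rw [abs_le']
    refine ⟨sup_le inf_le_right ((neg_nonpos.2 (abs_nonneg y)).trans (abs_nonneg y)), ?_⟩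
    rw [neg_le]; exact le_sup_right
  have hd : x - x' ∈ N := by
    have h_up : x - p ≤ x' := by
      refine le_trans (le_inf (sub_le_self x hp0) ?_) le_sup_left
      rw [sub_le_iff_le_add]
      exact (le_abs_self x).trans hxy
    have h_low : x' ≤ x + p := by
      refine sup_le (inf_le_left.trans (le_add_of_nonneg_right hp0)) ?_
      have h1 : -x ≤ |y| + p := (neg_le_abs x).trans hxy
      rw [neg_le_iff_add_nonneg] at h1 ⊢
      convert h1 using 1
      abel
    refine hN (y := p) ?_ hmem
    rw [abs_of_nonneg hp0]
    refine abs_le'.2 ⟨sub_le_comm.1 h_up, ?_⟩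
    rw [neg_sub]
    exact sub_le_iff_le_add'.2 h_low
  rw [(Submodule.Quotient.eq N).2 hd]
  exact ((Submodule.Quotient.norm_mk_le N x').trans (norm_le_norm_of_abs_le_abs hx')).trans_lt hy

end Quotient

section

variable {E : Type*} [NormedAddCommGroup E] [Lattice E] [HasSolidNorm E] [IsOrderedAddMonoid E]
  [NormedSpace ℝ E] {X C : E →L[ℝ] E} {φ : E →L[ℝ] ℝ} {r δ c c' : ℝ}

namespace PreCore

lemma mono_apply' (K : PreCore X C φ r δ c c') {x y : E} (h : x ≤ y) : φ x ≤ φ y := by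
  have := K.nonneg _ (sub_nonneg.2 h)
  rwa [map_sub, sub_nonneg] at this

lemma eq_zero_of_abs_le (K : PreCore X C φ r δ c c') {x y : E} {i : ℕ} (h : |x| ≤ y)
    (hy : φ ((X ^ i) y) = 0) : φ ((X ^ i) |x|) = 0 :=
  le_antisymm (hy ▸ K.mono_apply' ((K.posX.pow i).mono h))
    (K.nonneg _ (K.posX.pow i _ (abs_nonneg x)))

/-- The solid subspace on which all functionals `φ ∘ X ^ i` vanish absolutely. -/
def nullIdeal (K : PreCore X C φ r δ c c') : Submodule ℝ E where
  carrier := {x | ∀ i, φ ((X ^ i) |x|) = 0}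
  zero_mem' := fun i => by simp
  add_mem' := fun {x y} hx hy i => K.eq_zero_of_abs_le (abs_add_le x y) (by
    rw [map_add, map_add, hx, hy, add_zero])
  smul_mem' := fun a x hx i => by
    rw [abs_real_smul, map_smul, map_smul, hx, smul_zero]

theorem elim [CompleteSpace E] (K : PreCore X C φ r δ c c') : False := by
  let N := K.nullIdeal
  have hN : ∀ ⦃x y⦄, |x| ≤ |y| → y ∈ N → x ∈ N := fun x y h hy i => K.eq_zero_of_abs_le h (hy i)
  have hcl : IsClosed (N : Set E) := by
    have : (N : Set E) = ⋂ i : ℕ, {x | φ ((X ^ i) |x|) = 0} := by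
      ext x; simp only [Set.mem_iInter]; rfl
    rw [this]
    refine isClosed_iInter fun i => isClosed_eq ?_ continuous_const
    exact φ.continuous.comp ((X ^ i).continuous.comp (continuous_id.sup continuous_neg))
  have hXN : ∀ x ∈ N, X x ∈ N := fun x hx i => K.eq_zero_of_abs_le (K.posX.abs_apply_le x) (by
    rw [← mul_apply_eq_comp, ← pow_succ]; exact hx (i + 1))
  have hCN : ∀ x ∈ N, C x ∈ N := fun x hx i => K.eq_zero_of_abs_le (K.posC.abs_apply_le x) (by
    refine le_antisymm ?_ (K.nonneg _ (K.posX.pow i _ (K.posC _ (abs_nonneg x))))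
    have := K.pow_C_le i _ (abs_nonneg x)
    rwa [hx i, mul_zero] at this)
  have hφN : N ≤ φ.ker := fun x hx => by
    have h1 : φ |x| = 0 := hx 0
    have h2 := K.mono_apply' (le_abs_self x)
    have h3 := K.mono_apply' (neg_le_abs x)
    rw [map_neg] at h3
    have h4 : 0 ≤ φ x := by rw [h1] at h3; linarith
    exact le_antisymm (h1 ▸ h2) h4
  let := quotLattice N hN
  have := quot_isOrderedAddMonoid N hN
  have := quot_hasSolidNorm N hN
  have hrep := exists_nonneg_rep N hN
  have hmk := fun x (hx : 0 ≤ x) => quot_nonneg N hN hx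
  have hpow : ∀ i x, ((quotMap N X hXN) ^ i) (Submodule.Quotient.mk x) =
      Submodule.Quotient.mk ((X ^ i) x) := by
    intro i
    induction i with
    | zero => intro x; rfl
    | succ i ih => intro x; rw [pow_succ, pow_succ, mul_apply_eq_comp, quotMap_mk, ih]; rfl
  have hlift : ∀ x, (N.liftQL φ hφN) (Submodule.Quotient.mk x) = φ x := fun x => rfl
  have Kq : Core (quotMap N X hXN) (quotMap N C hCN) (N.liftQL φ hφN) r δ c c' :=
    { posX := fun q hq => by
        obtain ⟨x, hx, rfl⟩ := hrep q hq
        exact hmk _ (K.posX x hx)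
      compact := isCompactOperator_quotMap hXN K.compact
      posC := fun q hq => by
        obtain ⟨x, hx, rfl⟩ := hrep q hq
        exact hmk _ (K.posC x hx)
      nonneg := fun q hq => by
        obtain ⟨x, hx, rfl⟩ := hrep q hq
        exact K.nonneg x hx
      r_pos := K.r_pos
      δ_pos := K.δ_pos
      apply_C := fun q => by
        obtain ⟨x, rfl⟩ := Submodule.Quotient.mk_surjective N q
        exact K.apply_C x
      le_apply_X := fun q hq => by
        obtain ⟨x, hx, rfl⟩ := hrep q hq
        exact K.le_apply_X x hx
      pow_C_le := fun i q hq => by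
        obtain ⟨x, hx, rfl⟩ := hrep q hq
        rw [quotMap_mk, hpow, hpow]
        exact K.pow_C_le i x hx
      sum_le := fun m q hq => by
        obtain ⟨x, hx, rfl⟩ := hrep q hq
        simp only [hpow, quotMap_mk, hlift]
        exact K.sum_le m x hx
      sep := fun q hq h => by
        obtain ⟨x, hx, rfl⟩ := hrep q hq
        rw [Submodule.Quotient.mk_eq_zero]
        intro i
        rw [abs_of_nonneg hx, ← h i, hpow]
        rfl
      exists_pos := by
        obtain ⟨y, hy0, hy⟩ := K.exists_pos
        exact ⟨Submodule.Quotient.mk y, hmk y hy0, hy⟩ }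
  exact Core.elim _ Kq rfl

end PreCore
end
section Functional

variable {E : Type*} [NormedAddCommGroup E] [Lattice E] [HasSolidNorm E] [IsOrderedAddMonoid E]
  [NormedSpace ℝ E]

/-- A positive vector is normed by a positive functional. -/
lemma exists_pos_dual {y : E} (hy0 : y ≠ 0) (hy : 0 ≤ y) :
    ∃ ψ : E →L[ℝ] ℝ, (∀ x, 0 ≤ x → 0 ≤ ψ x) ∧ ‖ψ‖ ≤ 1 ∧ ψ y = ‖y‖ := by
  obtain ⟨g, hg1, hg2⟩ := exists_extension_of_le_sublinear
    (LinearPMap.mkSpanSingleton (K := ℝ) y ‖y‖ hy0) (fun x => ‖x + |x|‖ / 2)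
    (fun c hc x => by
      rw [abs_real_smul, abs_of_pos hc, ← smul_add, norm_smul, Real.norm_of_nonneg hc.le,
        mul_div_assoc])
    (fun x z => by
      rw [← add_div]
      refine div_le_div_of_nonneg_right ((norm_le_of_nonneg_of_le ?_ ?_).trans
        (norm_add_le _ _)) zero_le_two
      · rw [← neg_le_iff_add_nonneg']; exact neg_le_abs _
      · rw [add_add_add_comm]; exact add_le_add_right (abs_add_le x z) _)
    (by
      rintro ⟨x, hx⟩
      obtain ⟨a, rfl⟩ := Submodule.mem_span_singleton.1 hx
      rw [LinearPMap.mkSpanSingleton'_apply]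
      simp only [smul_eq_mul]
      rcases le_total 0 a with ha | ha
      · rw [abs_of_nonneg (real_smul_nonneg ha hy), ← two_smul ℝ, norm_smul, norm_smul,
          Real.norm_of_nonneg ha]
        norm_num
      · exact (mul_nonpos_of_nonpos_of_nonneg ha (norm_nonneg _)).trans (by positivity))
  have hbd : ∀ x, ‖g x‖ ≤ 1 * ‖x‖ := by
    have h1 : ∀ x, g x ≤ ‖x‖ := fun x => (hg2 x).trans (by
      have := norm_add_le x |x|
      rw [norm_abs_eq_norm] at this
      linarith)
    intro x
    rw [one_mul, Real.norm_eq_abs, abs_le']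
    refine ⟨h1 x, ?_⟩
    rw [← map_neg, ← norm_neg]
    exact h1 (-x)
  refine ⟨g.mkContinuous 1 hbd, fun x hx => ?_, LinearMap.mkContinuous_norm_le _ zero_le_one _, ?_⟩
  · have := hg2 (-x)
    rw [abs_neg, abs_of_nonneg hx, neg_add_cancel, norm_zero, zero_div, map_neg] at this
    exact neg_nonpos.1 this
  · have := hg1 ⟨y, Submodule.mem_span_singleton_self y⟩
    rw [LinearPMap.mkSpanSingleton_apply] at this
    exact this

lemma abs_apply_le_of_nonneg {φ : E →L[ℝ] ℝ} (hφ : ∀ x, 0 ≤ x → 0 ≤ φ x) (x : E) :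
    |φ x| ≤ φ |x| := by
  have h1 := hφ _ (sub_nonneg.2 (le_abs_self x))
  have h2 := hφ _ (sub_nonneg.2 (neg_le_abs x))
  rw [map_sub, sub_nonneg] at h1 h2
  exact abs_le'.2 ⟨h1, by rwa [map_neg] at h2⟩

variable [CompleteSpace E]

/-- A positive functional of norm one which is almost an eigenfunctional of `C`. -/
lemma exists_almost_eigenfunctional {C : E →L[ℝ] E} (hC : Pos C) (hr : 0 < rad C) (k : ℕ) :
    ∃ (φ : E →L[ℝ] ℝ) (z : E), (∀ x, 0 ≤ x → 0 ≤ φ x) ∧ ‖φ‖ ≤ 1 ∧ 0 ≤ z ∧ ‖z‖ ≤ 1 ∧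
      1 / 2 ≤ φ z ∧ ∀ x, |φ (C x) - rad C * φ x| ≤ 2 * (1 / (k + 1)) * ‖x‖ := by
  obtain ⟨Q, x, hQ, hx0, hx1, hQx⟩ := exists_large_resolvent hC hr (k + 1)
  push_cast at hQ hQx
  have hQx0 : Q x ≠ 0 := norm_pos_iff.1 (lt_trans (by positivity) hQx)
  obtain ⟨ψ, hψ, hψ1, hψx⟩ := exists_pos_dual hQx0 (hQ.pos x hx0)
  let f : E →L[ℝ] ℝ := ψ ∘L Q
  have hf : ∀ y, 0 ≤ y → 0 ≤ f y := fun y hy => hψ _ (hQ.pos y hy)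
  have hfn : (k : ℝ) + 1 < ‖f‖ := by
    refine hQx.trans_le ?_
    rw [← hψx]
    exact (le_abs_self (f x)).trans ((f.le_opNorm x).trans
      (mul_le_of_le_one_right (norm_nonneg _) hx1))
  have hk : (0 : ℝ) < k + 1 := by positivity
  have hf0 : 0 < ‖f‖ := hk.trans hfn
  have hinv : ‖f‖⁻¹ ≤ 1 / (k + 1) := by
    rw [one_div]; exact inv_anti₀ hk hfn.le
  obtain ⟨z, hz1, hz⟩ := f.exists_lt_apply_of_lt_opNorm (half_lt_self hf0)
  have hφ1 : ‖‖f‖⁻¹ • f‖ ≤ 1 := by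
    rw [norm_smul, norm_inv, norm_norm, inv_mul_cancel₀ hf0.ne']
  refine ⟨‖f‖⁻¹ • f, |z|, fun y hy => mul_nonneg (inv_nonneg.2 hf0.le) (hf y hy), hφ1,
    abs_nonneg z, by rw [norm_abs_eq_norm]; exact hz1.le, ?_, fun y => ?_⟩
  · rw [smul_apply, smul_eq_mul, inv_mul_eq_div, le_div_iff₀ hf0, one_div, inv_mul_eq_div]
    exact hz.le.trans (abs_apply_le_of_nonneg hf z)
  · have h1 : f (C y) = (rad C + 1 / (k + 1 + 1)) * f y - ψ y := by
      have := congrArg (fun S : E →L[ℝ] E => ψ (S y)) hQ.eq_mul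
      simp only [mul_apply_eq_comp, sub_apply, smul_apply, one_apply_eq_self, map_sub,
        map_smul, smul_eq_mul] at this
      exact this
    have h2 : (‖f‖⁻¹ • f) (C y) - rad C * (‖f‖⁻¹ • f) y =
        1 / (k + 1 + 1) * (‖f‖⁻¹ • f) y - ‖f‖⁻¹ * ψ y := by
      simp only [smul_apply, smul_eq_mul, h1]; ring
    have h3 : |(‖f‖⁻¹ • f) y| ≤ ‖y‖ :=
      (ContinuousLinearMap.le_opNorm _ y).trans (mul_le_of_le_one_left (norm_nonneg _) hφ1)
    have h4 : |ψ y| ≤ ‖y‖ :=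
      (ψ.le_opNorm y).trans (mul_le_of_le_one_left (norm_nonneg _) hψ1)
    rw [h2]
    refine (abs_sub _ _).trans ?_
    rw [abs_mul, abs_mul, abs_of_pos (inv_pos.2 hf0), abs_of_pos (by positivity), two_mul, add_mul]
    gcongr
    exact le_add_of_nonneg_right zero_le_one

/-- Krein–Rutman type theorem for the adjoint. -/
lemma exists_pos_eigenfunctional {X C : E →L[ℝ] E} {n : ℕ} (hC : Pos C) (hr : 0 < rad C)
    (hX : IsCompactOperator X) (hXC : Pos (X - C ^ n)) :
    ∃ φ : E →L[ℝ] ℝ, (∀ x, 0 ≤ x → 0 ≤ φ x) ∧ (∀ x, φ (C x) = rad C * φ x) ∧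
      ∃ y, 0 ≤ y ∧ 0 < φ y := by
  choose φ z hφ hφ1 hz0 hz1 hφz hφC using exists_almost_eigenfunctional hC hr
  obtain ⟨U, hU⟩ : ∃ U : Ultrafilter ℕ, (U : Filter ℕ) ≤ atTop :=
    ⟨hyperfilter ℕ, Nat.hyperfilter_le_atTop⟩
  have hinv : Tendsto (fun k : ℕ => 1 / ((k : ℝ) + 1)) U (𝓝 0) :=
    tendsto_one_div_add_atTop_nhds_zero_nat.mono_left hU
  -- the weak-star limit
  obtain ⟨Φ, -, hΦ⟩ := (WeakDual.isCompact_closedBall (𝕜 := ℝ) (E := E) 0 1).ultrafilter_le_nhds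
    (U.map fun k => StrongDual.toWeakDual (φ k)) (by
      rw [Ultrafilter.coe_map, le_principal_iff, mem_map]
      filter_upwards with k
      simpa using hφ1 k)
  have hlim : ∀ x, Tendsto (fun k => φ k x) U (𝓝 (Φ x)) := fun x =>
    ((WeakDual.eval_continuous x).tendsto Φ).comp hΦ
  have heig : ∀ (u : ℕ → E) (M a : ℝ), (∀ k, ‖u k‖ ≤ M) →
      Tendsto (fun k => φ k (u k)) U (𝓝 a) →
      Tendsto (fun k => φ k (C (u k))) U (𝓝 (rad C * a)) := by
    intro u M a hu ha
    have h1 : Tendsto (fun k => φ k (C (u k)) - rad C * φ k (u k)) U (𝓝 0) := by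
      refine squeeze_zero_norm (a := fun k : ℕ => 2 * (1 / ((k : ℝ) + 1)) * M) (fun k => ?_)
        (by simpa using (hinv.const_mul 2).mul_const M)
      refine (hφC k _).trans ?_
      gcongr
      exact hu k
    simpa using h1.add (ha.const_mul (rad C))
  refine ⟨WeakDual.toStrongDual Φ, fun x hx => ge_of_tendsto' (hlim x) fun k => hφ k x hx,
    fun x => ?_, ?_⟩
  · exact tendsto_nhds_unique (hlim (C x)) (heig (fun _ => x) ‖x‖ _ (fun _ => le_rfl) (hlim x))
  · obtain ⟨a, ha, hza⟩ := (isCompact_Icc (a := (1 / 2 : ℝ)) (b := 1)).ultrafilter_le_nhds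
      (U.map fun k => φ k (z k)) (by
        rw [Ultrafilter.coe_map, le_principal_iff, mem_map]
        filter_upwards with k
        refine ⟨hφz k, (le_abs_self _).trans (((φ k).le_opNorm _).trans ?_)⟩
        exact mul_le_one₀ (hφ1 k) (norm_nonneg _) (hz1 k))
    have hza' : Tendsto (fun k => φ k (z k)) U (𝓝 a) := hza
    have hpow : ∀ i, Tendsto (fun k => φ k ((C ^ i) (z k))) U (𝓝 (rad C ^ i * a)) := by
      intro i
      induction i with
      | zero => simpa using hza'
      | succ i ih =>
        have := heig (fun k => (C ^ i) (z k)) ‖C ^ i‖ _ (fun k => ?_) ih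
        · rw [← mul_assoc, ← pow_succ'] at this
          simpa only [pow_succ' C, mul_apply_eq_comp] using this
        · exact ((C ^ i).le_opNorm _).trans (mul_le_of_le_one_right (norm_nonneg _) (hz1 k))
    obtain ⟨K, hK, hKX⟩ := hX.image_closedBall_subset_compact 1
    obtain ⟨w, -, hw⟩ := hK.ultrafilter_le_nhds (U.map fun k => X (z k)) (by
      rw [Ultrafilter.coe_map, le_principal_iff, mem_map]
      filter_upwards with k
      exact hKX ⟨z k, by simpa using hz1 k, rfl⟩)
    have hw' : Tendsto (fun k => X (z k)) U (𝓝 w) := hw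
    have hφX : Tendsto (fun k => φ k (X (z k))) U (𝓝 (Φ w)) := by
      have h1 : Tendsto (fun k => φ k (X (z k) - w)) U (𝓝 0) := by
        refine squeeze_zero_norm (a := fun k => ‖X (z k) - w‖) (fun k => ?_) ?_
        · exact ((φ k).le_opNorm _).trans (mul_le_of_le_one_left (norm_nonneg _) (hφ1 k))
        · simpa using (hw'.sub_const w).norm
      simpa using h1.add (hlim w)
    have hle : ∀ k, φ k ((C ^ n) (z k)) ≤ φ k (X (z k)) := by
      intro k
      have := hφ k _ (hXC _ (hz0 k))
      rwa [sub_apply, map_sub, sub_nonneg] at this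
    have hXz : ∀ k, 0 ≤ X (z k) := fun k => by
      have := (hXC.add (hC.pow n)) _ (hz0 k)
      rwa [sub_add_cancel] at this
    refine ⟨w, isClosed_nonneg.mem_of_tendsto hw' (Eventually.of_forall hXz), ?_⟩
    have h1 : rad C ^ n * a ≤ Φ w := le_of_tendsto_of_tendsto' (hpow n) hφX hle
    refine lt_of_lt_of_le ?_ h1
    have : 0 < a := by linarith [ha.1]
    positivity

end Functional

section Main

variable {E : Type*} [NormedAddCommGroup E] [Lattice E] [HasSolidNorm E] [IsOrderedAddMonoid E]
  [NormedSpace ℝ E] {A B C P R X Y : E →L[ℝ] E} {n : ℕ}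

lemma sum_pow_mul_commutator_mul_pow {𝓡 : Type*} [Ring 𝓡] (X Y : 𝓡) (m : ℕ) :
    ∑ i ∈ Finset.range m, X ^ i * (X * Y - Y * X) * X ^ (m - 1 - i) = X ^ m * Y - Y * X ^ m := by
  induction m with
  | zero => simp
  | succ m ih =>
    rw [Finset.sum_range_succ, Nat.add_sub_cancel, Nat.sub_self, pow_zero, mul_one]
    have h1 : ∀ i ∈ Finset.range m, X ^ i * (X * Y - Y * X) * X ^ (m - i) =
        X ^ i * (X * Y - Y * X) * X ^ (m - 1 - i) * X := by
      intro i hi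
      have : m - i = m - 1 - i + 1 := by have := Finset.mem_range.1 hi; omega
      rw [this, pow_succ, ← mul_assoc]
    rw [Finset.sum_congr rfl h1, ← Finset.sum_mul, ih, pow_succ]
    noncomm_ring

lemma Pos.pow_mul_sub_mul_pow (hA : Pos A) (h : Pos (A * B - B * A)) (n : ℕ) :
    Pos (A ^ n * B - B * A ^ n) := by
  induction n with
  | zero => simpa using Pos.zero
  | succ n ih =>
    have : A ^ (n + 1) * B - B * A ^ (n + 1) =
        A * (A ^ n * B - B * A ^ n) + (A * B - B * A) * A ^ n := by
      rw [pow_succ']; noncomm_ring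
    rw [this]
    exact (hA.mul ih).add (h.mul (hA.pow n))

lemma Pos.mul_pow_sub_pow_mul (hB : Pos B) (h : Pos (A * B - B * A)) (n : ℕ) :
    Pos (A * B ^ n - B ^ n * A) := by
  induction n with
  | zero => simpa using Pos.zero
  | succ n ih =>
    have : A * B ^ (n + 1) - B ^ (n + 1) * A =
        (A * B - B * A) * B ^ n + B * (A * B ^ n - B ^ n * A) := by
      rw [pow_succ']; noncomm_ring
    rw [this]
    exact (h.mul (hB.pow n)).add (hB.mul ih)

lemma Pos.pow_mul_pow_sub_mul_pow (hA : Pos A) (hB : Pos B) (h : Pos (A * B - B * A)) (n : ℕ) :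
    Pos (A ^ n * B ^ n - (A * B) ^ n) := by
  induction n with
  | zero => simpa using Pos.zero
  | succ n ih =>
    have : A ^ (n + 1) * B ^ (n + 1) - (A * B) ^ (n + 1) =
        A * (A ^ n * B - B * A ^ n) * B ^ n + A * B * (A ^ n * B ^ n - (A * B) ^ n) := by
      rw [pow_succ', pow_succ', pow_succ']; noncomm_ring
    rw [this]
    exact ((hA.mul (hA.pow_mul_sub_mul_pow h n)).mul (hB.pow n)).add ((hA.mul hB).mul ih)

variable [CompleteSpace E]

lemma rad_eq_zero_of_sum_le (hX : Pos X) (hXc : IsCompactOperator X) (hC : Pos C)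
    (hXCn : Pos (X - C ^ n)) (hXC : Pos (X - X * C))
    (hs : ∀ m, Pos (X ^ m - ∑ i ∈ Finset.range m, X ^ i * (X * C) * X ^ (m - 1 - i))) :
    rad C = 0 := by
  by_contra hne
  have hr : 0 < rad C := (rad_nonneg C).lt_of_ne' hne
  obtain ⟨φ, hφ, hφC, hy⟩ := exists_pos_eigenfunctional hC hr hXc hXCn
  have hle : ∀ {S T : E →L[ℝ] E}, Pos (T - S) → ∀ x, 0 ≤ x → φ (S x) ≤ φ (T x) := by
    intro S T h x hx
    have := hφ _ (h x hx)
    rwa [sub_apply, map_sub, sub_nonneg] at this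
  have hφCn : ∀ i x, φ ((C ^ i) x) = rad C ^ i * φ x := by
    intro i
    induction i with
    | zero => simp
    | succ i ih => intro x; rw [pow_succ, mul_apply_eq_comp, ih, hφC, pow_succ, mul_assoc]
  refine PreCore.elim (X := X) (C := C) (φ := φ) (r := rad C) (δ := rad C ^ n) (c := 1)
    (c' := max (rad C) 1)
    { posX := hX, compact := hXc, posC := hC, nonneg := hφ, r_pos := hr, δ_pos := pow_pos hr n,
      apply_C := hφC, le_apply_X := fun x hx => ?_, pow_C_le := fun i x hx => ?_,
      sum_le := fun m x hx => ?_, exists_pos := hy }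
  · rw [← hφCn]
    exact hle hXCn x hx
  · have h0 := hφ _ (hX.pow i x hx)
    cases i with
    | zero =>
      rw [pow_zero, one_apply_eq_self, one_apply_eq_self, hφC]
      exact mul_le_mul_of_nonneg_right (le_max_left _ _) (hφ x hx)
    | succ i =>
      have h1 : φ ((X ^ (i + 1)) (C x)) ≤ φ ((X ^ (i + 1)) x) := by
        refine hle (S := X ^ (i + 1) * C) ?_ x hx
        have : X ^ (i + 1) - X ^ (i + 1) * C = X ^ i * (X - X * C) := by
          rw [pow_succ]; noncomm_ring
        rw [this]
        exact (hX.pow i).mul hXC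
      exact h1.trans (le_mul_of_one_le_left h0 (le_max_right _ _))
  · have := hle (hs m) x hx
    rw [sum_apply, map_sum] at this
    rw [one_mul]
    refine le_trans (le_of_eq (Finset.sum_congr rfl fun i _ => ?_)) this
    rw [pow_succ]
    rfl

lemma rad_eq_zero_of_commutator (hP : Pos P) (hPc : IsCompactOperator P) (hC : Pos C)
    (hR : Pos R) (hR1 : Pos (R - 1)) (hRY : R * Y - Y * R = R * C * R)
    (hPY : Pos (P * Y - Y * P)) (hRC : Pos (R - R * C)) (hCn : Pos (R * P * R - C ^ n))
    (hbd : ∀ m, Pos ((R * P * R) ^ m - ((R * P * R) ^ m * Y - Y * (R * P * R) ^ m))) :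
    rad C = 0 := by
  have hXc : IsCompactOperator (R * P * R) := (hPc.clm_comp R).comp_clm R
  have hX : Pos (R * P * R) := (hR.mul hP).mul hR
  generalize hXdef : R * P * R = X at hX hXc hCn hbd
  have hD : Pos (X * Y - Y * X - X * C) := by
    have : X * Y - Y * X - X * C = X * C * (R - 1) + R * (P * Y - Y * P) * R
        + R * C * R * P * R := by
      have h1 : X * Y - Y * X = R * P * (R * Y - Y * R) + R * (P * Y - Y * P) * R
          + (R * Y - Y * R) * P * R := by rw [← hXdef]; noncomm_ring
      rw [h1, hRY, ← hXdef]; noncomm_ring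
    rw [this]
    exact (((hX.mul hC).mul hR1).add ((hR.mul hPY).mul hR)).add
      ((((hR.mul hC).mul hR).mul hP).mul hR)
  refine rad_eq_zero_of_sum_le (n := n) hX hXc hC hCn ?_ fun m => ?_
  · have : X - X * C = R * P * (R - R * C) := by rw [← hXdef]; noncomm_ring
    rw [this]
    exact (hR.mul hP).mul hRC
  · refine Pos.sub_trans ?_ (hbd m)
    rw [← sum_pow_mul_commutator_mul_pow, ← Finset.sum_sub_distrib]
    refine Pos.sum fun i _ => ?_
    rw [← sub_mul, ← mul_sub]
    exact ((hX.pow _).mul hD).mul (hX.pow _)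

lemma rad_eq_zero_of_norm_lt_one (hA : Pos A) (hB : Pos B) (hC : Pos (A * B - B * A))
    (hpc : IsCompactOperator ⇑(A ^ n) ∨ IsCompactOperator ⇑(B ^ n)) (h1 : ‖A + B‖ < 1) :
    rad (A * B - B * A) = 0 := by
  have hS : Pos (A + B) := hA.add hB
  obtain ⟨R, hR, hRl, hRr⟩ := exists_pos_inverse hS (summable_geometric_of_norm_lt_one h1)
  obtain ⟨C, hCdef⟩ : ∃ C, C = A * B - B * A := ⟨_, rfl⟩
  rw [← hCdef] at hC ⊢
  have hRl' : R - 1 = R * (A + B) := by rw [← hRl]; noncomm_ring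
  have hRr' : R - 1 = (A + B) * R := by rw [← hRr]; noncomm_ring
  have hR1 : Pos (R - 1) := by rw [hRl']; exact hR.mul hS
  have hone : Pos (1 : E →L[ℝ] E) := Pos.one
  have hRA : Pos (R - R * A) := by
    have : R - R * A = R * B + R * (1 - (A + B)) := by noncomm_ring
    rw [this, hRl]
    exact (hR.mul hB).add hone
  have hRB : Pos (R - R * B) := by
    have : R - R * B = R * A + R * (1 - (A + B)) := by noncomm_ring
    rw [this, hRl]
    exact (hR.mul hA).add hone
  have hAR : Pos (R - A * R) := by
    have : R - A * R = B * R + (1 - (A + B)) * R := by noncomm_ring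
    rw [this, hRr]
    exact (hB.mul hR).add hone
  have hRBB : R * B - B * R = R * C * R := by
    have : R * B - B * R = R * B * ((1 - (A + B)) * R) - R * (1 - (A + B)) * B * R := by
      rw [hRr, hRl]; noncomm_ring
    rw [this, hCdef]; noncomm_ring
  have hRAA : R * (-A) - (-A) * R = R * C * R := by
    have : R * (-A) - (-A) * R = R * (1 - (A + B)) * A * R - R * A * ((1 - (A + B)) * R) := by
      rw [hRr, hRl]; noncomm_ring
    rw [this, hCdef]; noncomm_ring
  have hCAB : Pos (A * B - C) := by
    have : A * B - C = B * A := by rw [hCdef]; noncomm_ring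
    rw [this]; exact hB.mul hA
  have hRC : Pos (R - R * C) := by
    have : R - R * C = (R - R * B) + (R - R * A) * B + R * (A * B - C) := by noncomm_ring
    rw [this]
    exact (hRB.add (hRA.mul hB)).add (hR.mul hCAB)
  have hpow : ∀ k, Pos (R - (A + B) ^ k) := by
    intro k
    induction k with
    | zero => simpa using hR1
    | succ k ih =>
      have : R - (A + B) ^ (k + 1) = 1 + (A + B) * (R - (A + B) ^ k) := by
        rw [pow_succ', mul_sub, ← hRr']; noncomm_ring
      rw [this]
      exact hone.add (hS.mul ih)
  have hRAn : Pos (R - A ^ n) :=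
    Pos.sub_trans (hA.pow_sub_pow (by simpa using hB) n) (hpow n)
  have hRBn : Pos (R - B ^ n) :=
    Pos.sub_trans (hB.pow_sub_pow (by simpa using hA) n) (hpow n)
  have hCn : Pos (A ^ n * B ^ n - C ^ n) :=
    Pos.sub_trans (hC.pow_sub_pow hCAB n)
      (hA.pow_mul_pow_sub_mul_pow hB (by rwa [← hCdef]) n)
  rcases hpc with hc | hc
  · have hAn := hA.pow n
    refine rad_eq_zero_of_commutator (n := n) (Y := B) hAn hc hC hR hR1 hRBB
      (hA.pow_mul_sub_mul_pow (by rwa [← hCdef]) n) hRC (hCn.sub_trans ?_) fun m => ?_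
    · refine Pos.mul_sub_mul ?_ hRBn (hR.mul hAn) (hB.pow n)
      have : R * A ^ n - A ^ n = (R - 1) * A ^ n := by noncomm_ring
      rw [this]
      exact hR1.mul hAn
    · have hX : Pos (R * A ^ n * R) := (hR.mul hAn).mul hR
      cases m with
      | zero => simpa using hone
      | succ m =>
        generalize hXdef : R * A ^ n * R = X at hX ⊢
        have : X ^ (m + 1) - (X ^ (m + 1) * B - B * X ^ (m + 1)) =
            X ^ m * (R * A ^ n * (R - R * B)) + B * X ^ (m + 1) := by
          have : R * A ^ n * (R - R * B) = X - X * B := by rw [← hXdef]; noncomm_ring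
          rw [this, pow_succ]; noncomm_ring
        rw [this]
        exact ((hX.pow m).mul ((hR.mul hAn).mul hRB)).add (hB.mul (hX.pow _))
  · have hBn := hB.pow n
    refine rad_eq_zero_of_commutator (n := n) (Y := -A) hBn hc hC hR hR1 hRAA
      ?_ hRC (hCn.sub_trans ?_) fun m => ?_
    · have : B ^ n * -A - -A * B ^ n = A * B ^ n - B ^ n * A := by noncomm_ring
      rw [this]
      exact hB.mul_pow_sub_pow_mul (by rwa [← hCdef]) n
    · rw [← mul_one (A ^ n * B ^ n)]
      refine Pos.mul_sub_mul ?_ hR1 (hR.mul hBn) hone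
      rw [← sub_mul]
      exact hRAn.mul hBn
    · have hX : Pos (R * B ^ n * R) := (hR.mul hBn).mul hR
      cases m with
      | zero => simpa using hone
      | succ m =>
        generalize hXdef : R * B ^ n * R = X at hX ⊢
        have : X ^ (m + 1) - (X ^ (m + 1) * -A - -A * X ^ (m + 1)) =
            (R - A * R) * B ^ n * R * X ^ m + X ^ (m + 1) * A := by
          have : (R - A * R) * B ^ n * R = X - A * X := by rw [← hXdef]; noncomm_ring
          rw [this, pow_succ']; noncomm_ring
        rw [this]
        exact (((hAR.mul hBn).mul hR).mul (hX.pow m)).add ((hX.pow _).mul hA)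

/-- The geometric bounds expressing that the commutator is quasi-nilpotent. -/
lemma exists_norm_pow_commutator_le (hA : Pos A) (hB : Pos B) (hC : Pos (A * B - B * A))
    (hpc : IsCompactOperator ⇑(A ^ n) ∨ IsCompactOperator ⇑(B ^ n)) {ε : ℝ} (hε : 0 < ε) :
    ∃ M, 0 < M ∧ ∀ k, ‖(A * B - B * A) ^ k‖ ≤ M * ε ^ k := by
  obtain ⟨t, ht, hlt⟩ : ∃ t : ℝ, 0 < t ∧ t * ‖A + B‖ < 1 :=
    ⟨(‖A + B‖ + 1)⁻¹, by positivity, by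
      rw [inv_mul_eq_div, div_lt_one (by positivity)]; linarith⟩
  have hcomm : (t • A) * (t • B) - (t • B) * (t • A) = (t * t) • (A * B - B * A) := by
    rw [smul_mul_smul_comm, smul_mul_smul_comm, smul_sub]
  have hC' : Pos ((t * t) • (A * B - B * A)) := hC.smul (by positivity)
  have hrad : rad ((t * t) • (A * B - B * A)) = 0 := by
    rw [← hcomm]
    refine rad_eq_zero_of_norm_lt_one (n := n) (hA.smul ht.le) (hB.smul ht.le)
      (by rwa [hcomm]) ?_ ?_
    · rw [smul_pow, smul_pow]
      exact hpc.imp (fun h => h.smul _) (fun h => h.smul _)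
    · rwa [← smul_add, norm_smul, Real.norm_of_nonneg ht.le]
  obtain ⟨Q, hQ⟩ := mem_posResSet_of_rad_lt hC' (μ := t * t * ε) (by rw [hrad]; positivity)
  refine ⟨t * t * ε * ‖Q‖ + 1, by positivity, fun k => ?_⟩
  have := hQ.norm_pow_le hC' k
  rw [smul_pow, norm_smul, Real.norm_of_nonneg (by positivity), mul_pow (t * t) ε] at this
  have h2 : 0 < (t * t) ^ k := by positivity
  have h3 : 0 < ε ^ k := by positivity
  have h4 : ‖(A * B - B * A) ^ k‖ ≤ t * t * ε * ‖Q‖ * ε ^ k := by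
    rw [← mul_le_mul_iff_right₀ h2]
    linarith
  linarith

end Main

end PosComm

/-- If `A` and `B` are positive operators on a Banach lattice `E` with positive
commutator `C = A B - B A`, and one of `A`, `B` is power-compact, then `C` is quasi-nilpotent. -/
theorem stmt2 {E : Type*} [NormedAddCommGroup E] [Lattice E] [HasSolidNorm E]
    [IsOrderedAddMonoid E] [NormedSpace ℝ E] [CompleteSpace E]
    (A B : E →L[ℝ] E)
    (hA : ∀ x : E, 0 ≤ x → 0 ≤ A x)
    (hB : ∀ x : E, 0 ≤ x → 0 ≤ B x)
    (hC : ∀ x : E, 0 ≤ x → 0 ≤ (A * B - B * A) x)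
    (hpc : (∃ n : ℕ, 1 ≤ n ∧ IsCompactOperator ⇑(A ^ n)) ∨
           (∃ n : ℕ, 1 ≤ n ∧ IsCompactOperator ⇑(B ^ n))) :
    Tendsto (fun n : ℕ => ‖(A * B - B * A) ^ n‖ ^ (1 / (n : ℝ))) atTop (𝓝 0) := by
  have hbd : ∀ ε : ℝ, 0 < ε → ∃ M, 0 < M ∧ ∀ k, ‖(A * B - B * A) ^ k‖ ≤ M * ε ^ k := by
    intro ε hε
    rcases hpc with ⟨n, -, h⟩ | ⟨n, -, h⟩
    · exact PosComm.exists_norm_pow_commutator_le hA hB hC (Or.inl h) hε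
    · exact PosComm.exists_norm_pow_commutator_le hA hB hC (Or.inr h) hε
  refine tendsto_order.2 ⟨fun a ha => Eventually.of_forall fun n => ha.trans_le (by positivity),
    fun a ha => ?_⟩
  obtain ⟨M, hM, hle⟩ := hbd (a / 2) (by positivity)
  have hlim : Tendsto (fun n : ℕ => M ^ (1 / (n : ℝ)) * (a / 2)) atTop (𝓝 (M ^ (0 : ℝ) * (a / 2))) :=
    ((Real.continuous_const_rpow hM.ne').tendsto 0 |>.comp
      tendsto_one_div_atTop_nhds_zero_nat).mul_const _
  rw [Real.rpow_zero, one_mul] at hlim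
  filter_upwards [hlim.eventually_lt_const (half_lt_self ha), eventually_gt_atTop 0] with n hn hn0
  refine lt_of_le_of_lt ?_ hn
  calc ‖(A * B - B * A) ^ n‖ ^ (1 / (n : ℝ)) ≤ (M * (a / 2) ^ n) ^ (1 / (n : ℝ)) :=
        Real.rpow_le_rpow (norm_nonneg _) (hle n) (by positivity)
    _ = M ^ (1 / (n : ℝ)) * (a / 2) := by
        rw [Real.mul_rpow hM.le (by positivity), one_div,
          Real.pow_rpow_inv_natCast (by positivity) hn0.ne']
end

section
/- Let E be a Banach lattice and let A and B be positive bounded linear operators on E such that the commutator C = AB − BA is a positive operator. If one of the operators A and B is power-compact, then the commutator C is ideal-triangularizable: there exists a chain of closed ideals of E, each invariant under C, which is a maximal chain in the lattice of all closed ideals of E. -/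
/-- A closed ideal of a Banach lattice: a topologically closed linear subspace that is solid. -/
def IsClosedIdeal {E : Type*} [NormedAddCommGroup E] [Lattice E] [HasSolidNorm E] [IsOrderedAddMonoid E]
    [NormedSpace ℝ E]
    (I : Submodule ℝ E) : Prop :=
  IsClosed (I : Set E) ∧ ∀ x y : E, |x| ≤ |y| → y ∈ I → x ∈ I

/-- A subspace `I` is invariant under an operator `T` if `T` maps `I` into `I`. -/
def InvariantUnder {E : Type*} [NormedAddCommGroup E] [Lattice E] [HasSolidNorm E] [IsOrderedAddMonoid E]
    [NormedSpace ℝ E]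
    (T : E →L[ℝ] E) (I : Submodule ℝ E) : Prop :=
  ∀ x ∈ I, T x ∈ I

section BanachLattice

open Filter Topology

set_option linter.unusedSectionVars false

/-- In a normed lattice, multiplication by a nonnegative real preserves positivity. -/
theorem smul_nonneg_of_solid {E : Type*} [NormedAddCommGroup E] [Lattice E] [HasSolidNorm E]
    [IsOrderedAddMonoid E] [NormedSpace ℝ E] {c : ℝ} (hc : 0 ≤ c) {x : E} (hx : 0 ≤ x) :
    0 ≤ c • x := by
  have hdy (k : ℕ) : 0 ≤ ((2 : ℝ) ^ k)⁻¹ • x := by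
    induction k with
    | zero => simpa using hx
    | succ k ih =>
      refine nsmul_two_semiclosed ?_
      rw [← Nat.cast_smul_eq_nsmul ℝ, smul_smul]
      convert ih using 2
      rw [pow_succ, Nat.cast_ofNat]
      field_simp
  have hcl : IsClosed {r : ℝ | 0 ≤ r • x} := isClosed_nonneg.preimage (by fun_prop)
  have hlim : Tendsto (fun k : ℕ => (⌊c * (2 : ℝ) ^ k⌋₊ : ℝ) / (2 : ℝ) ^ k) atTop (𝓝 c) :=
    (tendsto_nat_floor_mul_div_atTop hc).comp (tendsto_pow_atTop_atTop_of_one_lt one_lt_two)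
  refine hcl.mem_of_tendsto hlim (Eventually.of_forall fun k => ?_)
  simp only [Set.mem_ofPred_eq]
  rw [div_eq_mul_inv, mul_smul, Nat.cast_smul_eq_nsmul]
  exact nsmul_nonneg (hdy k) _

instance (priority := 50) isOrderedModule_of_solid {E : Type*} [NormedAddCommGroup E] [Lattice E]
    [HasSolidNorm E] [IsOrderedAddMonoid E] [NormedSpace ℝ E] : IsOrderedModule ℝ E :=
  .of_smul_nonneg fun _ hc _ hx => smul_nonneg_of_solid hc hx

variable {E F : Type*} [NormedAddCommGroup E] [Lattice E] [HasSolidNorm E] [IsOrderedAddMonoid E]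
  [NormedSpace ℝ E] [NormedAddCommGroup F] [Lattice F] [HasSolidNorm F] [IsOrderedAddMonoid F]
  [NormedSpace ℝ F]

theorem norm_le_norm_of_nonneg_of_le {x y : E} (hx : 0 ≤ x) (hxy : x ≤ y) : ‖x‖ ≤ ‖y‖ :=
  norm_le_norm_of_abs_le_abs (by rwa [abs_of_nonneg hx, abs_of_nonneg (hx.trans hxy)])

theorem posPart_smul_of_nonneg {c : ℝ} (hc : 0 ≤ c) (x : E) : (c • x)⁺ = c • x⁺ := by
  have key {c : ℝ} (hc : 0 ≤ c) (x : E) : (c • x)⁺ ≤ c • x⁺ :=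
    sup_le (smul_le_smul_of_nonneg_left (le_posPart x) hc) (smul_nonneg hc (posPart_nonneg x))
  refine (key hc x).antisymm ?_
  rcases hc.eq_or_lt with rfl | hc
  · simp
  · have := smul_le_smul_of_nonneg_left (key (inv_nonneg.2 hc.le) (c • x)) hc.le
    rwa [smul_smul, smul_smul, mul_inv_cancel₀ hc.ne', inv_mul_cancel₀ hc.ne', one_smul,
      one_smul] at this

theorem posPart_add_le (x y : E) : (x + y)⁺ ≤ x⁺ + y⁺ :=
  sup_le (add_le_add (le_posPart x) (le_posPart y))
    (add_nonneg (posPart_nonneg x) (posPart_nonneg y))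

theorem abs_real_smul (c : ℝ) (x : E) : |c • x| = |c| • |x| := by
  have key {c : ℝ} (hc : 0 ≤ c) (x : E) : |c • x| = c • |x| := by
    have h : (c • x)⁺ + (-(c • x))⁺ = c • (x⁺ + (-x)⁺) := by
      rw [← smul_neg, posPart_smul_of_nonneg hc, posPart_smul_of_nonneg hc, smul_add]
    rwa [posPart_neg, posPart_neg, posPart_add_negPart, posPart_add_negPart] at h
  rcases le_total 0 c with hc | hc
  · rw [abs_of_nonneg hc, key hc]
  · rw [abs_of_nonpos hc, ← key (neg_nonneg.2 hc), neg_smul, abs_neg]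

/-- There is a positive functional of norm at most one that norms a given positive element. -/
theorem exists_positive_norming (y : E) (hy : 0 ≤ y) :
    ∃ f : E →L[ℝ] ℝ, (∀ x, 0 ≤ x → 0 ≤ f x) ∧ ‖f‖ ≤ 1 ∧ f y = ‖y‖ := by
  have hnorm (x : E) : ‖x⁺‖ ≤ ‖x‖ :=
    (norm_le_norm_of_nonneg_of_le (posPart_nonneg x)
      (sup_le (le_abs_self x) (abs_nonneg x))).trans (norm_abs_eq_norm x).le
  by_cases hy0 : y = 0
  · exact ⟨0, by simp, by simp, by simp [hy0]⟩
  obtain ⟨g, hg, hgN⟩ := exists_extension_of_le_sublinear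
    (LinearPMap.mkSpanSingleton (σ := RingHom.id ℝ) y ‖y‖ hy0) (fun x => ‖x⁺‖)
    (fun c hc x => by rw [posPart_smul_of_nonneg hc.le, norm_smul, Real.norm_of_nonneg hc.le])
    (fun u v => (norm_le_norm_of_nonneg_of_le (posPart_nonneg _) (posPart_add_le u v)).trans
      (norm_add_le _ _))
    (by
      rintro ⟨x, hx⟩
      obtain ⟨c, rfl⟩ := Submodule.mem_span_singleton.1 hx
      rw [LinearPMap.mkSpanSingleton'_apply, RingHom.id_apply, smul_eq_mul]
      rcases le_total 0 c with hc | hc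
      · simp [posPart_smul_of_nonneg hc, norm_smul, abs_of_nonneg hc, posPart_of_nonneg hy]
      · exact (mul_nonpos_of_nonpos_of_nonneg hc (norm_nonneg y)).trans (norm_nonneg _))
  have hgpos (x : E) (hx : 0 ≤ x) : 0 ≤ g x := by
    have := hgN (-x)
    simp only [map_neg, posPart_of_nonpos (neg_nonpos.2 hx), norm_zero] at this
    linarith
  have hbound (x : E) : ‖g x‖ ≤ 1 * ‖x‖ := by
    rw [one_mul, Real.norm_eq_abs, abs_le]
    constructor
    · have := (hgN (-x)).trans (hnorm (-x))
      rw [map_neg, norm_neg] at this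
      linarith
    · exact (hgN x).trans (hnorm x)
  refine ⟨g.mkContinuous 1 hbound, hgpos, g.mkContinuous_norm_le zero_le_one hbound, ?_⟩
  exact (hg ⟨y, Submodule.mem_span_singleton_self y⟩).trans
    (LinearPMap.mkSpanSingleton_apply ℝ ℝ hy0 _)

/-- A bounded operator is positive if it maps positive elements to positive elements. -/
def PositiveOp (T : E →L[ℝ] F) : Prop := ∀ x : E, 0 ≤ x → 0 ≤ T x

theorem PositiveOp.mono {T : E →L[ℝ] F} (hT : PositiveOp T) {x y : E} (h : x ≤ y) : T x ≤ T y := by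
  have := hT (y - x) (sub_nonneg.2 h)
  rwa [map_sub, sub_nonneg] at this

theorem PositiveOp.abs_le {T : E →L[ℝ] F} (hT : PositiveOp T) (x : E) : |T x| ≤ T |x| :=
  abs_le'.2 ⟨hT.mono (le_abs_self x), by rw [← map_neg]; exact hT.mono (neg_le_abs x)⟩

theorem PositiveOp.add {S T : E →L[ℝ] F} (hS : PositiveOp S) (hT : PositiveOp T) :
    PositiveOp (S + T) := fun x hx => add_nonneg (hS x hx) (hT x hx)

theorem PositiveOp.smul {T : E →L[ℝ] F} (hT : PositiveOp T) {c : ℝ} (hc : 0 ≤ c) :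
    PositiveOp (c • T) := fun x hx => smul_nonneg hc (hT x hx)

theorem PositiveOp.one : PositiveOp (1 : E →L[ℝ] E) := fun _ hx => hx

theorem PositiveOp.zero : PositiveOp (0 : E →L[ℝ] F) := fun _ _ => le_rfl

theorem PositiveOp.mul {S T : E →L[ℝ] E} (hS : PositiveOp S) (hT : PositiveOp T) :
    PositiveOp (S * T) := fun x hx => hS _ (hT x hx)

theorem PositiveOp.pow {T : E →L[ℝ] E} (hT : PositiveOp T) (n : ℕ) : PositiveOp (T ^ n) := by
  induction n with
  | zero => simpa using PositiveOp.one
  | succ n ih => rw [pow_succ]; exact ih.mul hT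

theorem PositiveOp.norm_le {S T : E →L[ℝ] F} (hS : PositiveOp S) (hST : PositiveOp (T - S)) :
    ‖S‖ ≤ ‖T‖ := by
  refine S.opNorm_le_bound (norm_nonneg T) fun x => ?_
  have h1 : S |x| ≤ T |x| := sub_nonneg.1 (hST |x| (abs_nonneg x))
  calc ‖S x‖ = ‖|S x|‖ := (norm_abs_eq_norm _).symm
    _ ≤ ‖T |x|‖ := norm_le_norm_of_nonneg_of_le (abs_nonneg _) ((hS.abs_le x).trans h1)
    _ ≤ ‖T‖ * ‖|x|‖ := T.le_opNorm _
    _ = ‖T‖ * ‖x‖ := by rw [norm_abs_eq_norm]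

theorem eq_zero_of_forall_nonneg {T : E →L[ℝ] F} (h : ∀ x : E, 0 ≤ x → T x = 0) : T = 0 := by
  ext x
  rw [← posPart_sub_negPart x, map_sub, h _ (posPart_nonneg x), h _ (negPart_nonneg x)]
  simp

theorem PositiveOp.trans {R S T : E →L[ℝ] E} (h₁ : PositiveOp (S - R)) (h₂ : PositiveOp (T - S)) :
    PositiveOp (T - R) := by
  simpa using h₂.add h₁

/-- If `U V ≤ V U`, then `V ^ m U ^ m` dominates both `(U V) ^ m` and `(V U) ^ m`. -/
theorem PositiveOp.mul_pow_le {U V : E →L[ℝ] E} (hU : PositiveOp U) (hV : PositiveOp V)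
    (h : PositiveOp (V * U - U * V)) (m : ℕ) :
    PositiveOp (V ^ m * U ^ m - (U * V) ^ m) ∧ PositiveOp (V ^ m * U ^ m - (V * U) ^ m) := by
  have h1 (m : ℕ) : PositiveOp (V ^ m * U - U * V ^ m) := by
    induction m with
    | zero => simpa using PositiveOp.zero
    | succ m ih =>
      have : V ^ (m + 1) * U - U * V ^ (m + 1)
          = V ^ m * (V * U - U * V) + (V ^ m * U - U * V ^ m) * V := by
        rw [pow_succ]; noncomm_ring
      rw [this]
      exact ((hV.pow m).mul h).add (ih.mul hV)
  have h2 (m : ℕ) : PositiveOp (V ^ m * U ^ m - (V * U) ^ m) := by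
    induction m with
    | zero => simpa using PositiveOp.zero
    | succ m ih =>
      have : V ^ (m + 1) * U ^ (m + 1) - (V * U) ^ (m + 1)
          = V * (V ^ m * U - U * V ^ m) * U ^ m + V * U * (V ^ m * U ^ m - (V * U) ^ m) := by
        rw [pow_succ', pow_succ', pow_succ']; noncomm_ring
      rw [this]
      exact ((hV.mul (h1 m)).mul (hU.pow m)).add ((hV.mul hU).mul ih)
  have h3 (m : ℕ) : PositiveOp ((V * U) ^ m - (U * V) ^ m) := by
    induction m with
    | zero => simpa using PositiveOp.zero
    | succ m ih =>
      have : (V * U) ^ (m + 1) - (U * V) ^ (m + 1)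
          = (V * U - U * V) * (V * U) ^ m + U * V * ((V * U) ^ m - (U * V) ^ m) := by
        rw [pow_succ', pow_succ']; noncomm_ring
      rw [this]
      exact (h.mul ((hV.mul hU).pow m)).add ((hU.mul hV).mul ih)
  exact ⟨(h3 m).trans (h2 m), h2 m⟩

/-- The closed ideal generated by `z` is everything. -/
def IsQuasiInterior (z : E) : Prop :=
  0 ≤ z ∧ ∀ x : E, 0 ≤ x → ∀ δ : ℝ, 0 < δ → ∃ m : ℕ, ‖(x - m • z)⁺‖ < δ

theorem IsQuasiInterior.eq_zero {z : E} (hz : IsQuasiInterior z) {D : E →L[ℝ] F}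
    (hD : PositiveOp D) (h : D z = 0) : D = 0 := by
  refine eq_zero_of_forall_nonneg fun x hx => norm_le_zero_iff.1 ?_
  refine le_of_forall_pos_le_add fun ε hε => ?_
  obtain ⟨m, hm⟩ := hz.2 x hx (ε / (‖D‖ + 1)) (by positivity)
  have h1 : D x ≤ D (x - m • z)⁺ := by
    have := hD.mono (le_posPart (x - m • z))
    rwa [map_sub, map_nsmul, h, smul_zero, sub_zero] at this
  have h2 := norm_le_norm_of_nonneg_of_le (hD x hx) h1
  have h3 := D.le_opNorm (x - m • z)⁺
  have h4 : ‖D‖ * ‖(x - m • z)⁺‖ ≤ (‖D‖ + 1) * (ε / (‖D‖ + 1)) :=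
    mul_le_mul (by linarith) hm.le (norm_nonneg _) (by positivity)
  rw [mul_div_cancel₀ _ (by positivity)] at h4
  linarith

/-- The closed ideal generated by a positive element `z`. -/
def principalClosedIdeal (z : E) : Submodule ℝ E :=
  have hsolid : ∀ x y : E, |x| ≤ |y| → (∀ δ : ℝ, 0 < δ → ∃ m : ℕ, ‖(|y| - m • z)⁺‖ < δ) →
      ∀ δ : ℝ, 0 < δ → ∃ m : ℕ, ‖(|x| - m • z)⁺‖ < δ := fun x y hxy hy δ hδ => by
    obtain ⟨m, hm⟩ := hy δ hδ
    exact ⟨m, (norm_le_norm_of_nonneg_of_le (posPart_nonneg _)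
      (posPart_mono (sub_le_sub_right hxy _))).trans_lt hm⟩
  { carrier := {x | ∀ δ : ℝ, 0 < δ → ∃ m : ℕ, ‖(|x| - m • z)⁺‖ < δ}
    zero_mem' := fun δ hδ => ⟨0, by simpa using hδ⟩
    add_mem' := fun {x y} hx hy δ hδ => by
      obtain ⟨m, hm⟩ := hx (δ / 2) (half_pos hδ)
      obtain ⟨n, hn⟩ := hy (δ / 2) (half_pos hδ)
      refine ⟨m + n, ?_⟩
      have h : (|x + y| - (m + n) • z)⁺ ≤ (|x| - m • z)⁺ + (|y| - n • z)⁺ := by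
        refine le_trans (posPart_mono ?_) (posPart_add_le _ _)
        rw [add_smul, ← add_sub_add_comm]
        exact sub_le_sub_right (abs_add_le x y) _
      have := (norm_le_norm_of_nonneg_of_le (posPart_nonneg _) h).trans (norm_add_le _ _)
      linarith
    smul_mem' := fun c x hx δ hδ => by
      obtain ⟨n, hn⟩ := exists_nat_ge |c|
      refine hsolid (c • x) ((n : ℝ) • x) ?_ ?_ δ hδ
      · rw [abs_real_smul, abs_real_smul, Nat.abs_cast]
        exact smul_le_smul_of_nonneg_right hn (abs_nonneg x)
      · intro δ hδ
        obtain ⟨m, hm⟩ := hx (δ / (n + 1)) (by positivity)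
        refine ⟨n * m, ?_⟩
        have : |(n : ℝ) • x| - (n * m) • z = (n : ℝ) • (|x| - m • z) := by
          rw [abs_real_smul, Nat.abs_cast, smul_sub, mul_smul, Nat.cast_smul_eq_nsmul ℝ n (m • z)]
        rw [this, posPart_smul_of_nonneg n.cast_nonneg, norm_smul, Real.norm_natCast]
        rw [lt_div_iff₀ (by positivity)] at hm
        nlinarith [norm_nonneg (|x| - m • z)⁺] }

theorem mem_principalClosedIdeal {z x : E} :
    x ∈ principalClosedIdeal z ↔ ∀ δ : ℝ, 0 < δ → ∃ m : ℕ, ‖(|x| - m • z)⁺‖ < δ := Iff.rfl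

theorem isClosedIdeal_principalClosedIdeal (z : E) :
    IsClosedIdeal (principalClosedIdeal z) := by
  refine ⟨isClosed_of_closure_subset fun x hx δ hδ => ?_, fun x y hxy hy δ hδ => ?_⟩
  · obtain ⟨y, hy, hxy⟩ := Metric.mem_closure_iff.1 hx (δ / 2) (half_pos hδ)
    obtain ⟨m, hm⟩ := mem_principalClosedIdeal.1 hy (δ / 2) (half_pos hδ)
    refine ⟨m, ?_⟩
    have h1 : ‖(|x| - m • z)⁺ - (|y| - m • z)⁺‖ ≤ ‖x - y‖ := by
      refine (norm_sup_sub_sup_le_norm _ _ _).trans ?_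
      rw [sub_sub_sub_cancel_right]
      exact norm_abs_sub_abs x y
    have h2 := norm_le_norm_add_norm_sub' (|x| - m • z)⁺ (|y| - m • z)⁺
    rw [dist_eq_norm] at hxy
    linarith
  · obtain ⟨m, hm⟩ := mem_principalClosedIdeal.1 hy δ hδ
    exact ⟨m, (norm_le_norm_of_nonneg_of_le (posPart_nonneg _)
      (posPart_mono (sub_le_sub_right hxy _))).trans_lt hm⟩

theorem self_mem_principalClosedIdeal {z : E} (hz : 0 ≤ z) : z ∈ principalClosedIdeal z :=
  fun δ hδ => ⟨1, by simpa [abs_of_nonneg hz] using hδ⟩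

theorem isQuasiInterior_of_principalClosedIdeal_eq_top {z : E} (hz : 0 ≤ z)
    (h : principalClosedIdeal z = ⊤) : IsQuasiInterior z := by
  refine ⟨hz, fun x hx δ hδ => ?_⟩
  have hx' : x ∈ principalClosedIdeal z := h ▸ Submodule.mem_top
  simpa [abs_of_nonneg hx] using mem_principalClosedIdeal.1 hx' δ hδ

theorem PositiveOp.invariantUnder_principalClosedIdeal {T : E →L[ℝ] E} (hT : PositiveOp T)
    {z : E} (hz : 0 ≤ z) {c : ℝ} (h : T z ≤ c • z) :
    InvariantUnder T (principalClosedIdeal z) := by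
  intro x hx δ hδ
  obtain ⟨n, hn⟩ := exists_nat_ge c
  obtain ⟨m, hm⟩ := mem_principalClosedIdeal.1 hx (δ / (‖T‖ + 1)) (by positivity)
  refine ⟨m * n, ?_⟩
  have h1 : T z ≤ n • z := by
    rw [← Nat.cast_smul_eq_nsmul ℝ]
    exact h.trans (smul_le_smul_of_nonneg_right hn hz)
  have h2 : |T x| - (m * n) • z ≤ T (|x| - m • z)⁺ := by
    refine le_trans ?_ (hT.mono (le_posPart _))
    rw [map_sub, map_nsmul, mul_smul]
    exact sub_le_sub (hT.abs_le x) (nsmul_le_nsmul_right h1 m)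
  have h3 := norm_le_norm_of_nonneg_of_le (posPart_nonneg _)
    (sup_le h2 (hT _ (posPart_nonneg _)))
  have h4 := T.le_opNorm (|x| - m • z)⁺
  rw [lt_div_iff₀ (by positivity)] at hm
  nlinarith [norm_nonneg (|x| - m • z)⁺]

theorem isClosed_setOf_positiveOp : IsClosed {T : E →L[ℝ] F | PositiveOp T} := by
  have : {T : E →L[ℝ] F | PositiveOp T} = ⋂ x : E, ⋂ _ : 0 ≤ x, {T | 0 ≤ T x} := by
    ext T; simp [PositiveOp]
  rw [this]
  exact isClosed_iInter fun x => isClosed_iInter fun _ =>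
    isClosed_nonneg.preimage (ContinuousLinearMap.apply ℝ F x).continuous

/-- `G` is a positive inverse of `1 - t A`, with `t ≥ 0`. -/
structure HasPosResolvent (A : E →L[ℝ] E) (t : ℝ) (G : E →L[ℝ] E) : Prop where
  nonneg : 0 ≤ t
  pos : PositiveOp G
  mul_left : G * (1 - t • A) = 1
  mul_right : (1 - t • A) * G = 1

theorem HasPosResolvent.zero (A : E →L[ℝ] E) : HasPosResolvent A 0 1 :=
  ⟨le_rfl, PositiveOp.one, by simp, by simp⟩

theorem HasPosResolvent.eq_one_add {A G : E →L[ℝ] E} {t : ℝ} (h : HasPosResolvent A t G) :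
    G = 1 + t • A * G := by
  have := h.mul_right
  rw [sub_mul, one_mul, sub_eq_iff_eq_add] at this
  exact this

theorem HasPosResolvent.pow_le {A G : E →L[ℝ] E} {t : ℝ} (hA : PositiveOp A)
    (h : HasPosResolvent A t G) (N : ℕ) : PositiveOp (G - (t • A) ^ N) := by
  have htA : PositiveOp (t • A) := hA.smul h.nonneg
  induction N with
  | zero =>
    have : G - (t • A) ^ 0 = t • A * G := by
      rw [pow_zero, sub_eq_iff_eq_add']; exact h.eq_one_add
    rw [this]
    exact htA.mul h.pos
  | succ N ih =>
    have : G - (t • A) ^ (N + 1) = 1 + t • A * (G - (t • A) ^ N) := by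
      rw [mul_sub, ← pow_succ', ← add_sub_assoc, ← h.eq_one_add]
    rw [this]
    exact PositiveOp.one.add (htA.mul ih)

theorem HasPosResolvent.exists_of_near [CompleteSpace E] {A G : E →L[ℝ] E} {t s : ℝ}
    (hA : PositiveOp A) (h : HasPosResolvent A t G) (hts : t ≤ s)
    (hs : (s - t) * (‖A‖ * ‖G‖) < 1) : ∃ G', HasPosResolvent A s G' := by
  set H : E →L[ℝ] E := (s - t) • (G * A) with hH
  have hHpos : PositiveOp H := (h.pos.mul hA).smul (sub_nonneg.2 hts)
  have hHn : ‖H‖ < 1 := by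
    rw [hH, norm_smul, Real.norm_of_nonneg (sub_nonneg.2 hts)]
    refine lt_of_le_of_lt ?_ hs
    rw [mul_comm ‖A‖]
    exact mul_le_mul_of_nonneg_left (norm_mul_le _ _) (sub_nonneg.2 hts)
  let v : (E →L[ℝ] E)ˣ := ⟨1 - t • A, G, h.mul_right, h.mul_left⟩ * Units.oneSub H hHn
  have hv : (v : E →L[ℝ] E) = 1 - s • A := by
    change (1 - t • A) * (1 - H) = 1 - s • A
    rw [hH, mul_sub, mul_one, mul_smul_comm, ← mul_assoc, h.mul_right, one_mul]
    module
  have hinv : PositiveOp ((Units.oneSub H hHn)⁻¹ : (E →L[ℝ] E)ˣ).val := by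
    have hsum : HasSum (fun n : ℕ => H ^ n) ((Units.oneSub H hHn)⁻¹ : (E →L[ℝ] E)ˣ).val :=
      (summable_geometric_of_norm_lt_one hHn).hasSum
    refine isClosed_setOf_positiveOp.mem_of_tendsto hsum (Eventually.of_forall fun S => ?_)
    change PositiveOp (∑ n ∈ S, H ^ n)
    exact Finset.sum_induction _ PositiveOp (fun _ _ => PositiveOp.add) PositiveOp.zero
      fun n _ => hHpos.pow n
  refine ⟨(v⁻¹ : (E →L[ℝ] E)ˣ).val, h.nonneg.trans hts, hinv.mul h.pos, ?_, ?_⟩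
  · rw [← hv]; exact v.inv_mul
  · rw [← hv]; exact v.mul_inv

/-- Either `A` is quasinilpotent, or its positive resolvents blow up at a critical parameter. -/
theorem PositiveOp.quasinilpotent_or_blowup [CompleteSpace E] {A : E →L[ℝ] E} (hA : PositiveOp A) :
    (∀ t : ℝ, 0 < t → ∃ M : ℝ, ∀ N : ℕ, ‖(t • A) ^ N‖ ≤ M) ∨
    ∃ t₀ : ℝ, 0 < t₀ ∧ ∃ (t : ℕ → ℝ) (G : ℕ → E →L[ℝ] E), Tendsto t atTop (𝓝 t₀) ∧
      (∀ k, HasPosResolvent A (t k) (G k)) ∧ Tendsto (fun k => ‖G k‖) atTop atTop := by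
  set J : Set ℝ := {t | ∃ G, HasPosResolvent A t G} with hJ
  have h0 : (0 : ℝ) ∈ J := ⟨1, .zero A⟩
  have hopen (s : ℝ) (hs : s ∈ J) : ∃ s' ∈ J, s < s' := by
    obtain ⟨G, hG⟩ := hs
    refine ⟨s + (‖A‖ * ‖G‖ + 1)⁻¹, hG.exists_of_near hA (by simp; positivity) ?_, ?_⟩
    · rw [add_sub_cancel_left, inv_mul_lt_one₀ (by positivity)]
      linarith
    · simp; positivity
  by_cases hb : BddAbove J
  · right
    have hsup : sSup J ∉ J := fun h => by
      obtain ⟨s, hs, hlt⟩ := hopen _ h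
      exact absurd (le_csSup hb hs) (not_le.2 hlt)
    obtain ⟨t, -, ht, htJ⟩ := exists_seq_tendsto_sSup ⟨0, h0⟩ hb
    choose G hG using htJ
    have key (k : ℕ) : 1 ≤ (sSup J - t k) * (‖A‖ * ‖G k‖) := by
      by_contra! hlt
      exact hsup ((hG k).exists_of_near hA (le_csSup hb ⟨_, hG k⟩) hlt)
    refine ⟨sSup J, (le_csSup hb h0).lt_of_ne fun h => hsup (h ▸ h0), t, G, ht, hG, ?_⟩
    refine tendsto_atTop.2 fun b => ?_
    have hlim : Tendsto (fun k => (sSup J - t k) * (‖A‖ * |b|)) atTop (𝓝 0) := by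
      simpa using (ht.const_sub (sSup J)).mul_const (‖A‖ * |b|)
    filter_upwards [hlim.eventually_lt_const one_pos] with k hk
    by_contra! hlt
    have h1 : 0 ≤ sSup J - t k := sub_nonneg.2 (le_csSup hb ⟨_, hG k⟩)
    have h2 : (sSup J - t k) * (‖A‖ * ‖G k‖) ≤ (sSup J - t k) * (‖A‖ * |b|) := by
      gcongr
      exact hlt.le.trans (le_abs_self b)
    linarith [key k]
  · left
    intro t ht
    obtain ⟨s, ⟨G, hG⟩, hts⟩ := not_bddAbove_iff.1 hb t
    refine ⟨‖G‖, fun N => ?_⟩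
    refine PositiveOp.norm_le ((hA.smul ht.le).pow N) ?_
    refine PositiveOp.trans (S := (s • A) ^ N) ?_ (hG.pow_le hA N)
    rw [smul_pow, smul_pow, ← sub_smul]
    exact (hA.pow N).smul (sub_nonneg.2 (by gcongr))

theorem tendsto_clm_apply {ι : Type*} {l : Filter ι} {T : ι → E →L[ℝ] F} {x : ι → E}
    {T₀ : E →L[ℝ] F} {x₀ : E} (hT : Tendsto T l (𝓝 T₀)) (hx : Tendsto x l (𝓝 x₀)) :
    Tendsto (fun i => T i (x i)) l (𝓝 (T₀ x₀)) :=
  (isBoundedBilinearMap_apply.continuous.tendsto (T₀, x₀)).comp (hT.prodMk_nhds hx)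

theorem PositiveOp.exists_nonneg_half_norm {T : E →L[ℝ] E} (hT : PositiveOp T) :
    ∃ u : E, 0 ≤ u ∧ ‖u‖ ≤ 1 ∧ ‖T‖ / 2 ≤ ‖T u‖ := by
  by_cases h : ‖T‖ = 0
  · exact ⟨0, le_rfl, by simp, by simp [h]⟩
  have hpos : 0 < ‖T‖ := (norm_nonneg T).lt_of_ne' h
  obtain ⟨x, hx1, hx⟩ := T.exists_lt_apply_of_lt_opNorm (half_lt_self hpos)
  refine ⟨|x|, abs_nonneg x, (norm_abs_eq_norm x).trans_le hx1.le, hx.le.trans ?_⟩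
  rw [← norm_abs_eq_norm (T x)]
  exact norm_le_norm_of_nonneg_of_le (abs_nonneg _) (hT.abs_le x)

/-- A Krein–Rutman theorem: a positive power-compact operator which is not quasinilpotent has a
positive eigenvector and a positive eigenfunctional for a common positive eigenvalue. -/
theorem PositiveOp.krein_rutman [CompleteSpace E] {A : E →L[ℝ] E} (hA : PositiveOp A) {n : ℕ}
    (hcomp : IsCompactOperator ⇑(A ^ n))
    (hqn : ¬ ∀ t : ℝ, 0 < t → ∃ M : ℝ, ∀ N : ℕ, ‖(t • A) ^ N‖ ≤ M) :
    ∃ t : ℝ, 0 < t ∧ (∃ x : E, 0 ≤ x ∧ x ≠ 0 ∧ t • A x = x) ∧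
      ∃ φ : E →L[ℝ] ℝ, PositiveOp φ ∧ φ ≠ 0 ∧ ∀ y, t * φ (A y) = φ y := by
  obtain ⟨t₀, ht₀, t, G, ht, hG, hGlim⟩ := hA.quasinilpotent_or_blowup.resolve_left hqn
  choose u hu0 hu1 hGu using fun k => (hG k).pos.exists_nonneg_half_norm
  choose f hfpos hf1 hfu using fun k => exists_positive_norming _ ((hG k).pos _ (hu0 k))
  obtain ⟨K, hK, hKsub⟩ := hcomp.image_closedBall_subset_compact (f := (A ^ n).toLinearMap) 1
  have hKmem {x : E} (hx : ‖x‖ ≤ 1) : (A ^ n) x ∈ K :=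
    hKsub ⟨x, by simpa using hx, rfl⟩
  set 𝒰 : Ultrafilter ℕ := Filter.hyperfilter ℕ
  have h𝒰 : (𝒰 : Filter ℕ) ≤ atTop := Nat.hyperfilter_le_atTop
  have hlimK {v : ℕ → E} (hv : ∀ k, ‖v k‖ ≤ 1) :
      ∃ w, Tendsto (fun k => (A ^ n) (v k)) 𝒰 (𝓝 w) := by
    obtain ⟨w, -, hw⟩ := hK.ultrafilter_le_nhds (𝒰.map fun k => (A ^ n) (v k))
      (le_principal_iff.2 (Ultrafilter.mem_map.2 (univ_mem' fun k => hKmem (hv k))))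
    exact ⟨w, hw⟩
  have ht' : Tendsto t 𝒰 (𝓝 t₀) := ht.mono_left h𝒰
  have hG' : Tendsto (fun k => ‖G k‖) 𝒰 atTop := hGlim.mono_left h𝒰
  have hGinv : Tendsto (fun k => ‖G k‖⁻¹) 𝒰 (𝓝 0) := hG'.inv_tendsto_atTop
  have hGpos : ∀ᶠ k in (𝒰 : Filter ℕ), 0 < ‖G k‖ := hG'.eventually_gt_atTop 0
  set Q : ℝ → E →L[ℝ] E := fun s => ∑ i ∈ Finset.range n, (s • A) ^ i with hQ
  have hQc : Continuous Q := by fun_prop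
  have hQlim : Tendsto (fun k => Q (t k)) 𝒰 (𝓝 (Q t₀)) := (hQc.tendsto t₀).comp ht'
  have hQl (s : ℝ) : Q s * (1 - s • A) = 1 - (s • A) ^ n := geom_sum_mul_neg _ _
  have hQr (s : ℝ) : (1 - s • A) * Q s = 1 - (s • A) ^ n := mul_neg_geom_sum _ _
  have htn : Tendsto (fun k => t k ^ n) 𝒰 (𝓝 (t₀ ^ n)) := ht'.pow n
  refine ⟨t₀, ht₀, ?_, ?_⟩
  · set x : ℕ → E := fun k => ‖G k (u k)‖⁻¹ • G k (u k) with hx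
    have hginv : Tendsto (fun k => ‖G k (u k)‖⁻¹) 𝒰 (𝓝 0) :=
      (tendsto_atTop_mono hGu (hG'.atTop_div_const two_pos)).inv_tendsto_atTop
    have hgpos : ∀ᶠ k in (𝒰 : Filter ℕ), ‖G k (u k)‖ ≠ 0 := by
      filter_upwards [hGpos] with k hk
      linarith [hGu k]
    have hxn : ∀ᶠ k in (𝒰 : Filter ℕ), ‖x k‖ = 1 := by
      filter_upwards [hgpos] with k hk
      simp [hx, norm_smul, hk]
    have hxle (k : ℕ) : ‖x k‖ ≤ 1 := by
      simpa [hx, norm_smul] using inv_mul_le_one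
    have hxeq (k : ℕ) : (1 - t k • A) (x k) = ‖G k (u k)‖⁻¹ • u k := by
      rw [hx, map_smul]
      congr 1
      exact congrArg (fun T : E →L[ℝ] E => T (u k)) (hG k).mul_right
    have hxeq0 : Tendsto (fun k => (1 - t k • A) (x k)) 𝒰 (𝓝 0) := by
      simp_rw [hxeq]
      refine squeeze_zero_norm (fun k => ?_) hginv
      rw [norm_smul, norm_inv, norm_norm]
      exact mul_le_of_le_one_right (by positivity) (hu1 k)
    obtain ⟨w, hw⟩ := hlimK hxle
    have hxlim : Tendsto x 𝒰 (𝓝 (t₀ ^ n • w)) := by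
      have h1 := (tendsto_clm_apply hQlim hxeq0).add (htn.smul hw)
      rw [map_zero, zero_add] at h1
      refine h1.congr fun k => ?_
      have := congrArg (fun T : E →L[ℝ] E => T (x k)) (hQl (t k))
      change Q (t k) ((1 - t k • A) (x k)) = x k - ((t k • A) ^ n) (x k) at this
      have h2 : ((t k • A) ^ n) (x k) = t k ^ n • (A ^ n) (x k) := by rw [smul_pow]; rfl
      rw [this, h2, sub_add_cancel]
    refine ⟨t₀ ^ n • w, ?_, ?_, ?_⟩
    · exact ge_of_tendsto hxlim (Eventually.of_forall fun k =>
        smul_nonneg (by positivity) ((hG k).pos _ (hu0 k)))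
    · intro h0
      have h1 := (hxlim.norm).congr' hxn
      rw [h0, norm_zero] at h1
      exact zero_ne_one (tendsto_nhds_unique h1 tendsto_const_nhds)
    · have h1 : Tendsto (fun k => (1 - t k • A) (x k)) 𝒰 (𝓝 ((1 - t₀ • A) (t₀ ^ n • w))) :=
        tendsto_clm_apply (tendsto_const_nhds.sub (ht'.smul_const A)) hxlim
      have h2 := tendsto_nhds_unique h1 hxeq0
      rw [sub_apply, sub_eq_zero] at h2
      exact h2.symm
  · set φ : ℕ → E →L[ℝ] ℝ := fun k => ‖G k‖⁻¹ • (f k).comp (G k) with hφ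
    have hφn (k : ℕ) : ‖φ k‖ ≤ 1 := by
      rw [hφ, norm_smul, norm_inv, norm_norm]
      refine (mul_le_mul_of_nonneg_left ((f k).opNorm_comp_le (G k)) (by positivity)).trans ?_
      refine (mul_le_mul_of_nonneg_left (mul_le_of_le_one_left (norm_nonneg _) (hf1 k))
        (by positivity)).trans inv_mul_le_one
    have hφeq (k : ℕ) (y : E) : φ k ((1 - t k • A) y) = ‖G k‖⁻¹ * f k y := by
      simp only [hφ, smul_apply, ContinuousLinearMap.comp_apply, smul_eq_mul]
      congr 2
      exact congrArg (fun T : E →L[ℝ] E => T y) (hG k).mul_left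
    have hfle (k : ℕ) (y : E) : |f k y| ≤ ‖y‖ := by
      simpa using (f k).le_of_opNorm_le (hf1 k) y
    have hφ0 {v : ℕ → E} {C : ℝ} (hv : ∀ᶠ k in (𝒰 : Filter ℕ), ‖v k‖ ≤ C) :
        Tendsto (fun k => φ k ((1 - t k • A) (v k))) 𝒰 (𝓝 0) := by
      simp_rw [hφeq]
      have h1 : Tendsto (fun k => ‖G k‖⁻¹ * C) 𝒰 (𝓝 0) := by simpa using hGinv.mul_const C
      refine squeeze_zero_norm' ?_ h1
      filter_upwards [hv] with k hk
      rw [norm_mul, norm_inv, norm_norm]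
      exact mul_le_mul_of_nonneg_left ((hfle k _).trans hk) (by positivity)
    obtain ⟨φ', hφ'⟩ : ∃ φ' : E →L[ℝ] ℝ, ∀ y, Tendsto (fun k => φ k y) 𝒰 (𝓝 (φ' y)) := by
      obtain ⟨ψ, -, hψ⟩ := (WeakDual.isCompact_closedBall (𝕜 := ℝ) (E := E) 0 1).ultrafilter_le_nhds
        (𝒰.map fun k => StrongDual.toWeakDual (φ k)) 
        (le_principal_iff.2 (Ultrafilter.mem_map.2 (univ_mem' fun k => by simpa using hφn k)))
      refine ⟨WeakDual.toStrongDual ψ, fun y => ?_⟩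
      exact ((WeakDual.eval_continuous y).tendsto ψ).comp hψ
    obtain ⟨w, hw⟩ := hlimK hu1
    refine ⟨φ', ?_, ?_, ?_⟩
    · intro y hy
      exact ge_of_tendsto (hφ' y) (Eventually.of_forall fun k =>
        mul_nonneg (by positivity) (hfpos k _ ((hG k).pos y hy)))
    · intro hzero
      have hφu : ∀ᶠ k in (𝒰 : Filter ℕ), 1 / 2 ≤ φ k (u k) := by
        filter_upwards [hGpos] with k hk
        simp only [hφ, smul_apply, ContinuousLinearMap.comp_apply, smul_eq_mul,
          hfu]
        rw [inv_mul_eq_div, le_div_iff₀ hk]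
        linarith [hGu k]
      have h1 : Tendsto (fun k => φ k ((1 - t k • A) (Q (t k) (u k)))) 𝒰 (𝓝 0) := by
        refine hφ0 (C := ‖Q t₀‖ + 1) ?_
        filter_upwards [hQlim.norm.eventually_lt_const (lt_add_one _)] with k hk
        exact ((Q (t k)).le_of_opNorm_le hk.le (u k)).trans
          (mul_le_of_le_one_right (by positivity) (hu1 k))
      have h2 : Tendsto (fun k => φ k (((t k • A) ^ n) (u k))) 𝒰 (𝓝 0) := by
        have hv : Tendsto (fun k => ((t k • A) ^ n) (u k)) 𝒰 (𝓝 (t₀ ^ n • w)) := by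
          refine (htn.smul hw).congr fun k => ?_
          rw [smul_pow]
          rfl
        have hd : Tendsto (fun k => φ k (((t k • A) ^ n) (u k) - t₀ ^ n • w)) 𝒰 (𝓝 0) := by
          have h0 := (tendsto_sub_nhds_zero_iff.2 hv).norm
          rw [norm_zero] at h0
          refine squeeze_zero_norm (fun k => ?_) h0
          simpa using (φ k).le_of_opNorm_le (hφn k) (((t k • A) ^ n) (u k) - t₀ ^ n • w)
        have hs := hd.add (hφ' (t₀ ^ n • w))
        rw [hzero, zero_add] at hs
        refine hs.congr fun k => ?_
        rw [map_sub, sub_add_cancel]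
      have h3 := (h1.add h2)
      have h4 : Tendsto (fun k => φ k (u k)) 𝒰 (𝓝 0) := by
        rw [add_zero] at h3
        refine h3.congr fun k => ?_
        have := congrArg (fun T : E →L[ℝ] E => T (u k)) (hQr (t k))
        rw [← map_add]
        congr 1
        change (1 - t k • A) (Q (t k) (u k)) = u k - ((t k • A) ^ n) (u k) at this
        rw [this, sub_add_cancel]
      have := ge_of_tendsto h4 hφu
      norm_num at this
    · intro y
      have h1 := hφ0 (v := fun _ => y) (Eventually.of_forall fun _ => le_rfl)
      have h2 : Tendsto (fun k => φ k ((1 - t k • A) y)) 𝒰 (𝓝 (φ' y - t₀ * φ' (A y))) := by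
        refine ((hφ' y).sub (ht'.mul (hφ' (A y)))).congr fun k => ?_
        simp
      linarith [tendsto_nhds_unique h1 h2]

theorem posPart_sub_nsmul_le {x w : E} (hw : 0 ≤ w) {m k : ℕ} (h : m ≤ k) :
    (x - k • w)⁺ ≤ (x - m • w)⁺ :=
  posPart_mono (sub_le_sub_left (nsmul_le_nsmul_left hw h) x)

/-- Hilden's estimate: if `K` is compact and positive, and `P` maps nonzero positive vectors to
quasi-interior points, then the powers of `P * K` decay at most geometrically. -/
theorem PositiveOp.exists_le_pow_mul_norm {K P : E →L[ℝ] E} (hK : PositiveOp K)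
    (hKc : IsCompactOperator ⇑K) (hP : PositiveOp P)
    (hPq : ∀ y : E, 0 ≤ y → y ≠ 0 → IsQuasiInterior (P y)) {x₀ : E} (hx₀ : 0 ≤ x₀)
    (hne : K x₀ ≠ 0) :
    ∃ (M : ℕ) (δ : ℝ), 0 < δ ∧ ∀ m : ℕ, δ ≤ M ^ m * ‖(P * K) ^ m‖ := by
  have hx₀n : 0 < ‖x₀‖ := norm_pos_iff.2 fun h => hne (by rw [h, map_zero])
  have hKn : 0 < ‖K x₀‖ := norm_pos_iff.2 hne
  obtain ⟨δ, hδ, hδx, hδK⟩ : ∃ δ : ℝ, 0 < δ ∧ δ < ‖x₀‖ ∧ ‖K‖ * δ < ‖K x₀‖ := by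
    refine ⟨min (‖x₀‖ / 2) (‖K x₀‖ / (‖K‖ + 1) / 2), by positivity,
      (min_le_left _ _).trans_lt (half_lt_self hx₀n), ?_⟩
    calc ‖K‖ * min (‖x₀‖ / 2) (‖K x₀‖ / (‖K‖ + 1) / 2)
        ≤ (‖K‖ + 1) * (‖K x₀‖ / (‖K‖ + 1) / 2) := by
          gcongr
          · linarith
          · exact min_le_right _ _
      _ = ‖K x₀‖ / 2 := by field_simp
      _ < ‖K x₀‖ := half_lt_self hKn
  obtain ⟨M, hM⟩ : ∃ M : ℕ, ∀ x : E, 0 ≤ x → ‖x - x₀‖ ≤ δ → ‖(x₀ - M • P (K x))⁺‖ ≤ δ := by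
    by_contra! h
    choose x hx hxδ hxM using h
    obtain ⟨S, hS, hSsub⟩ := hKc.image_closedBall_subset_compact (f := K.toLinearMap) (‖x₀‖ + δ)
    obtain ⟨y, -, hy⟩ := hS.ultrafilter_le_nhds ((Filter.hyperfilter ℕ).map fun k => K (x k))
      (le_principal_iff.2 (Ultrafilter.mem_map.2 (univ_mem' fun k => hSsub ⟨x k, by
        have := norm_le_norm_add_norm_sub' (x k) x₀
        simpa using this.trans (add_le_add_right (hxδ k) _), rfl⟩)))
    replace hy : Tendsto (fun k => K (x k)) (Filter.hyperfilter ℕ) (𝓝 y) := hy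
    have hy0 : 0 ≤ y := ge_of_tendsto hy (Eventually.of_forall fun k => hK _ (hx k))
    have hyne : y ≠ 0 := by
      have h1 : ‖K x₀‖ - ‖K‖ * δ ≤ ‖y‖ := by
        refine ge_of_tendsto hy.norm (Eventually.of_forall fun k => ?_)
        have h2 : ‖K (x k) - K x₀‖ ≤ ‖K‖ * δ := by
          rw [← map_sub]
          exact (K.le_opNorm _).trans (by gcongr; exact hxδ k)
        have h3 := norm_sub_norm_le (K x₀) (K (x k))
        rw [norm_sub_rev] at h3
        linarith
      exact norm_pos_iff.1 (by linarith)
    obtain ⟨m, hm⟩ := (hPq y hy0 hyne).2 x₀ hx₀ δ hδ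
    have hlim : Tendsto (fun k => ‖(x₀ - m • P (K (x k)))⁺‖) (Filter.hyperfilter ℕ)
        (𝓝 ‖(x₀ - m • P y)⁺‖) := by
      have hc : Continuous fun v : E => ‖(x₀ - m • P v)⁺‖ := by
        simp only [posPart_def]
        fun_prop
      exact (hc.tendsto y).comp hy
    have hge := Nat.hyperfilter_le_atTop (eventually_ge_atTop m)
    obtain ⟨k, hk, hmk⟩ := ((hlim.eventually_lt_const hm).and hge).exists
    refine absurd (hxM k) (not_lt.2 (le_trans ?_ hk.le))
    exact norm_le_norm_of_nonneg_of_le (posPart_nonneg _)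
      (posPart_sub_nsmul_le (hP _ (hK _ (hx k))) hmk)
  have hiter (m : ℕ) : ∃ x : E, 0 ≤ x ∧ ‖x - x₀‖ ≤ δ ∧ x ≤ (M : ℝ) ^ m • ((P * K) ^ m) x₀ := by
    induction m with
    | zero => exact ⟨x₀, hx₀, by simpa using hδ.le, by simp⟩
    | succ m ih =>
      obtain ⟨x, hx, hxδ, hxm⟩ := ih
      have hPK : PositiveOp (P * K) := hP.mul hK
      refine ⟨x₀ ⊓ M • P (K x), le_inf hx₀ (nsmul_nonneg (hPK x hx) _), ?_, ?_⟩
      · have h1 : x₀ - x₀ ⊓ M • P (K x) = (x₀ - M • P (K x))⁺ := by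
          rw [sub_inf, sub_self, posPart_def, sup_comm]
        rw [norm_sub_rev, h1]
        exact hM x hx hxδ
      · refine inf_le_right.trans ?_
        rw [← Nat.cast_smul_eq_nsmul ℝ, pow_succ', mul_smul]
        refine smul_le_smul_of_nonneg_left ?_ (Nat.cast_nonneg M)
        have := hPK.mono hxm
        rwa [map_smul, ← mul_apply_eq_comp, ← pow_succ'] at this
  refine ⟨M, (‖x₀‖ - δ) / ‖x₀‖, div_pos (sub_pos.2 hδx) hx₀n, fun m => ?_⟩
  obtain ⟨x, hx, hxδ, hxm⟩ := hiter m
  rw [div_le_iff₀ hx₀n]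
  have h1 := norm_sub_norm_le x₀ x
  rw [norm_sub_rev] at h1
  have h2 := norm_le_norm_of_nonneg_of_le hx hxm
  rw [norm_smul, norm_pow, Real.norm_natCast] at h2
  have h3 := mul_le_mul_of_nonneg_left (((P * K) ^ m).le_opNorm x₀) (by positivity : 0 ≤ (M : ℝ) ^ m)
  linarith

theorem PositiveOp.pow_mul_sub {A P : E →L[ℝ] E} (hA : PositiveOp A)
    (h : PositiveOp (A * P - P * A)) (n : ℕ) : PositiveOp (A ^ n * P - P * A ^ n) := by
  induction n with
  | zero => simpa using PositiveOp.zero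
  | succ n ih =>
    have : A ^ (n + 1) * P - P * A ^ (n + 1) =
        A ^ n * (A * P - P * A) + (A ^ n * P - P * A ^ n) * A := by
      rw [pow_succ]; noncomm_ring
    rw [this]
    exact ((hA.pow n).mul h).add (ih.mul hA)

theorem PositiveOp.mul_sub_pow {A P : E →L[ℝ] E} (hA : PositiveOp A)
    (h : PositiveOp (P * A - A * P)) (n : ℕ) : PositiveOp (P * A ^ n - A ^ n * P) := by
  induction n with
  | zero => simpa using PositiveOp.zero
  | succ n ih =>
    have : P * A ^ (n + 1) - A ^ (n + 1) * P =
        A ^ n * (P * A - A * P) + (P * A ^ n - A ^ n * P) * A := by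
      rw [pow_succ]; noncomm_ring
    rw [this]
    exact ((hA.pow n).mul h).add (ih.mul hA)

theorem PositiveOp.norm_mul_pow_le {A P : E →L[ℝ] E} (hA : PositiveOp A) (hP : PositiveOp P)
    (h : PositiveOp (A * P - P * A) ∨ PositiveOp (P * A - A * P)) (m : ℕ) :
    ‖(P * A) ^ m‖ ≤ ‖P ^ m‖ * ‖A ^ m‖ := by
  have hpos : PositiveOp ((P * A) ^ m) := (hP.mul hA).pow m
  rcases h with h | h
  · rw [mul_comm]
    exact (hpos.norm_le (hP.mul_pow_le hA h m).1).trans (norm_mul_le _ _)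
  · exact (hpos.norm_le (hA.mul_pow_le hP h m).2).trans (norm_mul_le _ _)

/-- A positive resolvent operator of `A + B`, which maps nonzero positive vectors to generators of
closed ideals invariant under `A` and `B`. -/
theorem PositiveOp.exists_smoothing [CompleteSpace E] {A B : E →L[ℝ] E} (hA : PositiveOp A)
    (hB : PositiveOp B) :
    ∃ (P : E →L[ℝ] E) (ε : ℝ), 0 < ε ∧ PositiveOp P ∧ (∀ y, 0 ≤ y → y ≤ P y) ∧
      (∀ y, 0 ≤ y → A (P y) ≤ ε⁻¹ • P y) ∧ (∀ y, 0 ≤ y → B (P y) ≤ ε⁻¹ • P y) ∧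
      A * P - P * A = ε • (P * (A * B - B * A) * P) := by
  have hAB := hA.add hB
  set ε : ℝ := (‖A + B‖ * ‖(1 : E →L[ℝ] E)‖ + 1)⁻¹ with hε
  have hε0 : 0 < ε := by positivity
  obtain ⟨P, hP⟩ := HasPosResolvent.exists_of_near hAB (.zero (A + B)) hε0.le (by
    rw [sub_zero, hε, inv_mul_lt_one₀ (by positivity)]
    exact lt_add_one _)
  have hsum (y : E) : P y = y + ε • (A (P y) + B (P y)) :=
    congrArg (fun T : E →L[ℝ] E => T y) hP.eq_one_add
  have hAP (y : E) (hy : 0 ≤ y) := hA _ (hP.pos y hy)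
  have hBP (y : E) (hy : 0 ≤ y) := hB _ (hP.pos y hy)
  have hle (y : E) (hy : 0 ≤ y) : A (P y) + B (P y) ≤ ε⁻¹ • P y := by
    have h1 : ε⁻¹ • P y = ε⁻¹ • y + (A (P y) + B (P y)) := by
      conv_lhs => rw [hsum y]
      rw [smul_add, smul_smul, inv_mul_cancel₀ hε0.ne', one_smul]
    rw [h1]
    exact le_add_of_nonneg_left (smul_nonneg (by positivity) hy)
  refine ⟨P, ε, hε0, hP.pos, fun y hy => ?_, fun y hy => ?_, fun y hy => ?_, ?_⟩
  · rw [hsum y]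
    exact le_add_of_nonneg_right (smul_nonneg hε0.le (add_nonneg (hAP y hy) (hBP y hy)))
  · exact (le_add_of_nonneg_right (hBP y hy)).trans (hle y hy)
  · exact (le_add_of_nonneg_left (hAP y hy)).trans (hle y hy)
  · have h1 : A * P = P * (1 - ε • (A + B)) * A * P := by rw [hP.mul_left, one_mul]
    have h2 : P * A = P * A * ((1 - ε • (A + B)) * P) := by rw [hP.mul_right, mul_one]
    rw [h1, h2]
    simp only [mul_sub, sub_mul, mul_add, add_mul, smul_add, mul_smul_comm, smul_mul_assoc,
      mul_one, one_mul, mul_assoc, smul_sub]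
    abel

/-- The operators `A` and `B` have no common nontrivial closed invariant ideal. -/
def IdealIrreducible (A B : E →L[ℝ] E) : Prop :=
  ∀ I : Submodule ℝ E, IsClosedIdeal I → InvariantUnder A I → InvariantUnder B I → I = ⊥ ∨ I = ⊤

theorem eq_zero_of_quasinilpotent {A P : E →L[ℝ] E} (hA : PositiveOp A) (hP : PositiveOp P)
    (hPq : ∀ y : E, 0 ≤ y → y ≠ 0 → IsQuasiInterior (P y))
    (h : PositiveOp (A * P - P * A) ∨ PositiveOp (P * A - A * P)) {n : ℕ} (hn : 1 ≤ n)
    (hcomp : IsCompactOperator ⇑(A ^ n))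
    (hqn : ∀ t : ℝ, 0 < t → ∃ M : ℝ, ∀ N : ℕ, ‖(t • A) ^ N‖ ≤ M) : A = 0 := by
  by_contra hA0
  obtain ⟨y, hy, hAy⟩ : ∃ y : E, 0 ≤ y ∧ A y ≠ 0 := by
    by_contra! hcon
    exact hA0 (eq_zero_of_forall_nonneg hcon)
  have hPA : PositiveOp (P * A) := hP.mul hA
  have hne (j : ℕ) : A (((P * A) ^ j) y) ≠ 0 := by
    induction j with
    | zero => simpa using hAy
    | succ j ih =>
      intro h0
      rw [pow_succ', mul_apply_eq_comp] at h0
      exact hA0 ((hPq _ (hA _ (hPA.pow j _ hy)) ih).eq_zero hA h0)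
  have hK0 : A ^ n ≠ 0 := by
    intro h0
    have h1 := hA.norm_mul_pow_le hP h n
    rw [h0, norm_zero, mul_zero, norm_le_zero_iff] at h1
    exact hne n (by rw [h1]; simp)
  obtain ⟨x₀, hx₀, hKx₀⟩ : ∃ y : E, 0 ≤ y ∧ (A ^ n) y ≠ 0 := by
    by_contra! hcon
    exact hK0 (eq_zero_of_forall_nonneg hcon)
  obtain ⟨M, δ, hδ, hM⟩ := (hA.pow n).exists_le_pow_mul_norm hcomp hP hPq hx₀ hKx₀
  have hK : PositiveOp (A ^ n * P - P * A ^ n) ∨ PositiveOp (P * A ^ n - A ^ n * P) :=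
    h.imp (fun h => hA.pow_mul_sub h n) (fun h => hA.mul_sub_pow h n)
  set c : ℝ := M * (‖P‖ + 1) with hc
  have hc0 : 0 ≤ c := by positivity
  have ht1 : 1 ≤ c + 1 := by linarith
  obtain ⟨L, hL⟩ := hqn (c + 1) (by linarith)
  have key (m : ℕ) (hm : 1 ≤ m) : δ ≤ (c / (c + 1)) ^ m * L := by
    have h1 : ‖P ^ m‖ ≤ (‖P‖ + 1) ^ m :=
      (norm_pow_le' P hm).trans (pow_le_pow_left₀ (norm_nonneg _) (by linarith) m)
    have h2 : (c + 1) ^ (n * m) * ‖A ^ (n * m)‖ ≤ L := by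
      have := hL (n * m)
      rwa [smul_pow, norm_smul, norm_pow, Real.norm_of_nonneg (by linarith)] at this
    have h3 : (c + 1) ^ m ≤ (c + 1) ^ (n * m) :=
      pow_le_pow_right₀ ht1 (Nat.le_mul_of_pos_left m hn)
    have h4 : ‖A ^ (n * m)‖ ≤ L / (c + 1) ^ m := by
      rw [le_div_iff₀ (by positivity), mul_comm]
      exact (mul_le_mul_of_nonneg_right h3 (norm_nonneg _)).trans h2
    calc δ ≤ M ^ m * ‖(P * A ^ n) ^ m‖ := hM m
      _ ≤ M ^ m * (‖P ^ m‖ * ‖(A ^ n) ^ m‖) := by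
        gcongr; exact (hA.pow n).norm_mul_pow_le hP hK m
      _ ≤ M ^ m * ((‖P‖ + 1) ^ m * (L / (c + 1) ^ m)) := by
        rw [← pow_mul]; gcongr
      _ = (c / (c + 1)) ^ m * L := by rw [hc, div_pow, mul_pow]; ring
  have hlim : Tendsto (fun m : ℕ => (c / (c + 1)) ^ m * L) atTop (𝓝 (0 * L)) :=
    (tendsto_pow_atTop_nhds_zero_of_lt_one (by positivity)
      ((div_lt_one (by linarith)).2 (lt_add_one c))).mul_const L
  rw [zero_mul] at hlim
  exact not_le.2 hδ (ge_of_tendsto hlim (eventually_atTop.2 ⟨1, key⟩))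

theorem commutator_eq_zero_of_eigenvector {A B P : E →L[ℝ] E} (hP : PositiveOp P)
    (hPq : ∀ y : E, 0 ≤ y → y ≠ 0 → IsQuasiInterior (P y)) {σ : ℝ} (hσ : σ ≠ 0)
    (hAP : PositiveOp (σ • (A * P - P * A))) (hC : PositiveOp (σ • (A * B - B * A)))
    {t : ℝ} (ht : 0 < t) {x : E} (hx : 0 ≤ x) (hx0 : x ≠ 0) (hAx : t • A x = x)
    {φ : E →L[ℝ] ℝ} (hφ : PositiveOp φ) (hφ0 : φ ≠ 0) (hAφ : ∀ y, t * φ (A y) = φ y) :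
    A * B - B * A = 0 := by
  have hφP {y : E} (hy : 0 ≤ y) (h : φ (P y) = 0) : y = 0 := by
    by_contra hy0
    exact hφ0 ((hPq y hy hy0).eq_zero hφ h)
  have hz := hPq x hx hx0
  have hφA (y : E) : φ (A y) = t⁻¹ * φ y := by rw [← hAφ y, inv_mul_cancel_left₀ ht.ne']
  have hAx' : A x = t⁻¹ • x := by
    conv_rhs => rw [← hAx, smul_smul, inv_mul_cancel₀ ht.ne', one_smul]
  set D : E →L[ℝ] E := σ • (A * P - P * A) with hD
  have hDapp (y : E) : D y = σ • (A (P y) - P (A y)) := rfl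
  have hDx : D x = σ • (A (P x) - t⁻¹ • P x) := by rw [hDapp, hAx', map_smul]
  have hφD : φ (D (P x)) = -φ (P (D x)) := by
    rw [hDx, hDapp]
    simp only [map_smul, map_sub, hφA, smul_eq_mul]
    ring
  have h1 : 0 ≤ φ (D (P x)) := hφ _ (hAP _ hz.1)
  have h2 : 0 ≤ φ (P (D x)) := hφ _ (hP _ (hAP _ hx))
  have hDx0 : D x = 0 := hφP (hAP _ hx) (by linarith)
  have hAz : A (P x) = t⁻¹ • P x := by
    rw [hDx, smul_eq_zero_iff_right hσ] at hDx0
    exact sub_eq_zero.1 hDx0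
  have hφD0 : φ.comp D = 0 :=
    hz.eq_zero (D := φ.comp D) (fun y hy => hφ _ (hAP _ hy))
      (show φ (D (P x)) = 0 by linarith)
  have hψ (y : E) : φ (P (A y)) = t⁻¹ * φ (P y) := by
    have h3 : φ (D y) = 0 := congrArg (fun f : E →L[ℝ] ℝ => f y) hφD0
    rw [hDapp, map_smul, smul_eq_zero_iff_right hσ, map_sub, sub_eq_zero, hφA] at h3
    exact h3.symm
  have hCz : (σ • (A * B - B * A)) (P x) = 0 := by
    refine hφP (hC _ hz.1) ?_
    change φ (P (σ • (A (B (P x)) - B (A (P x))))) = 0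
    rw [hAz]
    simp only [map_smul, map_sub, hψ, smul_eq_mul]
    ring
  exact (smul_eq_zero_iff_right hσ).1 (hz.eq_zero hC hCz)

/-- A positive power-compact operator which semi-commutes with a positive operator, without common
closed invariant ideals, commutes with it. -/
theorem IdealIrreducible.commutator_eq_zero [CompleteSpace E] {A B : E →L[ℝ] E}
    (hirr : IdealIrreducible A B) (hA : PositiveOp A) (hB : PositiveOp B)
    (hC : PositiveOp (A * B - B * A) ∨ PositiveOp (B * A - A * B)) {n : ℕ} (hn : 1 ≤ n)
    (hcomp : IsCompactOperator ⇑(A ^ n)) : A * B - B * A = 0 := by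
  obtain ⟨P, ε, hε, hP, hPge, hPA, hPB, hcomm⟩ := hA.exists_smoothing hB
  have hPq (y : E) (hy : 0 ≤ y) (hy0 : y ≠ 0) : IsQuasiInterior (P y) := by
    have hPy := hP y hy
    refine isQuasiInterior_of_principalClosedIdeal_eq_top hPy ?_
    refine (hirr _ (isClosedIdeal_principalClosedIdeal _)
      (hA.invariantUnder_principalClosedIdeal hPy (hPA y hy))
      (hB.invariantUnder_principalClosedIdeal hPy (hPB y hy))).resolve_left fun h => hy0 ?_
    have h1 := self_mem_principalClosedIdeal hPy
    rw [h, Submodule.mem_bot] at h1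
    exact le_antisymm ((hPge y hy).trans h1.le) hy
  obtain ⟨σ, hσ, hσC⟩ : ∃ σ : ℝ, (σ = 1 ∨ σ = -1) ∧ PositiveOp (σ • (A * B - B * A)) := by
    rcases hC with h | h
    · exact ⟨1, .inl rfl, by rwa [one_smul]⟩
    · exact ⟨-1, .inr rfl, by rwa [neg_smul, one_smul, neg_sub]⟩
  have hσP : PositiveOp (σ • (A * P - P * A)) := by
    have h := ((hP.mul hσC).mul hP).smul hε.le
    rwa [mul_smul_comm, smul_mul_assoc, smul_comm, ← hcomm] at h
  by_cases hqn : ∀ t : ℝ, 0 < t → ∃ M : ℝ, ∀ N : ℕ, ‖(t • A) ^ N‖ ≤ M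
  · have hAP : PositiveOp (A * P - P * A) ∨ PositiveOp (P * A - A * P) := by
      rcases hσ with rfl | rfl
      · exact .inl (by rwa [one_smul] at hσP)
      · exact .inr (by rwa [neg_smul, one_smul, neg_sub] at hσP)
    rw [eq_zero_of_quasinilpotent hA hP hPq hAP hn hcomp hqn]
    simp
  · obtain ⟨t, ht, ⟨x, hx, hx0, hAx⟩, φ, hφ, hφ0, hAφ⟩ := hA.krein_rutman hcomp hqn
    exact commutator_eq_zero_of_eigenvector hP hPq (by rcases hσ with rfl | rfl <;> norm_num) hσP hσC ht hx hx0 hAx hφ hφ0 hAφ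

section Quotient

variable {I : Submodule ℝ E} [hI : Fact (IsClosedIdeal I)]

instance : IsClosed (I : Set E) := hI.out.1

theorem mem_of_abs_le_abs {x y : E} (h : |x| ≤ |y|) (hy : y ∈ I) : x ∈ I :=
  hI.out.2 x y h hy

theorem sup_sub_sup_mem {a a' b b' : E} (ha : a - a' ∈ I) (hb : b - b' ∈ I) :
    a ⊔ b - a' ⊔ b' ∈ I := by
  have h1 : a ⊔ b - a' ⊔ b ∈ I := mem_of_abs_le_abs (abs_sup_sub_sup_le_abs a a' b) ha
  have h2 : a' ⊔ b - a' ⊔ b' ∈ I := by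
    rw [sup_comm a', sup_comm a']
    exact mem_of_abs_le_abs (abs_sup_sub_sup_le_abs b b' a') hb
  simpa using I.add_mem h1 h2

theorem inf_sub_inf_mem {a a' b b' : E} (ha : a - a' ∈ I) (hb : b - b' ∈ I) :
    a ⊓ b - a' ⊓ b' ∈ I := by
  have h1 : a ⊓ b - a' ⊓ b ∈ I := mem_of_abs_le_abs (abs_inf_sub_inf_le_abs a a' b) ha
  have h2 : a' ⊓ b - a' ⊓ b' ∈ I := by
    rw [inf_comm a', inf_comm a']
    exact mem_of_abs_le_abs (abs_inf_sub_inf_le_abs b b' a') hb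
  simpa using I.add_mem h1 h2

instance : Max (E ⧸ I) :=
  ⟨Quotient.map₂ (· ⊔ ·) fun _ _ ha _ _ hb => (Submodule.quotientRel_def I).2
    (sup_sub_sup_mem ((Submodule.quotientRel_def I).1 ha) ((Submodule.quotientRel_def I).1 hb))⟩

instance : Min (E ⧸ I) :=
  ⟨Quotient.map₂ (· ⊓ ·) fun _ _ ha _ _ hb => (Submodule.quotientRel_def I).2
    (inf_sub_inf_mem ((Submodule.quotientRel_def I).1 ha) ((Submodule.quotientRel_def I).1 hb))⟩

instance : Lattice (E ⧸ I) :=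
  Lattice.mk' (by rintro ⟨a⟩ ⟨b⟩; exact congrArg I.mkQ (sup_comm a b))
    (by rintro ⟨a⟩ ⟨b⟩ ⟨c⟩; exact congrArg I.mkQ (sup_assoc a b c))
    (by rintro ⟨a⟩ ⟨b⟩; exact congrArg I.mkQ (inf_comm a b))
    (by rintro ⟨a⟩ ⟨b⟩ ⟨c⟩; exact congrArg I.mkQ (inf_assoc a b c))
    (by rintro ⟨a⟩ ⟨b⟩; exact congrArg I.mkQ (sup_inf_self (a := a) (b := b)))
    (by rintro ⟨a⟩ ⟨b⟩; exact congrArg I.mkQ (inf_sup_self (a := a) (b := b)))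

theorem mkQ_sup (a b : E) : I.mkQ (a ⊔ b) = I.mkQ a ⊔ I.mkQ b := rfl

theorem mkQ_inf (a b : E) : I.mkQ (a ⊓ b) = I.mkQ a ⊓ I.mkQ b := rfl

theorem mkQ_mono {a b : E} (h : a ≤ b) : I.mkQ a ≤ I.mkQ b := by
  rw [← sup_eq_right, ← mkQ_sup, sup_eq_right.2 h]

theorem exists_mkQ_nonneg {y : E ⧸ I} (hy : 0 ≤ y) : ∃ x : E, 0 ≤ x ∧ I.mkQ x = y := by
  obtain ⟨a, rfl⟩ := I.mkQ_surjective y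
  refine ⟨a ⊔ 0, le_sup_right, ?_⟩
  rw [mkQ_sup, map_zero, sup_eq_left.2 hy]

instance : IsOrderedAddMonoid (E ⧸ I) where
  add_le_add_left := by
    intro a b h c
    obtain ⟨a, rfl⟩ := I.mkQ_surjective a
    obtain ⟨b, rfl⟩ := I.mkQ_surjective b
    obtain ⟨c, rfl⟩ := I.mkQ_surjective c
    rw [← sup_eq_right] at h ⊢
    rw [← map_add, ← map_add, ← mkQ_sup, ← sup_add, map_add, mkQ_sup, h, map_add]

theorem mkQ_abs (a : E) : I.mkQ |a| = |I.mkQ a| := rfl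

instance : HasSolidNorm (E ⧸ I) where
  solid := by
    intro x y h
    obtain ⟨a, rfl⟩ := I.mkQ_surjective x
    refine le_of_forall_pos_le_add fun ε hε => ?_
    obtain ⟨b, rfl, hb⟩ := Submodule.Quotient.norm_mk_lt y hε
    change |I.mkQ a| ≤ |I.mkQ b| at h
    have ha : I.mkQ (a ⊓ |b| ⊔ -|b|) = I.mkQ a := by
      rw [mkQ_sup, mkQ_inf, map_neg, mkQ_abs, inf_eq_left.2 ((le_abs_self _).trans h),
        sup_eq_left.2 ((neg_le_neg h).trans (neg_le.1 (neg_le_abs _)))]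
    rw [← ha]
    refine (Submodule.Quotient.norm_mk_le I _).trans (le_trans ?_ hb.le)
    refine norm_le_norm_of_abs_le_abs (abs_le'.2 ⟨sup_le inf_le_right ?_, neg_le.2 le_sup_right⟩)
    exact (neg_nonpos.2 (abs_nonneg b)).trans (abs_nonneg b)

end Quotient

section QuotientOperator

variable {I : Submodule ℝ E} [hI : Fact (IsClosedIdeal I)]

/-- The operator induced on the quotient by an invariant closed ideal. -/
def quotientOp (T : E →L[ℝ] E) (hT : InvariantUnder T I) : E ⧸ I →L[ℝ] E ⧸ I :=
  I.liftQL (I.mkQL.comp T) fun x hx => (Submodule.Quotient.mk_eq_zero I).2 (hT x hx)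

theorem quotientOp_mkQ (T : E →L[ℝ] E) (hT : InvariantUnder T I) (x : E) :
    quotientOp T hT (I.mkQ x) = I.mkQ (T x) := rfl

theorem quotientOp_pow_mkQ (T : E →L[ℝ] E) (hT : InvariantUnder T I) (n : ℕ) (x : E) :
    (quotientOp T hT ^ n) (I.mkQ x) = I.mkQ ((T ^ n) x) := by
  induction n with
  | zero => simp
  | succ n ih =>
    rw [pow_succ', pow_succ', mul_apply_eq_comp, ih, quotientOp_mkQ, mul_apply_eq_comp]

theorem PositiveOp.quotientOp {T : E →L[ℝ] E} (h : PositiveOp T) (hT : InvariantUnder T I) :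
    PositiveOp (quotientOp T hT) := by
  intro y hy
  obtain ⟨x, hx, rfl⟩ := exists_mkQ_nonneg hy
  rw [quotientOp_mkQ, ← map_zero I.mkQ]
  exact mkQ_mono (h x hx)

theorem isCompactOperator_quotientOp_pow {T : E →L[ℝ] E} (hT : InvariantUnder T I) {n : ℕ}
    (h : IsCompactOperator ⇑(T ^ n)) : IsCompactOperator ⇑(quotientOp T hT ^ n) := by
  obtain ⟨K, hK, hKn⟩ := h
  refine ⟨I.mkQL '' K, hK.image I.mkQL.continuous, ?_⟩
  have h1 := I.isOpenQuotientMap_mkQL.isOpenMap.image_mem_nhds hKn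
  rw [map_zero] at h1
  refine mem_of_superset h1 ?_
  rintro - ⟨x, hx, rfl⟩
  exact ⟨(T ^ n) x, hx, (quotientOp_pow_mkQ T hT n x).symm⟩

/-- If an invariant closed ideal `I` is maximal among proper closed ideals invariant under `A` and
`B`, then the commutator of `A` and `B` maps into `I`. -/
theorem commutator_apply_mem_of_maximal [CompleteSpace E] {A B : E →L[ℝ] E} (hA : PositiveOp A)
    (hB : PositiveOp B) (hC : PositiveOp (A * B - B * A) ∨ PositiveOp (B * A - A * B)) {n : ℕ}
    (hn : 1 ≤ n) (hcomp : IsCompactOperator ⇑(A ^ n)) (hAI : InvariantUnder A I)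
    (hBI : InvariantUnder B I)
    (hmax : ∀ L : Submodule ℝ E, IsClosedIdeal L → InvariantUnder A L → InvariantUnder B L →
      I ≤ L → L = I ∨ L = ⊤) (x : E) : (A * B - B * A) x ∈ I := by
  have hirr : IdealIrreducible (quotientOp A hAI) (quotientOp B hBI) := by
    intro L hL hAL hBL
    have hle : I ≤ L.comap I.mkQ := fun y hy => by
      rw [Submodule.mem_comap, Submodule.mkQ_apply, (Submodule.Quotient.mk_eq_zero I).2 hy]
      exact L.zero_mem
    have hclosed : IsClosedIdeal (L.comap I.mkQ) := by
      refine ⟨hL.1.preimage I.mkQL.continuous, fun y z hyz hz => ?_⟩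
      refine hL.2 _ (I.mkQ z) ?_ hz
      rw [← mkQ_abs, ← mkQ_abs]
      exact mkQ_mono hyz
    refine (hmax _ hclosed (fun y hy => hAL _ hy) (fun y hy => hBL _ hy) hle).imp
      (fun h => ?_) (fun h => ?_)
    · rw [eq_bot_iff]
      intro y hy
      obtain ⟨z, rfl⟩ := I.mkQ_surjective y
      have hz : z ∈ L.comap I.mkQ := hy
      rw [h] at hz
      exact (Submodule.Quotient.mk_eq_zero I).2 hz
    · rw [eq_top_iff]
      intro y _
      obtain ⟨z, rfl⟩ := I.mkQ_surjective y
      have hz : z ∈ L.comap I.mkQ := h ▸ Submodule.mem_top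
      exact hz
  have hC' : PositiveOp (quotientOp A hAI * quotientOp B hBI - quotientOp B hBI * quotientOp A hAI) ∨
      PositiveOp (quotientOp B hBI * quotientOp A hAI - quotientOp A hAI * quotientOp B hBI) := by
    refine hC.imp (fun h y hy => ?_) (fun h y hy => ?_) <;>
    · obtain ⟨z, hz, rfl⟩ := exists_mkQ_nonneg hy
      have := mkQ_mono (I := I) (h z hz)
      rw [map_zero] at this
      exact this
  have h0 := hirr.commutator_eq_zero (hA.quotientOp hAI) (hB.quotientOp hBI) hC' hn
    (isCompactOperator_quotientOp_pow hAI hcomp)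
  exact (Submodule.Quotient.mk_eq_zero I).1 (congrArg (fun T => T (I.mkQ x)) h0)

end QuotientOperator

section Restriction

variable {J : Submodule ℝ E} [hJ : Fact (IsClosedIdeal J)]

theorem sup_mem_of_isClosedIdeal {x y : E} (hx : x ∈ J) (hy : y ∈ J) : x ⊔ y ∈ J := by
  simpa using sup_sub_sup_mem (I := J) (a := x) (a' := 0) (b := y) (b' := 0)
    (by simpa using hx) (by simpa using hy)

theorem inf_mem_of_isClosedIdeal {x y : E} (hx : x ∈ J) (hy : y ∈ J) : x ⊓ y ∈ J := by
  simpa using inf_sub_inf_mem (I := J) (a := x) (a' := 0) (b := y) (b' := 0)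
    (by simpa using hx) (by simpa using hy)

instance : Lattice J :=
  Subtype.lattice (fun _ _ => sup_mem_of_isClosedIdeal) (fun _ _ => inf_mem_of_isClosedIdeal)

instance : IsOrderedAddMonoid J where
  add_le_add_left a b h c := by
    have h' : (a : E) ≤ b := h
    exact add_le_add_left h' (c : E)

instance : HasSolidNorm J where
  solid x y h := norm_le_norm_of_abs_le_abs (a := (x : E)) (b := y) h

/-- The restriction of an operator to an invariant closed ideal. -/
def restrictOp (T : E →L[ℝ] E) (hT : InvariantUnder T J) : J →L[ℝ] J :=
  T.restrict hT

theorem coe_restrictOp (T : E →L[ℝ] E) (hT : InvariantUnder T J) (x : J) :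
    (restrictOp T hT x : E) = T x := rfl

theorem coe_restrictOp_pow (T : E →L[ℝ] E) (hT : InvariantUnder T J) (n : ℕ) (x : J) :
    ((restrictOp T hT ^ n) x : E) = (T ^ n) x := by
  induction n with
  | zero => simp
  | succ n ih =>
    rw [pow_succ', pow_succ', mul_apply_eq_comp, coe_restrictOp, ih, mul_apply_eq_comp]

theorem isCompactOperator_restrictOp_pow {T : E →L[ℝ] E} (hT : InvariantUnder T J) {n : ℕ}
    (h : IsCompactOperator ⇑(T ^ n)) : IsCompactOperator ⇑(restrictOp T hT ^ n) := by
  obtain ⟨K, hK, hKn⟩ := h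
  refine ⟨_, hJ.out.1.isClosedEmbedding_subtypeVal.isCompact_preimage hK, ?_⟩
  have h1 : (Subtype.val : J → E) ⁻¹' ((T ^ n) ⁻¹' K) ∈ 𝓝 (0 : J) :=
    continuous_subtype_val.continuousAt.preimage_mem_nhds hKn
  refine mem_of_superset h1 fun x hx => ?_
  change ((restrictOp T hT ^ n) x : E) ∈ K
  rw [coe_restrictOp_pow]
  exact hx

end Restriction

/-- The commutator of `A` and `B` maps the larger ideal of a gap in the family of closed ideals
invariant under `A` and `B` into the smaller one. -/
theorem commutator_apply_mem_of_gap [CompleteSpace E] {A B : E →L[ℝ] E} (hA : PositiveOp A)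
    (hB : PositiveOp B) (hC : PositiveOp (A * B - B * A) ∨ PositiveOp (B * A - A * B)) {n : ℕ}
    (hn : 1 ≤ n) (hcomp : IsCompactOperator ⇑(A ^ n)) {I J : Submodule ℝ E} (hIJ : I ≤ J)
    (hI : IsClosedIdeal I) (hJ : IsClosedIdeal J)
    (hAI : InvariantUnder A I) (hBI : InvariantUnder B I)
    (hAJ : InvariantUnder A J) (hBJ : InvariantUnder B J)
    (hgap : ∀ L : Submodule ℝ E, IsClosedIdeal L → InvariantUnder A L → InvariantUnder B L →
      I ≤ L → L ≤ J → L = I ∨ L = J) {x : E} (hx : x ∈ J) : (A * B - B * A) x ∈ I := by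
  have : Fact (IsClosedIdeal J) := ⟨hJ⟩
  have hI' : IsClosedIdeal (I.comap J.subtype) :=
    ⟨hI.1.preimage continuous_subtype_val, fun y z hyz hz => hI.2 (y : E) z hyz hz⟩
  have : Fact (IsClosedIdeal (I.comap J.subtype)) := ⟨hI'⟩
  have : CompleteSpace J := hJ.1.completeSpace_coe
  refine commutator_apply_mem_of_maximal (I := I.comap J.subtype) (A := restrictOp A hAJ)
    (B := restrictOp B hBJ) (fun y hy => hA (y : E) hy) (fun y hy => hB (y : E) hy)
    (hC.imp (fun h y hy => h (y : E) hy) (fun h y hy => h (y : E) hy)) hn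
    (isCompactOperator_restrictOp_pow hAJ hcomp) (fun y hy => hAI (y : E) hy)
    (fun y hy => hBI (y : E) hy) (fun L hL hAL hBL hIL => ?_) ⟨x, hx⟩
  have hLJ : L.map J.subtype ≤ J := Submodule.map_subtype_le J L
  have hLc : IsClosedIdeal (L.map J.subtype) := by
    refine ⟨hJ.1.isClosedEmbedding_subtypeVal.isClosedMap _ hL.1, ?_⟩
    rintro y - hyz ⟨z, hz, rfl⟩
    have hy : y ∈ J := hJ.2 y z hyz z.2
    exact ⟨⟨y, hy⟩, hL.2 _ z hyz hz, rfl⟩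
  have hinj := Submodule.map_injective_of_injective J.subtype_injective
  have key := hgap (L.map J.subtype) hLc
    (by rintro - ⟨z, hz, rfl⟩; exact ⟨_, hAL z hz, rfl⟩)
    (by rintro - ⟨z, hz, rfl⟩; exact ⟨_, hBL z hz, rfl⟩)
    (fun y hy => ⟨⟨y, hIJ hy⟩, hIL hy, rfl⟩) hLJ
  refine key.imp (fun h => hinj ?_) (fun h => hinj ?_)
  · rw [h, Submodule.map_comap_subtype, inf_eq_right.2 hIJ]
  · rw [h, Submodule.map_subtype_top]

theorem exists_maximal_chain_within {α : Type*} [PartialOrder α] (S : Set α) {c : Set α}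
    (hcS : c ⊆ S) (hc : IsChain (· ≤ ·) c) :
    ∃ M, c ⊆ M ∧ M ⊆ S ∧ IsChain (· ≤ ·) M ∧
      ∀ D ⊆ S, IsChain (· ≤ ·) D → M ⊆ D → D = M := by
  have hbound (C : Set (Set α)) (hC : C ⊆ {D | D ⊆ S ∧ IsChain (· ≤ ·) D})
      (hCc : IsChain (· ⊆ ·) C) : ⋃₀ C ∈ {D | D ⊆ S ∧ IsChain (· ≤ ·) D} := by
    refine ⟨Set.sUnion_subset fun D hD => (hC hD).1, ?_⟩
    rintro x ⟨D, hD, hx⟩ y ⟨D', hD', hy⟩ hxy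
    rcases hCc.total hD hD' with h | h
    · exact (hC hD').2 (h hx) hy hxy
    · exact (hC hD).2 hx (h hy) hxy
  obtain ⟨M, hcM, hM⟩ := zorn_subset_nonempty {D | D ⊆ S ∧ IsChain (· ≤ ·) D}
    (fun C hC hCc _ => ⟨⋃₀ C, hbound C hC hCc, fun D hD => Set.subset_sUnion_of_mem hD⟩)
    c ⟨hcS, hc⟩
  exact ⟨M, hcM, hM.prop.1, hM.prop.2, fun D hDS hD hMD =>
    (hM.le_of_ge ⟨hDS, hD⟩ hMD).antisymm hMD⟩

theorem mem_of_maximal_chain {α : Type*} [PartialOrder α] {S M : Set α} (hMS : M ⊆ S)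
    (hM : IsChain (· ≤ ·) M) (hmax : ∀ D ⊆ S, IsChain (· ≤ ·) D → M ⊆ D → D = M) {a : α}
    (ha : a ∈ S) (hcomp : ∀ b ∈ M, a ≤ b ∨ b ≤ a) : a ∈ M := by
  rw [← hmax (insert a M) (Set.insert_subset ha hMS) (hM.insert fun b hb _ => hcomp b hb)
    (Set.subset_insert a M)]
  exact Set.mem_insert a M

theorem isClosedIdeal_topologicalClosure {I : Submodule ℝ E}
    (hI : ∀ x y : E, |x| ≤ |y| → y ∈ I → x ∈ I) : IsClosedIdeal I.topologicalClosure := by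
  refine ⟨I.isClosed_topologicalClosure, fun x y hxy hy => ?_⟩
  have hc : Continuous fun z : E => x ⊓ |z| ⊔ -|z| := by
    simp only [abs]
    fun_prop
  have hx : x ⊓ |y| ⊔ -|y| = x := by
    rw [inf_eq_left.2 ((le_abs_self x).trans hxy),
      sup_eq_left.2 ((neg_le_neg hxy).trans (neg_le.1 (neg_le_abs x)))]
  have hmaps : Set.MapsTo (fun z : E => x ⊓ |z| ⊔ -|z|) I I := fun z hz => by
    refine hI _ z (abs_le'.2 ⟨sup_le inf_le_right ?_, neg_le.2 le_sup_right⟩) hz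
    exact (neg_nonpos.2 (abs_nonneg z)).trans (abs_nonneg z)
  have hmem : x ⊓ |y| ⊔ -|y| ∈ closure (I : Set E) :=
    hmaps.closure hc (show y ∈ closure (I : Set E) from hy)
  rw [hx] at hmem
  exact hmem

theorem InvariantUnder.topologicalClosure {T : E →L[ℝ] E} {I : Submodule ℝ E}
    (hI : InvariantUnder T I) : InvariantUnder T I.topologicalClosure := by
  have hmaps : Set.MapsTo T I I := fun x hx => hI x hx
  exact fun x hx => hmaps.closure T.continuous (show x ∈ closure (I : Set E) from hx)

theorem isClosedIdeal_bot : IsClosedIdeal (⊥ : Submodule ℝ E) := by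
  refine ⟨by simp, fun x y hxy hy => ?_⟩
  rw [Submodule.mem_bot] at hy ⊢
  rw [hy, abs_zero] at hxy
  have h0 := hxy.antisymm (abs_nonneg x)
  rw [← norm_eq_zero, ← norm_abs_eq_norm, h0, norm_zero]

/-- The closed ideals invariant under both `A` and `B`. -/
def invariantClosedIdeals (A B : E →L[ℝ] E) : Set (Submodule ℝ E) :=
  {I | IsClosedIdeal I ∧ InvariantUnder A I ∧ InvariantUnder B I}

theorem sInf_mem_invariantClosedIdeals {A B : E →L[ℝ] E} {S : Set (Submodule ℝ E)}
    (hS : S ⊆ invariantClosedIdeals A B) : sInf S ∈ invariantClosedIdeals A B := by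
  simp only [invariantClosedIdeals, Set.mem_ofPred_eq, IsClosedIdeal, InvariantUnder,
    Submodule.mem_sInf]
  refine ⟨⟨?_, fun x y hxy hy I hI => (hS hI).1.2 x y hxy (hy I hI)⟩,
    fun x hx I hI => (hS hI).2.1 x (hx I hI), fun x hx I hI => (hS hI).2.2 x (hx I hI)⟩
  rw [Submodule.coe_sInf]
  exact isClosed_biInter fun I hI => (hS hI).1.1

theorem closure_sSup_mem_invariantClosedIdeals {A B : E →L[ℝ] E} {S : Set (Submodule ℝ E)}
    (hS : S ⊆ invariantClosedIdeals A B) (hne : S.Nonempty) (hchain : IsChain (· ≤ ·) S) :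
    (sSup S).topologicalClosure ∈ invariantClosedIdeals A B := by
  have hmem {x : E} : x ∈ sSup S ↔ ∃ I ∈ S, x ∈ I :=
    Submodule.mem_sSup_of_directed hne hchain.directedOn
  refine ⟨isClosedIdeal_topologicalClosure fun x y hxy hy => ?_,
    InvariantUnder.topologicalClosure fun x hx => ?_,
    InvariantUnder.topologicalClosure fun x hx => ?_⟩
  · obtain ⟨I, hI, hyI⟩ := hmem.1 hy
    exact hmem.2 ⟨I, hI, (hS hI).1.2 x y hxy hyI⟩
  · obtain ⟨I, hI, hxI⟩ := hmem.1 hx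
    exact hmem.2 ⟨I, hI, (hS hI).2.1 x hxI⟩
  · obtain ⟨I, hI, hxI⟩ := hmem.1 hx
    exact hmem.2 ⟨I, hI, (hS hI).2.2 x hxI⟩

/-- The commutator of semi-commuting positive operators, the first of which is power-compact, is
ideal-triangularizable. -/
theorem exists_maximal_chain_commutator [CompleteSpace E] {A B : E →L[ℝ] E} (hA : PositiveOp A)
    (hB : PositiveOp B) (hC : PositiveOp (A * B - B * A) ∨ PositiveOp (B * A - A * B)) {n : ℕ}
    (hn : 1 ≤ n) (hcomp : IsCompactOperator ⇑(A ^ n)) :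
    ∃ 𝒞 : Set (Submodule ℝ E), (∀ I ∈ 𝒞, IsClosedIdeal I) ∧
      (∀ I ∈ 𝒞, InvariantUnder (A * B - B * A) I) ∧ IsChain (· ≤ ·) 𝒞 ∧
      (∀ 𝒟 : Set (Submodule ℝ E), (∀ I ∈ 𝒟, IsClosedIdeal I) → IsChain (· ≤ ·) 𝒟 →
        𝒞 ⊆ 𝒟 → 𝒟 = 𝒞) := by
  obtain ⟨𝒜, hbot, h𝒜S, h𝒜, h𝒜max⟩ := exists_maximal_chain_within (invariantClosedIdeals A B)
    (c := {⊥}) (Set.singleton_subset_iff.2 ⟨isClosedIdeal_bot,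
      fun x hx => by simp_all, fun x hx => by simp_all⟩) IsChain.singleton
  obtain ⟨𝒞, h𝒜𝒞, h𝒞S, h𝒞, h𝒞max⟩ := exists_maximal_chain_within
    {I : Submodule ℝ E | IsClosedIdeal I} (fun I hI => (h𝒜S hI).1) h𝒜
  refine ⟨𝒞, h𝒞S, fun J hJ => ?_, h𝒞, h𝒞max⟩
  set lower : Set (Submodule ℝ E) := {I ∈ 𝒜 | I ≤ J} with hlower
  set upper : Set (Submodule ℝ E) := {I ∈ 𝒜 | J ≤ I} with hupper
  have hsplit (I : Submodule ℝ E) (hI : I ∈ 𝒜) : I ∈ lower ∨ I ∈ upper :=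
    (h𝒞.total (h𝒜𝒞 hI) hJ).imp (fun h => ⟨hI, h⟩) (fun h => ⟨hI, h⟩)
  set I₁ := (sSup lower).topologicalClosure with hI₁
  set I₂ := sInf upper with hI₂
  have hI₁J : I₁ ≤ J :=
    Submodule.topologicalClosure_minimal _ (sSup_le fun I hI => hI.2) (h𝒞S hJ).1
  have hJI₂ : J ≤ I₂ := le_sInf fun I hI => hI.2
  have hle₁ (I : Submodule ℝ E) (hI : I ∈ lower) : I ≤ I₁ :=
    (le_sSup hI).trans (Submodule.le_topologicalClosure _)
  have hle₂ (I : Submodule ℝ E) (hI : I ∈ upper) : I₂ ≤ I := sInf_le hI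
  have hI₁S : I₁ ∈ invariantClosedIdeals A B :=
    closure_sSup_mem_invariantClosedIdeals (fun I hI => h𝒜S hI.1)
      ⟨⊥, hbot rfl, bot_le⟩ (h𝒜.mono fun I hI => hI.1)
  have hI₂S : I₂ ∈ invariantClosedIdeals A B :=
    sInf_mem_invariantClosedIdeals fun I hI => h𝒜S hI.1
  intro x hx
  refine hI₁J (commutator_apply_mem_of_gap hA hB hC hn hcomp (hI₁J.trans hJI₂) hI₁S.1 hI₂S.1
    hI₁S.2.1 hI₁S.2.2 hI₂S.2.1 hI₂S.2.2 (fun L hL hAL hBL h₁ h₂ => ?_) (hJI₂ hx))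
  have hL𝒜 : L ∈ 𝒜 := mem_of_maximal_chain h𝒜S h𝒜 h𝒜max ⟨hL, hAL, hBL⟩ fun I hI =>
    (hsplit I hI).symm.imp (fun h => h₂.trans (hle₂ I h)) (fun h => (hle₁ I h).trans h₁)
  exact (hsplit L hL𝒜).imp (fun h => (hle₁ L h).antisymm h₁) (fun h => h₂.antisymm (hle₂ L h))

end BanachLattice

/-- If `A` and `B` are positive operators on a Banach lattice `E` with positive
commutator `C = A B - B A`, and one of `A`, `B` is power-compact, then `C` is
ideal-triangularizable: there is a chain of closed ideals, each invariant under `C`,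
which is maximal as a chain in the lattice of all closed ideals of `E`. -/
theorem stmt3 {E : Type*} [NormedAddCommGroup E] [Lattice E] [HasSolidNorm E] [IsOrderedAddMonoid E]
    [NormedSpace ℝ E] [CompleteSpace E]
    (A B : E →L[ℝ] E)
    (hA : ∀ x : E, 0 ≤ x → 0 ≤ A x)
    (hB : ∀ x : E, 0 ≤ x → 0 ≤ B x)
    (hC : ∀ x : E, 0 ≤ x → 0 ≤ (A * B - B * A) x)
    (hpc : (∃ n : ℕ, 1 ≤ n ∧ IsCompactOperator ⇑(A ^ n)) ∨
           (∃ n : ℕ, 1 ≤ n ∧ IsCompactOperator ⇑(B ^ n))) :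
    ∃ 𝒞 : Set (Submodule ℝ E),
      (∀ I ∈ 𝒞, IsClosedIdeal I) ∧
      (∀ I ∈ 𝒞, InvariantUnder (A * B - B * A) I) ∧
      IsChain (· ≤ ·) 𝒞 ∧
      (∀ 𝒟 : Set (Submodule ℝ E), (∀ I ∈ 𝒟, IsClosedIdeal I) → IsChain (· ≤ ·) 𝒟 →
        𝒞 ⊆ 𝒟 → 𝒟 = 𝒞) := by
  rcases hpc with ⟨n, hn, hn'⟩ | ⟨n, hn, hn'⟩
  · exact exists_maximal_chain_commutator hA hB (.inl hC) hn hn'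
  · obtain ⟨𝒞, h𝒞, hinv, hmax⟩ := exists_maximal_chain_commutator hB hA (.inr hC) hn hn'
    refine ⟨𝒞, h𝒞, fun I hI x hx => ?_, hmax⟩
    rw [← neg_sub, neg_apply]
    exact I.neg_mem (hinv I hI x hx)
end
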